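/- arXiv:1308.3604 — 6 statements merged into one kernel-verified Lean document; each statement's English description precedes it below -/
import Mathlib

section
/- Let L be a Lie algebra over ℤ that is free of finite rank as a ℤ-module. Then there exist an integer D > 0 and a real constant ε with 0 < ε ≤ 1 such that the following holds: for every prime p and every ℤ_p-Lie subalgebra M of L_p = L ⊗_ℤ ℤ_p that is an open ℤ_p-submodule of level p^n with n > v_p(D), there exists a proper isolated ℤ_p-Lie subalgebra I of L_p such that M ⊆ I + p^⌈ε·n⌉ L_p. -/
theorem fl_lift_field (O : Type) [CommRing O] (K : Type) [Field K] [CharZero K]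
    (res : O →+* K) (hsurj : Function.Surjective res)
    (hloc : ∀ x, res x ≠ 0 → IsUnit x)
    (hens : ∀ (f : Polynomial O) (a : O), res (f.eval a) = 0 → res (f.derivative.eval a) ≠ 0 →
      ∃ b, f.eval b = 0 ∧ res b = res a)
    {ι : Type} [Finite ι] (x : ι → O) :
    ∃ y : ι → O, (∀ i, res (y i) = res (x i)) ∧
      ∀ f : MvPolynomial ι ℤ, res (MvPolynomial.aeval x f) = 0 → MvPolynomial.aeval y f = 0 := by
  classical
  have : FaithfulSMul ℤ K := by
    exact (faithfulSMul_iff_algebraMap_injective ℤ K).2 (algebraMap ℤ K).injective_int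
  obtain ⟨B, hB⟩ := exists_isTranscendenceBasis ℤ K
  choose ℓ hℓ using fun b : B => hsurj b.1
  let φ : MvPolynomial B ℤ →ₐ[ℤ] O := MvPolynomial.aeval ℓ
  have hres : ∀ g, res (φ g) = MvPolynomial.aeval ((↑) : B → K) g := by
    intro g
    have : (res.toIntAlgHom.comp φ) = MvPolynomial.aeval ((↑) : B → K) := by
      apply MvPolynomial.algHom_ext
      intro b
      simp [φ, hℓ]
    exact DFunLike.congr_fun this g
  have hunit : ∀ g : nonZeroDivisors (MvPolynomial B ℤ), IsUnit ((φ : MvPolynomial B ℤ →+* O) g) := by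
    intro g
    by_contra h
    have h1 : res (φ g) = 0 := by
      by_contra h'
      exact h (hloc _ h')
    rw [hres] at h1
    have h2 := hB.1
    rw [algebraicIndependent_iff] at h2
    exact nonZeroDivisors.coe_ne_zero g (h2 _ h1)
  let k := FractionRing (MvPolynomial B ℤ)
  let ψ : k →+* O := IsLocalization.lift (M := nonZeroDivisors (MvPolynomial B ℤ)) hunit
  have hψ : ∀ g, ψ (algebraMap _ k g) = φ g := fun g => IsLocalization.lift_eq hunit g
  let _ : Algebra k O := ψ.toAlgebra
  let _ : Algebra O K := res.toAlgebra
  let _ : Algebra k K := (res.comp ψ).toAlgebra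
  have : IsScalarTower k O K := IsScalarTower.of_algebraMap_eq (fun _ => rfl)
  have : CharZero k := inferInstance
  have hint : Algebra.IsIntegral k K := by
    rw [← Algebra.isAlgebraic_iff_isIntegral]
    constructor
    intro a
    have ha := hB.isAlgebraic.isAlgebraic a
    obtain ⟨q, hq0, hq⟩ := ha
    let e := hB.1.aevalEquiv
    have hinj : Function.Injective ((algebraMap (MvPolynomial B ℤ) k).comp (e.symm.toRingEquiv.toRingHom)) := by
      intro u v huv
      have := IsFractionRing.injective (MvPolynomial B ℤ) k huv
      exact e.symm.injective this
    refine ⟨q.map ((algebraMap (MvPolynomial B ℤ) k).comp (e.symm.toRingEquiv.toRingHom)), ?_, ?_⟩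
    · rwa [Ne, Polynomial.map_eq_zero_iff hinj]
    · rw [Polynomial.aeval_def, Polynomial.eval₂_map]
      rw [Polynomial.aeval_def] at hq
      rw [← hq]
      congr 1
      ext u
      change res (ψ (algebraMap _ k (e.symm u))) = _
      rw [hψ, hres, ← hB.1.algebraMap_aevalEquiv]
      simp [e]
  let xb : ι → K := fun i => res (x i)
  let E : IntermediateField k K := IntermediateField.adjoin k (Set.range xb)
  have : FiniteDimensional k E := by
    apply IntermediateField.finiteDimensional_adjoin
    intro z _
    exact Algebra.IsIntegral.isIntegral z
  let pb : PowerBasis k E := Field.powerBasisOfFiniteOfSeparable k E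
  obtain ⟨θ, hgen⟩ : ∃ θ, pb.gen = θ := ⟨_, rfl⟩
  have hθi : IsIntegral k θ := Algebra.IsIntegral.isIntegral θ
  have hsep : (minpoly k θ).Separable := (minpoly.irreducible hθi).separable
  let F : Polynomial O := (minpoly k θ).map (algebraMap k O)
  have haev : ∀ g : Polynomial k, Polynomial.aeval (θ : K) (g.map (algebraMap k O)) = ((Polynomial.aeval θ g : E) : K) := by
    intro g
    rw [Polynomial.aeval_map_algebraMap]
    exact (Polynomial.aeval_algebraMap_apply K θ g)
  obtain ⟨a, ha⟩ := hsurj (θ : K)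
  have hev : ∀ g : Polynomial k, res ((g.map (algebraMap k O)).eval a) = ((Polynomial.aeval θ g : E) : K) := by
    intro g
    rw [← haev, ← ha, Polynomial.eval₂_at_apply _ _ |>.symm]
    rfl
  obtain ⟨t, ht, htθ⟩ := hens F a (by rw [hev]; simp) (by
      rw [Polynomial.derivative_map, hev]
      intro h0
      have h0' : Polynomial.aeval θ (Polynomial.derivative (minpoly k θ)) = 0 := by
        exact_mod_cast h0
      exact hsep.aeval_derivative_ne_zero (minpoly.aeval k θ) h0')
  rw [ha] at htθ
  let σ : E →ₐ[k] O := pb.lift t (by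
    rw [hgen]
    have := ht
    rw [Polynomial.eval_map_algebraMap] at this
    exact this)
  have hσ : ∀ u : E, res (σ u) = u := by
    have : (IsScalarTower.toAlgHom k O K).comp σ = E.val := by
      apply pb.algHom_ext
      rw [AlgHom.comp_apply, pb.lift_gen]
      simp [hgen]
      exact htθ
    intro u
    exact DFunLike.congr_fun this u
  have hmem : ∀ i, xb i ∈ E := fun i => IntermediateField.subset_adjoin _ _ ⟨i, rfl⟩
  let xe : ι → E := fun i => ⟨xb i, hmem i⟩
  refine ⟨fun i => σ (xe i), ?_, ?_⟩
  · intro i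
    exact hσ _
  · intro f hf
    have hx : MvPolynomial.aeval xb f = 0 := by
      have h2 := DFunLike.congr_fun (MvPolynomial.comp_aeval x (res.toIntAlgHom)) f
      rw [AlgHom.comp_apply] at h2
      exact h2.symm.trans hf
    have h1 : MvPolynomial.aeval xe f = 0 := by
      apply E.val.toRingHom.injective
      have h2 := DFunLike.congr_fun (MvPolynomial.comp_aeval xe (E.val.toRingHom.toIntAlgHom)) f
      rw [AlgHom.comp_apply] at h2
      rw [map_zero]
      exact h2.trans hx
    have h3 := DFunLike.congr_fun (MvPolynomial.comp_aeval xe (σ.toRingHom.toIntAlgHom)) f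
    rw [AlgHom.comp_apply, h1, map_zero] at h3
    exact h3.symm

section Ultra
variable (p : ℕ → ℕ) [hp : ∀ k, Fact (p k).Prime] (n : ℕ → ℕ) (U : Ultrafilter ℕ)

/-- sequences eventually divisible by `p ^ n` -/
noncomputable def flQ : Ideal (∀ k, ℤ_[p k]) where
  carrier := {x | ∀ᶠ k in (U : Filter ℕ), (p k : ℤ_[p k]) ^ n k ∣ x k}
  add_mem' := by
    intro a b ha hb
    filter_upwards [ha, hb] with k h1 h2 using dvd_add h1 h2
  zero_mem' := by simp
  smul_mem' := by
    intro c a ha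
    filter_upwards [ha] with k h1 using Dvd.dvd.mul_left h1 _

/-- sequences of valuation at least a positive multiple of `n` -/
noncomputable def flP : Ideal (∀ k, ℤ_[p k]) := (flQ p n U).radical

theorem mem_flP {x : ∀ k, ℤ_[p k]} :
    x ∈ flP p n U ↔ ∃ N : ℕ, ∀ᶠ k in (U : Filter ℕ), (p k : ℤ_[p k]) ^ n k ∣ x k ^ N := Iff.rfl

theorem not_mem_flP {x : ∀ k, ℤ_[p k]} :
    x ∉ flP p n U ↔ ∀ N : ℕ, ∀ᶠ k in (U : Filter ℕ), ¬ (p k : ℤ_[p k]) ^ n k ∣ x k ^ N := by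
  rw [mem_flP, not_exists]
  exact forall_congr' fun N => Ultrafilter.eventually_not.symm

theorem fl_dvd_total (q : ℕ) [Fact q.Prime] (x y : ℤ_[q]) : x ∣ y ∨ y ∣ x :=
  ValuationRing.dvd_total x y

theorem flP_prime (h1 : (1 : ∀ k, ℤ_[p k]) ∉ flP p n U) : (flP p n U).IsPrime := by
  refine ⟨fun h => h1 (h ▸ Submodule.mem_top), ?_⟩
  intro x y hxy
  obtain ⟨N, hN⟩ := (mem_flP p n U).1 hxy
  have : ∀ᶠ k in (U : Filter ℕ), ((p k : ℤ_[p k]) ^ n k ∣ x k ^ (N + N) ∨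
      (p k : ℤ_[p k]) ^ n k ∣ y k ^ (N + N)) := by
    filter_upwards [hN] with k hk
    have hk' : (p k : ℤ_[p k]) ^ n k ∣ x k ^ N * y k ^ N := by
      rw [← mul_pow]; exact hk
    rcases fl_dvd_total _ (x k) (y k) with h | h
    · right
      rw [pow_add]
      exact hk'.trans (mul_dvd_mul_right (pow_dvd_pow_of_dvd h N) _)
    · left
      rw [pow_add]
      exact hk'.trans (mul_dvd_mul_left _ (pow_dvd_pow_of_dvd h N))
  rcases Ultrafilter.eventually_or.1 this with h | h
  · exact Or.inl ((mem_flP p n U).2 ⟨_, h⟩)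
  · exact Or.inr ((mem_flP p n U).2 ⟨_, h⟩)

theorem flP_of_eventually_zero {x : ∀ k, ℤ_[p k]} (h : ∀ᶠ k in (U : Filter ℕ), x k = 0) :
    x ∈ flP p n U :=
  (mem_flP p n U).2 ⟨1, by filter_upwards [h] with k hk; simp [hk]⟩

theorem fl_eventually_ne {x : ∀ k, ℤ_[p k]} (h : x ∉ flP p n U) :
    ∀ᶠ k in (U : Filter ℕ), x k ≠ 0 := by
  filter_upwards [(not_mem_flP p n U).1 h 1] with k hk h0
  apply hk
  simp [h0]

theorem fl_hensel (hP : (flP p n U).IsPrime) (G : Polynomial (∀ k, ℤ_[p k])) (a : ∀ k, ℤ_[p k])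
    (h0 : G.eval a ∈ flP p n U) (h1 : G.derivative.eval a ∉ flP p n U) :
    ∃ z : ∀ k, ℤ_[p k], (∀ᶠ k in (U : Filter ℕ), G.eval z k = 0) ∧ z - a ∈ flP p n U := by
  classical
  have hcomp : ∀ (G : Polynomial (∀ k, ℤ_[p k])) (a : ∀ k, ℤ_[p k]) k,
      (G.map (Pi.evalRingHom _ k)).eval (a k) = G.eval a k := by
    intro G a k
    exact Polynomial.eval_map_apply (f := Pi.evalRingHom _ k) (p := G) a
  obtain ⟨N, hN⟩ := (mem_flP p n U).1 h0
  have hE : ∀ᶠ k in (U : Filter ℕ), ∃ z : ℤ_[p k],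
      (G.map (Pi.evalRingHom _ k)).eval z = 0 ∧ ‖z - a k‖ < ‖G.derivative.eval a k‖ := by
    filter_upwards [hN, (not_mem_flP p n U).1 h1 (2 * N)] with k hk hk'
    have hlt : ‖G.eval a k‖ < ‖G.derivative.eval a k‖ ^ 2 := by
      by_contra hge
      push Not at hge
      rw [← norm_pow] at hge
      have hd : G.eval a k ∣ (G.derivative.eval a k) ^ 2 := by
        rcases fl_dvd_total _ (G.eval a k) ((G.derivative.eval a k) ^ 2) with h | h
        · exact h
        · obtain ⟨c, hc⟩ := h
          by_cases hz : (G.derivative.eval a k) ^ 2 = 0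
          · rw [hz]; exact dvd_zero _
          have hc1 : ‖c‖ = 1 := by
            apply le_antisymm (PadicInt.norm_le_one c)
            rw [hc, norm_mul] at hge
            have := norm_pos_iff.2 hz
            by_contra hcc
            push Not at hcc
            nlinarith
          rw [hc]
          exact (associated_mul_unit_right _ _ (PadicInt.isUnit_iff.2 hc1)).symm.dvd
      apply hk'
      rw [pow_mul]
      exact hk.trans (pow_dvd_pow_of_dvd hd N)
    obtain ⟨z, hz, hz2, -⟩ := hensels_lemma (F := G.map (Pi.evalRingHom _ k)) (a := a k) (by
      rw [Polynomial.coe_aeval_eq_eval, Polynomial.derivative_map, hcomp]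
      rw [hcomp]
      exact hlt)
    rw [Polynomial.coe_aeval_eq_eval] at hz hz2
    rw [Polynomial.derivative_map, hcomp] at hz2
    exact ⟨z, hz, hz2⟩
  let z : ∀ k, ℤ_[p k] := fun k =>
    if h : ∃ z : ℤ_[p k], (G.map (Pi.evalRingHom _ k)).eval z = 0 ∧
      ‖z - a k‖ < ‖G.derivative.eval a k‖ then h.choose else 0
  have hz : ∀ᶠ k in (U : Filter ℕ), G.eval z k = 0 ∧
      ‖z k - a k‖ < ‖G.derivative.eval a k‖ := by
    filter_upwards [hE] with k hk
    rw [← hcomp]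
    have : z k = hk.choose := dif_pos hk
    rw [this]
    exact hk.choose_spec
  refine ⟨z, hz.mono fun k h => h.1, ?_⟩
  -- Taylor expansion
  obtain ⟨c, hc⟩ := G.binomExpansion a (z - a)
  rw [add_sub_cancel] at hc
  have hGz : G.eval z ∈ flP p n U := flP_of_eventually_zero p n U (hz.mono fun k h => h.1)
  have hmul : (z - a) * (G.derivative.eval a + c * (z - a)) ∈ flP p n U := by
    have : (z - a) * (G.derivative.eval a + c * (z - a)) = G.eval z - G.eval a := by
      rw [hc]; ring
    rw [this]
    exact sub_mem hGz h0
  rcases hP.mem_or_mem hmul with h | h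
  · exact h
  · exfalso
    apply h1
    obtain ⟨N, hN⟩ := (mem_flP p n U).1 h
    refine (mem_flP p n U).2 ⟨N, ?_⟩
    filter_upwards [hN, hz] with k hk hk2
    refine hk.trans (pow_dvd_pow_of_dvd ?_ N)
    -- z - a = derivative * t with t nonunit
    have hd : ∃ t, z k - a k = G.derivative.eval a k * t ∧ ‖t‖ < 1 := by
      rcases fl_dvd_total _ (G.derivative.eval a k) (z k - a k) with h | h
      · obtain ⟨t, ht⟩ := h
        refine ⟨t, ht, ?_⟩
        have := hk2.2
        rw [ht, norm_mul] at this
        have h0 := norm_nonneg (G.derivative.eval a k)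
        by_contra hcc
        push Not at hcc
        nlinarith
      · obtain ⟨t, ht⟩ := h
        exfalso
        have := hk2.2
        rw [ht, norm_mul] at this
        have h0 := norm_nonneg (z k - a k)
        have := PadicInt.norm_le_one t
        nlinarith
    obtain ⟨t, ht, ht1⟩ := hd
    have hu : IsUnit (1 + c k * t) := by
      rw [PadicInt.isUnit_iff]
      by_contra hne
      have h2 : ‖1 + c k * t‖ < 1 := lt_of_le_of_ne (PadicInt.norm_le_one _) hne
      have h3 : ‖c k * t‖ < 1 := by
        rw [norm_mul]
        have := PadicInt.norm_le_one (c k)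
        have := norm_nonneg t
        nlinarith
      have h4 : (1 : ℤ_[p k]) = (1 + c k * t) + (-(c k * t)) := by ring
      have h5 := PadicInt.nonarchimedean (1 + c k * t) (-(c k * t))
      rw [← h4, norm_neg, norm_one] at h5
      exact absurd (max_lt h2 h3) (not_lt.2 h5)
    have : (G.derivative.eval a + c * (z - a)) k = G.derivative.eval a k * (1 + c k * t) := by
      simp only [Pi.add_apply, Pi.mul_apply, Pi.sub_apply, ht]; ring
    rw [this]
    exact (associated_mul_unit_left _ _ hu).dvd

theorem fl_lift_aux (hP : (flP p n U).IsPrime)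
    (O : Type) [CommRing O] (K : Type) [Field K] [CharZero K]
    (al : (∀ k, ℤ_[p k]) →+* O) (res : O →+* K)
    (hresal : ∀ r : (∀ k, ℤ_[p k]), res (al r) = 0 ↔ r ∈ (flP p n U))
    (hal : ∀ r : (∀ k, ℤ_[p k]), al r = 0 ↔ ∀ᶠ k in (U : Filter ℕ), r k = 0)
    (hunit : ∀ s : (∀ k, ℤ_[p k]), s ∉ (flP p n U) → IsUnit (al s))
    (hfrac : ∀ o : O, ∃ a s : (∀ k, ℤ_[p k]), s ∉ (flP p n U) ∧ al a = al s * o)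
    (hsurj : Function.Surjective res)
    (hloc : ∀ x, res x ≠ 0 → IsUnit x)
    (hnorm : ∀ f : Polynomial O, ∃ b : (∀ k, ℤ_[p k]), b ∉ (flP p n U) ∧ ∃ F : Polynomial (∀ k, ℤ_[p k]),
      F.map al = Polynomial.C (al b) * f)
    {ι : Type} [Finite ι] (x : ι → (∀ k, ℤ_[p k])) :
    ∃ y : ι → (∀ k, ℤ_[p k]), (∀ i, y i - x i ∈ flP p n U) ∧
      ∀ f : MvPolynomial ι ℤ, MvPolynomial.aeval x f ∈ flP p n U →
        ∀ᶠ k in (U : Filter ℕ), (MvPolynomial.aeval y f) k = 0 := by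
  classical
  have hens : ∀ (f : Polynomial O) (a : O), res (f.eval a) = 0 → res (f.derivative.eval a) ≠ 0 →
      ∃ b, f.eval b = 0 ∧ res b = res a := by
    intro f o h0 h1
    obtain ⟨b, hb, F, hF'⟩ := hnorm f
    obtain ⟨a, t, ht, hat⟩ := hfrac o
    let G := F.scaleRoots t
    let d := F.natDegree
    have hcomp : (G.map al).comp (Polynomial.C (al t) * Polynomial.X) =
        Polynomial.C (al t) ^ d * (Polynomial.C (al b) * f) := by
      have := Polynomial.scaleRoots_eval₂_mul (p := F) (Polynomial.C.comp al) Polynomial.X t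
      rw [← hF', Polynomial.comp, Polynomial.eval₂_map]
      refine this.trans ?_
      rw [← Polynomial.eval₂_map, Polynomial.eval₂_C_X]
      rfl
    have hE : ∀ u, al t ^ d * (al b * f.eval u) = (G.map al).eval (al t * u) := by
      intro u
      have := congrArg (Polynomial.eval u) hcomp
      simpa [Polynomial.eval_comp] using this.symm
    have hD : al t ^ d * (al b * f.derivative.eval o) = al t * (G.derivative.map al).eval (al t * o) := by
      have := congrArg (fun g => Polynomial.eval o (Polynomial.derivative g)) hcomp
      rw [← Polynomial.C_pow] at this
      simp only [Polynomial.derivative_comp, Polynomial.eval_comp, Polynomial.derivative_map,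
        Polynomial.derivative_C_mul, Polynomial.eval_mul, Polynomial.eval_C, Polynomial.eval_X,
        Polynomial.derivative_X, mul_one] at this
      exact this.symm
    have hev : ∀ (H : Polynomial (∀ k, ℤ_[p k])) (r : (∀ k, ℤ_[p k])), (H.map al).eval (al r) = al (H.eval r) :=
      fun H r => Polynomial.eval_map_apply (f := al) r
    obtain ⟨z, hz, hza⟩ := fl_hensel p n U hP G a (by
        apply (hresal _).1
        rw [← hev, hat, ← hE, map_mul, map_mul, h0, mul_zero, mul_zero]) (by
        intro hmem
        have h3 := (hresal _).2 hmem
        rw [← hev, hat] at h3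
        have h4 := congrArg res hD
        rw [map_mul, map_mul, map_mul res (al t), h3, mul_zero, map_pow] at h4
        rcases mul_eq_zero.1 h4 with h | h
        · exact ht ((hresal _).1 (eq_zero_of_pow_eq_zero h))
        · rcases mul_eq_zero.1 h with h | h
          · exact hb ((hresal _).1 h)
          · exact h1 h)
    have htu := hunit t ht
    obtain ⟨w, hw⟩ : ∃ w, al z = al t * w := by
      obtain ⟨v, hv⟩ := htu.exists_right_inv
      exact ⟨v * al z, by rw [← mul_assoc, hv, one_mul]⟩
    refine ⟨w, ?_, ?_⟩
    · have h5 := hE w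
      rw [← hw, hev, (hal _).2 hz] at h5
      have h6 := (htu.pow d).mul_right_eq_zero.1 h5
      exact (hunit b hb).mul_right_eq_zero.1 h6
    · have h7 := (hresal _).2 hza
      rw [map_sub, hw, hat, ← mul_sub, map_mul] at h7
      rcases mul_eq_zero.1 h7 with h | h
      · exact absurd ((hresal _).1 h) ht
      · rw [map_sub] at h
        exact sub_eq_zero.1 h
  obtain ⟨y', hy', hyf⟩ := fl_lift_field O K res hsurj hloc hens (fun i => al (x i))
  have hm : ∀ o : O, res o = 0 → ∃ r ∈ (flP p n U), al r = o := by
    intro o ho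
    obtain ⟨q, s, hs, hqs⟩ := hfrac o
    have hq : q ∈ (flP p n U) := by
      rw [← hresal, hqs, map_mul, ho, mul_zero]
    have hdvd : ∀ᶠ k in (U : Filter ℕ), s k ∣ q k := by
      obtain ⟨N, hN⟩ := (mem_flP p n U).1 hq
      filter_upwards [hN, (not_mem_flP p n U).1 hs N] with k h1 h2
      rcases fl_dvd_total _ (s k) (q k) with h | h
      · exact h
      · exact absurd (h1.trans (pow_dvd_pow_of_dvd h N)) h2
    let r : (∀ k, ℤ_[p k]) := fun k => if h : s k ∣ q k then h.choose else 0
    have hr : al (s * r - q) = 0 := by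
      rw [hal]
      filter_upwards [hdvd] with k hk
      have : r k = hk.choose := dif_pos hk
      simp only [Pi.sub_apply, Pi.mul_apply, this]
      rw [← hk.choose_spec, sub_self]
    rw [map_sub, map_mul, sub_eq_zero, hqs] at hr
    have hro := (hunit s hs).mul_left_cancel hr
    refine ⟨r, ?_, hro⟩
    rw [← hresal, hro, ho]
  choose r hr hr' using fun i => hm (y' i - al (x i)) (by rw [map_sub, hy', sub_self])
  refine ⟨fun i => x i + r i, fun i => by simpa using hr i, ?_⟩
  intro f hf
  rw [← hal]
  have hyy : (fun i => al (x i + r i)) = y' := by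
    funext i
    rw [map_add, hr']; ring
  have hmap : ∀ v : ι → (∀ k, ℤ_[p k]), al (MvPolynomial.aeval v f) = MvPolynomial.aeval (fun i => al (v i)) f := by
    intro v
    exact DFunLike.congr_fun (MvPolynomial.comp_aeval v (al.toIntAlgHom)) f
  rw [hmap, hyy]
  apply hyf
  rw [← hmap]
  exact (hresal _).2 hf

theorem fl_lift (hchar : ∀ m : ℕ, m ≠ 0 → (m : ∀ k, ℤ_[p k]) ∉ flP p n U)
    {ι : Type} [Finite ι] (x : ι → ∀ k, ℤ_[p k]) :
    ∃ y : ι → ∀ k, ℤ_[p k], (∀ i, y i - x i ∈ flP p n U) ∧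
      ∀ f : MvPolynomial ι ℤ, MvPolynomial.aeval x f ∈ flP p n U →
        ∀ᶠ k in (U : Filter ℕ), (MvPolynomial.aeval y f) k = 0 := by
  classical
  have hP : (flP p n U).IsPrime := flP_prime p n U (by simpa using hchar 1 one_ne_zero)
  let R := ∀ k, ℤ_[p k]
  let P : Ideal R := flP p n U
  have : P.IsPrime := hP
  let O := Localization.AtPrime P
  let K := IsLocalRing.ResidueField O
  let al : R →+* O := algebraMap R O
  let res : O →+* K := IsLocalRing.residue O
  have hresal : ∀ r : R, res (al r) = 0 ↔ r ∈ P := by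
    intro r
    rw [IsLocalRing.residue_eq_zero_iff]
    exact IsLocalization.AtPrime.to_map_mem_maximal_iff O P r
  have hal : ∀ r : (∀ k, ℤ_[p k]), al r = 0 ↔ ∀ᶠ k in (U : Filter ℕ), r k = 0 := by
    intro r
    rw [IsLocalization.map_eq_zero_iff P.primeCompl O]
    constructor
    · rintro ⟨s, hs⟩
      filter_upwards [fl_eventually_ne p n U s.2] with k hk
      have h3 : (s : ∀ k, ℤ_[p k]) k * r k = 0 := congrFun hs k
      exact (mul_eq_zero.1 h3).resolve_left hk
    · intro h
      let s : (∀ k, ℤ_[p k]) := fun k => if r k = 0 then 1 else 0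
      have hs : s ∉ (flP p n U) := by
        intro hs
        apply hP.ne_top
        rw [Ideal.eq_top_iff_one]
        have h2 : (1 : (∀ k, ℤ_[p k])) = s + (1 - s) := by ring
        rw [h2]
        refine add_mem hs (flP_of_eventually_zero p n U ?_)
        filter_upwards [h] with k hk
        simp [s, hk]
      refine ⟨⟨s, hs⟩, ?_⟩
      funext k
      change s k * r k = 0
      by_cases hk : r k = 0 <;> simp [s, hk]
  have hunit : ∀ s : R, s ∉ P → IsUnit (al s) := fun s hs =>
    IsLocalization.map_units O (⟨s, hs⟩ : P.primeCompl)
  have hfrac : ∀ o : O, ∃ a s : R, s ∉ P ∧ al a = al s * o := by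
    intro o
    obtain ⟨⟨a, s⟩, h⟩ := IsLocalization.surj P.primeCompl o
    exact ⟨a, s, s.2, by rw [mul_comm]; exact h.symm⟩
  have hK : CharZero K := by
    apply charZero_of_inj_zero
    intro m hm
    by_contra hm0
    apply hchar m hm0
    apply (hresal _).1
    rw [map_natCast, map_natCast]
    exact hm
  have hsurj : Function.Surjective res := IsLocalRing.residue_surjective
  have hloc : ∀ x, res x ≠ 0 → IsUnit x := fun x hx =>
    (IsLocalRing.residue_ne_zero_iff_isUnit x).1 hx
  refine fl_lift_aux p n U hP O K al res hresal hal hunit hfrac hsurj hloc ?_ x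
  intro f
  obtain ⟨b, hb, hF⟩ := IsLocalization.integerNormalization_spec P.primeCompl f
  refine ⟨b, hb, IsLocalization.integerNormalization P.primeCompl f, ?_⟩
  change Polynomial.map (algebraMap R O) _ = _
  rw [hF, Polynomial.C_mul']
  exact (algebraMap_smul O b f).symm
end Ultra

open scoped TensorProduct

theorem fl_final {q : ℕ} [Fact q.Prime] {V : Type} [LieRing V] [LieAlgebra ℤ_[q] V]
    {ι : Type} [Fintype ι] (e : Module.Basis ι ℤ_[q] V) (J : Set ι) (hJ : J ≠ Set.univ)
    (v : ι → V) (hv : ∀ i, ∃ w, v i = e i + (q : ℤ_[q]) • w)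
    (hbr : ∀ i ∈ J, ∀ j ∈ J, ⁅v i, v j⁆ ∈ Submodule.span ℤ_[q] (v '' J)) :
    ∃ I : LieSubalgebra ℤ_[q] V, I ≠ ⊤ ∧ (∀ x : V, (q : ℤ_[q]) • x ∈ I → x ∈ I) ∧
      ∀ j ∈ J, v j ∈ I := by
  classical
  choose w hw using hv
  have hdet : IsUnit (e.det v) := by
    rw [Module.Basis.det_apply]
    apply isUnit_of_map_unit (IsLocalRing.residue ℤ_[q])
    rw [RingHom.map_det]
    have : (IsLocalRing.residue ℤ_[q]).mapMatrix (e.toMatrix v) = 1 := by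
      ext i j
      rw [RingHom.mapMatrix_apply, Matrix.map_apply, Module.Basis.toMatrix_apply, hw, map_add, map_smul,
        Finsupp.add_apply, Finsupp.smul_apply, map_add, Module.Basis.repr_self, smul_eq_mul, map_mul]
      have h0 : IsLocalRing.residue ℤ_[q] (q : ℤ_[q]) = 0 := by
        rw [IsLocalRing.residue_eq_zero_iff, PadicInt.maximalIdeal_eq_span_p]
        exact Ideal.mem_span_singleton_self _
      rw [h0, zero_mul, add_zero, Finsupp.single_apply, Matrix.one_apply]
      by_cases h : i = j
      · simp [h]
      · simp [h, Ne.symm h]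
    rw [this, Matrix.det_one]
    exact isUnit_one
  obtain ⟨hli, hsp⟩ := (Module.Basis.is_basis_iff_det e).2 hdet
  let b := Module.Basis.mk hli hsp.ge
  have hb : ⇑b = v := Module.Basis.coe_mk _ _
  let I : LieSubalgebra ℤ_[q] V :=
    { Submodule.span ℤ_[q] (v '' J) with
      lie_mem' := by
        intro x y hx hy
        change x ∈ Submodule.span ℤ_[q] (v '' J) at hx
        change y ∈ Submodule.span ℤ_[q] (v '' J) at hy
        change ⁅x, y⁆ ∈ Submodule.span ℤ_[q] (v '' J)
        induction hx, hy using Submodule.span_induction₂ with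
        | mem_mem x y hx hy =>
          obtain ⟨i, hi, rfl⟩ := hx
          obtain ⟨j, hj, rfl⟩ := hy
          exact hbr i hi j hj
        | zero_left y hy => simp
        | zero_right x hx => simp
        | add_left x y z hx hy hz h1 h2 => rw [add_lie]; exact add_mem h1 h2
        | add_right x y z hx hy hz h1 h2 => rw [lie_add]; exact add_mem h1 h2
        | smul_left r x y hx hy h => rw [smul_lie]; exact Submodule.smul_mem _ _ h
        | smul_right r x y hx hy h => rw [lie_smul]; exact Submodule.smul_mem _ _ h }
  have hI : ∀ x, x ∈ I ↔ ∀ i, i ∉ J → b.repr x i = 0 := by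
    intro x
    change x ∈ Submodule.span ℤ_[q] (v '' J) ↔ _
    rw [← hb, Module.Basis.mem_span_image]
    constructor
    · intro h i hi
      by_contra h0
      exact hi (h (by simpa using h0))
    · intro h i hi
      by_contra h0
      have : b.repr x i ≠ 0 := by simpa using hi
      exact this (h i h0)
  refine ⟨I, ?_, ?_, ?_⟩
  · intro htop
    apply hJ
    rw [Set.eq_univ_iff_forall]
    intro i
    by_contra hi
    have := (hI (b i)).1 (by rw [htop]; exact LieSubalgebra.mem_top _) i hi
    simp at this
  · intro x hx
    rw [hI] at hx ⊢
    intro i hi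
    have := hx i hi
    rw [map_smul, Finsupp.smul_apply, smul_eq_mul, mul_eq_zero] at this
    refine this.resolve_left ?_
    exact PadicInt.prime_p.ne_zero
  · intro j hj
    exact Submodule.subset_span ⟨j, hj, rfl⟩

theorem fl_smith {q : ℕ} [Fact q.Prime] {V : Type} [AddCommGroup V] [Module ℤ_[q] V]
    {ι : Type} [Fintype ι] (b : Module.Basis ι ℤ_[q] V) (M : Submodule ℤ_[q] V) :
    ∃ (e : Module.Basis ι ℤ_[q] V) (a : ι → ℤ_[q]), ∀ m, m ∈ M ↔ ∀ i, a i ∣ e.repr m i := by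
  classical
  obtain ⟨r, s⟩ := M.smithNormalForm b
  refine ⟨s.bM, fun i => if h : ∃ j, s.f j = i then s.a h.choose else 0, ?_⟩
  intro m
  beta_reduce
  constructor
  · intro hm i
    by_cases h : ∃ j, s.f j = i
    · rw [dif_pos h]
      have h2 := s.repr_apply_embedding_eq_repr_smul (m := ⟨m, hm⟩) (i := h.choose)
      rw [h.choose_spec] at h2
      rw [map_smul, Finsupp.smul_apply, smul_eq_mul] at h2
      exact ⟨_, h2⟩
    · rw [dif_neg h]
      rw [s.repr_eq_zero_of_notMem_range ⟨m, hm⟩ (by simpa using h)]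
  · intro h
    rw [← s.bM.sum_repr m]
    refine sum_mem fun i _ => ?_
    have hi := h i
    by_cases h' : ∃ j, s.f j = i
    · rw [dif_pos h'] at hi
      obtain ⟨t, ht⟩ := hi
      have h3 := s.snf h'.choose
      rw [h'.choose_spec] at h3
      rw [ht, mul_comm, mul_smul, ← h3]
      exact M.smul_mem _ (Subtype.mem _)
    · rw [dif_neg h', zero_dvd_iff] at hi
      rw [hi, zero_smul]
      exact zero_mem _

theorem fl_bracket0 {A V ι : Type} [CommRing A] [LieRing V] [LieAlgebra A V] [Fintype ι]
    (b : Module.Basis ι A V) (u w : V) (m : ι) :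
    b.repr ⁅u, w⁆ m = ∑ s, ∑ t, b.repr ⁅b s, b t⁆ m * b.repr u s * b.repr w t := by
  conv_lhs => rw [← b.sum_repr u, ← b.sum_repr w]
  simp only [sum_lie, lie_sum, smul_lie, lie_smul, map_sum, map_smul,
    Finsupp.coe_finsetSum, Finset.sum_apply, Finsupp.smul_apply, smul_eq_mul, Finset.mul_sum]
  rw [Finset.sum_comm]
  refine Finset.sum_congr rfl fun s _ => Finset.sum_congr rfl fun t _ => ?_
  ring

theorem fl_bracket {q : ℕ} [Fact q.Prime] {L : Type} [LieRing L] {ι : Type} [Fintype ι]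
    (β : Module.Basis ι ℤ L) (s t m : ι) :
    (β.baseChange ℤ_[q]).repr ⁅β.baseChange ℤ_[q] s, β.baseChange ℤ_[q] t⁆ m =
      ((β.repr ⁅β s, β t⁆ m : ℤ) : ℤ_[q]) := by
  rw [Module.Basis.baseChange_apply, Module.Basis.baseChange_apply]
  have : ⁅(1 : ℤ_[q]) ⊗ₜ[ℤ] β s, (1 : ℤ_[q]) ⊗ₜ[ℤ] β t⁆ = (1 : ℤ_[q]) ⊗ₜ[ℤ] ⁅β s, β t⁆ := by
    rw [LieAlgebra.ExtendScalars.bracket_tmul, one_mul]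
  rw [this, Module.Basis.baseChange_repr_tmul]
  simp

section Main
variable (p : ℕ → ℕ) [hp : ∀ k, Fact (p k).Prime] (n : ℕ → ℕ) (U : Ultrafilter ℕ)

theorem fl_commonN {κ : Type} [Finite κ] (x : κ → ∀ k, ℤ_[p k]) (hx : ∀ i, x i ∈ flP p n U) :
    ∃ N : ℕ, ∀ᶠ k in (U : Filter ℕ), ∀ i, (p k : ℤ_[p k]) ^ n k ∣ x i k ^ N := by
  cases nonempty_fintype κ
  choose N hN using fun i => (mem_flP p n U).1 (hx i)
  refine ⟨∑ i, N i, ?_⟩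
  rw [Filter.eventually_all]
  intro i
  filter_upwards [hN i] with k hk
  exact hk.trans (pow_dvd_pow _ (Finset.single_le_sum (f := N) (fun _ _ => Nat.zero_le _) (Finset.mem_univ i)))

theorem fl_dvd_pred {q : ℕ} [Fact q.Prime] {a : ℤ_[q]} {n : ℕ} (h : a ∣ (q : ℤ_[q]) ^ n)
    (h' : ¬ (q : ℤ_[q]) ^ n ∣ a) : a ∣ (q : ℤ_[q]) ^ (n - 1) := by
  obtain ⟨i, hi, hai⟩ := (dvd_prime_pow PadicInt.prime_p n).1 h
  have : i ≠ n := by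
    rintro rfl
    exact h' hai.symm.dvd
  exact hai.dvd.trans (pow_dvd_pow _ (by omega))

theorem fl_main (hchar : ∀ m : ℕ, m ≠ 0 → (m : ∀ k, ℤ_[p k]) ∉ flP p n U)
    (hn : ∀ k, 0 < n k) {ι : Type} [Fintype ι]
    (V : ℕ → Type) [∀ k, LieRing (V k)] [∀ k, LieAlgebra ℤ_[p k] (V k)]
    (b : ∀ k, Module.Basis ι ℤ_[p k] (V k)) (γ : ι → ι → ι → ℤ)
    (hγ : ∀ k s t m, (b k).repr ⁅b k s, b k t⁆ m = (γ s t m : ℤ_[p k]))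
    (M : ∀ k, LieSubalgebra ℤ_[p k] (V k))
    (hM : ∀ k, IsLeast {j : ℕ | ∀ x : V k, (p k : ℤ_[p k]) ^ j • x ∈ M k} (n k)) :
    ∃ N : ℕ, ∀ᶠ k in (U : Filter ℕ), ∃ I : LieSubalgebra ℤ_[p k] (V k), I ≠ ⊤ ∧
      (∀ x : V k, (p k : ℤ_[p k]) • x ∈ I → x ∈ I) ∧
      ∀ c : ℕ, (∀ r : ℤ_[p k], (p k : ℤ_[p k]) ^ n k ∣ r ^ N → (p k : ℤ_[p k]) ^ c ∣ r) →
        ∀ m ∈ M k, ∃ y ∈ I, ∃ z : V k, m = y + (p k : ℤ_[p k]) ^ c • z := by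
  classical
  have hP : (flP p n U).IsPrime := flP_prime p n U (by simpa using hchar 1 one_ne_zero)
  choose e a hea using fun k => fl_smith (b k) (M k).toSubmodule
  have hea' : ∀ k m, m ∈ M k ↔ ∀ i, a k i ∣ (e k).repr m i := hea
  let A : ι → ∀ k, ℤ_[p k] := fun i k => a k i
  let g : ι → ι → ∀ k, ℤ_[p k] := fun i l k => (b k).repr (e k i) l
  let c : ι → ι → ι → ∀ k, ℤ_[p k] := fun i j l k => (e k).repr ⁅e k i, e k j⁆ l
  let J : Set ι := {i | A i ∉ flP p n U}
  have haM : ∀ k i, a k i • e k i ∈ M k := by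
    intro k i
    rw [hea']
    intro j
    rw [map_smul, Finsupp.smul_apply, Module.Basis.repr_self, Finsupp.single_apply]
    split_ifs with h
    · rw [h]; simp
    · simp
  have hc : ∀ i ∈ J, ∀ j ∈ J, ∀ l, l ∉ J → c i j l ∈ flP p n U := by
    intro i hi j hj l hl
    have hl' : A l ∈ flP p n U := by
      by_contra h; exact hl h
    have h1 : A i * (A j * c i j l) ∈ flP p n U := by
      have hd : A l ∣ A i * (A j * c i j l) := by
        have : ∀ k, A l k ∣ A i k * (A j k * c i j l k) := by
          intro k
          have := (hea' k _).1 ((M k).lie_mem (haM k i) (haM k j)) l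
          rwa [smul_lie, lie_smul, map_smul, map_smul, Finsupp.smul_apply, Finsupp.smul_apply,
            smul_eq_mul, smul_eq_mul] at this
        choose d hd using this
        exact ⟨d, funext hd⟩
      exact Ideal.mem_of_dvd _ hd hl'
    rcases hP.mem_or_mem h1 with h | h
    · exact absurd h hi
    rcases hP.mem_or_mem h with h | h
    · exact absurd h hj
    · exact h
  have hJ : J ≠ Set.univ := by
    intro hJ
    have h1 : ∀ᶠ k in (U : Filter ℕ), ∀ i, ¬ (p k : ℤ_[p k]) ^ n k ∣ a k i := by
      rw [Filter.eventually_all]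
      intro i
      have hi : i ∈ J := by rw [hJ]; trivial
      filter_upwards [(not_mem_flP p n U).1 hi 1] with k hk
      rwa [pow_one] at hk
    obtain ⟨k, hk⟩ := h1.exists
    have h2 : ∀ i, a k i ∣ (p k : ℤ_[p k]) ^ (n k - 1) := by
      intro i
      apply fl_dvd_pred _ (hk i)
      have := (hea' k _).1 ((hM k).1 (e k i)) i
      simpa using this
    have h3 : n k ≤ n k - 1 := by
      apply (hM k).2
      intro x
      rw [hea']
      intro i
      rw [map_smul, Finsupp.smul_apply, smul_eq_mul]
      exact (h2 i).mul_right _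
    have := hn k
    omega
  let x : (ι × ι) ⊕ (ι × ι × ι) → ∀ k, ℤ_[p k] :=
    Sum.elim (fun il => g il.1 il.2) (fun ijl => c ijl.1 ijl.2.1 ijl.2.2)
  let F : ι → ι → ι → MvPolynomial ((ι × ι) ⊕ (ι × ι × ι)) ℤ := fun i j m =>
    (∑ s, ∑ t, MvPolynomial.C (γ s t m) * MvPolynomial.X (Sum.inl (i, s)) *
      MvPolynomial.X (Sum.inl (j, t))) -
    ∑ l, if l ∈ J then MvPolynomial.X (Sum.inr (i, j, l)) * MvPolynomial.X (Sum.inl (l, m)) else 0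
  have hFev : ∀ (y : (ι × ι) ⊕ (ι × ι × ι) → ∀ k, ℤ_[p k]) i j m k,
      (MvPolynomial.aeval y (F i j m)) k =
      (∑ s, ∑ t, (γ s t m : ℤ_[p k]) * y (Sum.inl (i, s)) k * y (Sum.inl (j, t)) k) -
      ∑ l, if l ∈ J then y (Sum.inr (i, j, l)) k * y (Sum.inl (l, m)) k else 0 := by
    intro y i j m k
    simp only [F, map_sub, map_sum, map_mul, MvPolynomial.aeval_X, MvPolynomial.aeval_C,
      Pi.sub_apply, Finset.sum_apply, Pi.mul_apply]
    congr 1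
    refine Finset.sum_congr rfl fun l _ => ?_
    split_ifs <;> simp
  have hFx : ∀ i ∈ J, ∀ j ∈ J, ∀ m, MvPolynomial.aeval x (F i j m) ∈ flP p n U := by
    intro i hi j hj m
    have : MvPolynomial.aeval x (F i j m) = ∑ l, if l ∈ J then 0 else c i j l * g l m := by
      funext k
      rw [hFev, sub_eq_iff_eq_add, Finset.sum_apply, ← Finset.sum_add_distrib]
      have h1 : (b k).repr ⁅e k i, e k j⁆ m = ∑ l, c i j l k * g l m k := by
        conv_lhs => rw [← (e k).sum_repr ⁅e k i, e k j⁆]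
        simp only [map_sum, map_smul, Finsupp.coe_finsetSum, Finset.sum_apply,
          Finsupp.smul_apply, smul_eq_mul]
        rfl
      rw [fl_bracket0] at h1
      simp only [hγ] at h1
      refine h1.trans (Finset.sum_congr rfl fun l _ => ?_)
      by_cases hl : l ∈ J <;> simp [hl, x]
    rw [this]
    refine sum_mem fun l _ => ?_
    split_ifs with hl
    · exact zero_mem _
    · exact Ideal.mul_mem_right _ _ (hc i hi j hj l hl)
  obtain ⟨y, hyx, hyF⟩ := fl_lift p n U hchar x
  obtain ⟨N, hN⟩ := fl_commonN p n U
    (Sum.elim (fun i => y i - x i) (fun i : {i // i ∉ J} => A i.1)) (by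
      rintro (i | i)
      · exact hyx i
      · by_contra h; exact i.2 h)
  have hy0 : ∀ᶠ k in (U : Filter ℕ), ∀ i j m, i ∈ J → j ∈ J →
      (MvPolynomial.aeval y (F i j m)) k = 0 := by
    simp only [Filter.eventually_all]
    intro i j m hi hj
    exact hyF _ (hFx i hi j hj m)
  refine ⟨N, ?_⟩
  filter_upwards [hN, hy0] with k hN hy0
  let v : ι → V k := fun i => if i ∈ J then ∑ s, y (Sum.inl (i, s)) k • b k s else e k i
  have hvr : ∀ i ∈ J, ∀ s, (b k).repr (v i) s = y (Sum.inl (i, s)) k := by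
    intro i hi s
    have : v i = ∑ s, y (Sum.inl (i, s)) k • b k s := if_pos hi
    rw [this, Module.Basis.repr_sum_self]
  have hve : ∀ d : ℕ, (∀ r : ℤ_[p k], (p k : ℤ_[p k]) ^ n k ∣ r ^ N → (p k : ℤ_[p k]) ^ d ∣ r) →
      ∀ i, ∃ w, v i = e k i + (p k : ℤ_[p k]) ^ d • w := by
    intro d hd i
    by_cases hi : i ∈ J
    · have h1 : ∀ s, (p k : ℤ_[p k]) ^ d ∣ (b k).repr (v i - e k i) s := by
        intro s
        apply hd
        have h2 := hN (Sum.inl (Sum.inl (i, s)))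
        rw [map_sub, Finsupp.sub_apply, hvr i hi]
        exact h2
      choose w hw using h1
      refine ⟨∑ s, w s • b k s, ?_⟩
      rw [← sub_eq_iff_eq_add', ← (b k).sum_repr (v i - e k i), Finset.smul_sum]
      refine Finset.sum_congr rfl fun s _ => ?_
      rw [hw, mul_smul]
    · exact ⟨0, by simp [v, hi]⟩
  have hp1 : ∀ r : ℤ_[p k], (p k : ℤ_[p k]) ^ n k ∣ r ^ N → (p k : ℤ_[p k]) ^ 1 ∣ r := by
    intro r hr
    rw [pow_one]
    exact PadicInt.prime_p.dvd_of_dvd_pow ((dvd_pow_self _ (hn k).ne').trans hr)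
  obtain ⟨I, hI1, hI2, hI3⟩ := fl_final (e k) J hJ v (by simpa using hve 1 hp1) (by
    intro i hi j hj
    have : ⁅v i, v j⁆ = ∑ l, if l ∈ J then y (Sum.inr (i, j, l)) k • v l else 0 := by
      apply (b k).repr.injective
      ext m
      rw [fl_bracket0]
      have h0 := hy0 i j m hi hj
      rw [hFev, sub_eq_zero] at h0
      simp only [hγ, hvr i hi, hvr j hj]
      rw [h0, map_sum, Finsupp.coe_finsetSum, Finset.sum_apply]
      refine Finset.sum_congr rfl fun l _ => ?_
      split_ifs with hl
      · rw [map_smul, Finsupp.smul_apply, hvr l hl, smul_eq_mul]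
      · simp
    rw [this]
    refine sum_mem fun l _ => ?_
    split_ifs with hl
    · exact Submodule.smul_mem _ _ (Submodule.subset_span ⟨l, hl, rfl⟩)
    · exact zero_mem _)
  refine ⟨I, hI1, hI2, ?_⟩
  intro d hd m hm
  let S : Submodule ℤ_[p k] (V k) := I.toSubmodule ⊔
    LinearMap.range (LinearMap.lsmul ℤ_[p k] (V k) ((p k : ℤ_[p k]) ^ d))
  have hpS : ∀ w : V k, (p k : ℤ_[p k]) ^ d • w ∈ S := fun w =>
    Submodule.mem_sup_right ⟨w, rfl⟩
  have hmS : m ∈ S := by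
    rw [← (e k).sum_repr m]
    refine sum_mem fun i _ => ?_
    by_cases hi : i ∈ J
    · apply Submodule.smul_mem
      obtain ⟨w, hw⟩ := hve d hd i
      rw [← sub_eq_iff_eq_add] at hw
      rw [← hw]
      exact sub_mem (Submodule.mem_sup_left (hI3 i hi)) (hpS w)
    · have h1 : (p k : ℤ_[p k]) ^ d ∣ (e k).repr m i :=
        (hd _ (hN (Sum.inr ⟨i, hi⟩))).trans ((hea' k m).1 hm i)
      obtain ⟨t, ht⟩ := h1
      rw [ht, mul_smul]
      exact hpS _
  obtain ⟨y, hy, z, ⟨w, hw⟩, hyz⟩ := Submodule.mem_sup.1 hmS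
  refine ⟨y, hy, w, ?_⟩
  rw [← hyz, ← hw]
  rfl
end Main

theorem stmt_0 (L : Type) [LieRing L]
    [Module.Free ℤ L] [Module.Finite ℤ L] :
    ∃ (D : ℕ) (ε : ℝ), 0 < D ∧ 0 < ε ∧ ε ≤ 1 ∧
      ∀ (p : ℕ) [Fact p.Prime], ∀ n : ℕ, padicValNat p D < n →
        ∀ M : LieSubalgebra ℤ_[p] (ℤ_[p] ⊗[ℤ] L),
          IsLeast {k : ℕ | ∀ x : ℤ_[p] ⊗[ℤ] L, (p : ℤ_[p]) ^ k • x ∈ M} n →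
          ∃ I : LieSubalgebra ℤ_[p] (ℤ_[p] ⊗[ℤ] L),
            I ≠ ⊤ ∧ (∀ x : ℤ_[p] ⊗[ℤ] L, (p : ℤ_[p]) • x ∈ I → x ∈ I) ∧
            ∀ m ∈ M, ∃ y ∈ I, ∃ z : ℤ_[p] ⊗[ℤ] L,
              m = y + (p : ℤ_[p]) ^ ⌈ε * (n : ℝ)⌉₊ • z := by
  by_contra hcon
  have key : ∀ k : ℕ, ∃ (p : ℕ) (hp : Fact p.Prime) (n : ℕ)
      (M : LieSubalgebra ℤ_[p] (ℤ_[p] ⊗[ℤ] L)),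
      padicValNat p ((k + 1).factorial ^ (k + 1)) < n ∧
      IsLeast {k : ℕ | ∀ x : ℤ_[p] ⊗[ℤ] L, (p : ℤ_[p]) ^ k • x ∈ M} n ∧
      ¬ ∃ I : LieSubalgebra ℤ_[p] (ℤ_[p] ⊗[ℤ] L),
            I ≠ ⊤ ∧ (∀ x : ℤ_[p] ⊗[ℤ] L, (p : ℤ_[p]) • x ∈ I → x ∈ I) ∧
            ∀ m ∈ M, ∃ y ∈ I, ∃ z : ℤ_[p] ⊗[ℤ] L,
              m = y + (p : ℤ_[p]) ^ ⌈(1 / ((k : ℝ) + 1)) * (n : ℝ)⌉₊ • z := by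
    intro k
    by_contra hk
    apply hcon
    refine ⟨(k + 1).factorial ^ (k + 1), 1 / ((k : ℝ) + 1), by positivity, by positivity, ?_, ?_⟩
    · rw [div_le_one (by positivity)]
      have : (0 : ℝ) ≤ k := Nat.cast_nonneg k
      linarith
    · intro p hp n hn M hM
      by_contra hI
      exact hk ⟨p, hp, n, M, hn, hM, hI⟩
  choose p hp n M hD hM hno using key
  let U : Ultrafilter ℕ := Filter.hyperfilter ℕ
  have hU : ∀ N : ℕ, ∀ᶠ k in (U : Filter ℕ), N ≤ k := by
    intro N
    have h1 : (U : Filter ℕ) ≤ Filter.atTop := by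
      rw [← Nat.cofinite_eq_atTop]
      exact Filter.hyperfilter_le_cofinite
    exact h1 (Filter.eventually_ge_atTop N)
  have hchar : ∀ m : ℕ, m ≠ 0 → (m : ∀ k, ℤ_[p k]) ∉ flP p n U := by
    intro m hm
    rw [not_mem_flP]
    intro N
    filter_upwards [hU m, hU N] with k h1 h2 hdvd
    have h3 : ((p k ^ n k : ℕ) : ℤ_[p k]) ∣ ((m ^ N : ℕ) : ℤ_[p k]) := by
      push_cast
      exact hdvd
    have h4 : p k ^ n k ∣ m ^ N := by
      have h3' : (p k : ℤ_[p k]) ^ n k ∣ (((m ^ N : ℕ) : ℤ) : ℤ_[p k]) := by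
        push_cast
        exact hdvd
      rw [PadicInt.pow_p_dvd_int_iff] at h3'
      exact_mod_cast h3'
    have h5 : p k ^ n k ∣ (k + 1).factorial ^ (k + 1) :=
      h4.trans ((pow_dvd_pow _ (by omega)).trans
        (pow_dvd_pow_of_dvd (Nat.dvd_factorial (Nat.pos_of_ne_zero hm) (by omega)) (k + 1)))
    have h6 := (padicValNat_dvd_iff_le (p := p k) (by positivity)).1 h5
    have := hD k
    omega
  let β := Module.Free.chooseBasis ℤ L
  obtain ⟨N, hN⟩ := fl_main p n U hchar (fun k => (Nat.zero_le _).trans_lt (hD k))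
    (fun k => ℤ_[p k] ⊗[ℤ] L) (fun k => β.baseChange ℤ_[p k])
    (fun s t m => β.repr ⁅β s, β t⁆ m) (fun k s t m => fl_bracket β s t m) M hM
  obtain ⟨k, hk, hkN⟩ := (hN.and (hU N)).exists
  obtain ⟨I, hI1, hI2, hI3⟩ := hk
  apply hno k
  refine ⟨I, hI1, hI2, hI3 _ ?_⟩
  intro r hr
  by_cases hr0 : r = 0
  · rw [hr0]; exact dvd_zero _
  rw [← Ideal.mem_span_singleton, PadicInt.mem_span_pow_iff_le_valuation _ hr0]
  rw [← Ideal.mem_span_singleton, PadicInt.mem_span_pow_iff_le_valuation _ (pow_ne_zero _ hr0),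
    PadicInt.valuation_pow] at hr
  rw [Nat.ceil_le, div_mul_eq_mul_div, one_mul, div_le_iff₀ (by positivity)]
  have h7 : n k ≤ r.valuation * (k + 1) := by nlinarith
  exact_mod_cast h7
end

section
/- Let p be a prime number and let L be a Lie algebra over ℤ_p that is free of finite rank as a ℤ_p-module. Then there exist an integer n₀ ≥ 0 and a real constant ε with 0 < ε ≤ 1 such that for every ℤ_p-Lie subalgebra M of L that is an open ℤ_p-submodule of level p^n with n > n₀, there exists a proper isolated ℤ_p-Lie subalgebra I of L such that M ⊆ I + p^⌈ε·n⌉ L. -/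
open Polynomial in
theorem gr_hensel {p : ℕ} [Fact p.Prime] (F : ℤ_[p][X]) (x : ℤ_[p]) (K j : ℕ)
    (h1 : (p : ℤ_[p]) ^ (2 * K + j) ∣ F.eval x) (h2 : ¬ (p : ℤ_[p]) ^ K ∣ F.derivative.eval x) :
    ∃ z, F.eval z = 0 ∧ (p : ℤ_[p]) ^ j ∣ x - z := by
  have hp : (1 : ℝ) < p := by exact_mod_cast (Fact.out : p.Prime).one_lt
  have key : ∀ (y : ℤ_[p]) (n : ℕ), (p : ℤ_[p]) ^ n ∣ y ↔ ‖y‖ ≤ ((p : ℝ) ^ n)⁻¹ := by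
    intro y n
    rw [← Ideal.mem_span_singleton, ← PadicInt.norm_le_pow_iff_mem_span_pow]
    simp [zpow_neg]
  rw [key] at h1 h2
  push Not at h2
  have hK : 0 < ((p : ℝ) ^ K)⁻¹ := by positivity
  have hj : 0 < ((p : ℝ) ^ j)⁻¹ := by positivity
  have hK1 : ((p : ℝ) ^ K)⁻¹ ≤ 1 := inv_le_one_of_one_le₀ (one_le_pow₀ hp.le)
  have hj1 : ((p : ℝ) ^ j)⁻¹ ≤ 1 := inv_le_one_of_one_le₀ (one_le_pow₀ hp.le)
  have e : ((p : ℝ) ^ (2 * K + j))⁻¹ = ((p : ℝ) ^ K)⁻¹ ^ 2 * ((p : ℝ) ^ j)⁻¹ := by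
    rw [pow_add, mul_inv, pow_mul', inv_pow]
  rw [e] at h1
  have hn : ‖F.aeval x‖ < ‖F.derivative.aeval x‖ ^ 2 := by
    rw [coe_aeval_eq_eval]
    calc _ ≤ _ := h1
      _ ≤ ((p : ℝ) ^ K)⁻¹ ^ 2 := mul_le_of_le_one_right (by positivity) hj1
      _ < _ := by gcongr
  obtain ⟨z, hz, hzx, hd, -⟩ := hensels_lemma hn
  rw [coe_aeval_eq_eval] at hz
  simp only [coe_aeval_eq_eval] at hd
  rw [coe_aeval_eq_eval] at hzx
  refine ⟨z, hz, ?_⟩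
  obtain ⟨k, hk⟩ := F.binomExpansion z (x - z)
  rw [hz, zero_add, add_sub_cancel] at hk
  have hk' : F.eval x = (F.derivative.eval z + k * (x - z)) * (x - z) := by rw [hk]; ring
  have hlt : ‖k * (x - z)‖ < ‖F.derivative.eval z‖ := by
    rw [norm_mul, hd]
    calc _ ≤ 1 * ‖x - z‖ := by gcongr; exact PadicInt.norm_le_one k
      _ = ‖z - x‖ := by rw [one_mul, norm_sub_rev]
      _ < _ := hzx
  have h3 : ‖F.derivative.eval z + k * (x - z)‖ = ‖F.derivative.eval z‖ := by
    rw [PadicInt.norm_add_eq_max_of_ne hlt.ne', max_eq_left hlt.le]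
  rw [hk', norm_mul, h3, hd] at h1
  rw [key]
  by_contra hc
  push Not at hc
  have : ((p : ℝ) ^ K)⁻¹ * ((p : ℝ) ^ j)⁻¹ <  ((p : ℝ) ^ K)⁻¹ ^ 2 * ((p : ℝ) ^ j)⁻¹ :=
    lt_of_lt_of_le (mul_lt_mul'' h2 hc hK.le hj.le) h1
  have h4 : ((p : ℝ) ^ K)⁻¹ < ((p : ℝ) ^ K)⁻¹ ^ 2 := lt_of_mul_lt_mul_right this hj.le
  nlinarith

def GrProp (p : ℕ) [Fact p.Prime] {A : Type*} [CommRing A] [Algebra ℤ_[p] A] (I : Ideal A) : Prop :=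
  ∃ c : ℕ, ∀ k : ℕ, 1 ≤ k → ∀ φ : A →ₐ[ℤ_[p]] ℤ_[p], (∀ a ∈ I, (p : ℤ_[p]) ^ (c * k) ∣ φ a) →
    ∃ ψ : A →ₐ[ℤ_[p]] ℤ_[p], (∀ a ∈ I, ψ a = 0) ∧ ∀ a, (p : ℤ_[p]) ^ k ∣ φ a - ψ a

theorem gr_nat {p : ℕ} [Fact p.Prime] {A : Type*} [CommRing A] [Algebra ℤ_[p] A] (I : Ideal A)
    (d : ℕ) (hd : d ≠ 0) (h : (d : A) ∈ I) : GrProp p I := by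
  refine ⟨d, fun k hk φ hφ => ?_⟩
  exfalso
  have := hφ _ h
  rw [map_natCast] at this
  have h2 : (p : ℤ_[p]) ^ d ∣ (d : ℤ_[p]) :=
    (pow_dvd_pow _ (Nat.le_mul_of_pos_right d hk)).trans this
  rw [← Ideal.mem_span_singleton, ← PadicInt.norm_le_pow_iff_mem_span_pow] at h2
  have h3 := (PadicInt.norm_int_le_pow_iff_dvd (p := p) (k := (d : ℤ)) (n := d)).1 (by exact_mod_cast h2)
  have h4 : p ^ d ∣ d := by exact_mod_cast h3
  exact absurd (Nat.le_of_dvd (Nat.pos_of_ne_zero hd) h4)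
    (not_le.2 (Nat.lt_pow_self (Fact.out : p.Prime).one_lt))

theorem gr_base (p : ℕ) [Fact p.Prime] (I : Ideal ℤ_[p]) : GrProp p I := by
  by_cases hI : I = ⊥
  · refine ⟨0, fun k _ φ _ => ⟨φ, ?_, by simp⟩⟩
    subst hI
    intro a ha
    rw [Ideal.mem_bot] at ha
    simp [ha]
  · obtain ⟨n, hn⟩ := PadicInt.ideal_eq_span_pow_p hI
    refine gr_nat I (p ^ n) (pow_ne_zero _ (Fact.out : p.Prime).ne_zero) ?_
    rw [hn, Nat.cast_pow]
    exact Ideal.mem_span_singleton_self _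

theorem gr_equiv {p : ℕ} [Fact p.Prime] {A B : Type*} [CommRing A] [Algebra ℤ_[p] A]
    [CommRing B] [Algebra ℤ_[p] B] (e : A ≃ₐ[ℤ_[p]] B) (h : ∀ I : Ideal A, GrProp p I)
    (I : Ideal B) : GrProp p I := by
  obtain ⟨c, hc⟩ := h (I.comap e.toAlgHom)
  refine ⟨c, fun k hk φ hφ => ?_⟩
  obtain ⟨ψ, h1, h2⟩ := hc k hk (φ.comp e.toAlgHom) (fun a ha => hφ _ ha)
  refine ⟨ψ.comp e.symm.toAlgHom, fun b hb => h1 _ ?_, fun b => ?_⟩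
  · rw [Ideal.mem_comap]; simpa using hb
  · simpa using h2 (e.symm b)

theorem gr_mul {p : ℕ} [Fact p.Prime] {A : Type*} [CommRing A] [Algebra ℤ_[p] A] (I : Ideal A)
    (x y : A) (hxy : x * y ∈ I) (hx : GrProp p (I ⊔ Ideal.span {x}))
    (hy : GrProp p (I ⊔ Ideal.span {y})) : GrProp p I := by
  obtain ⟨c, hc⟩ := hx
  obtain ⟨d, hd⟩ := hy
  refine ⟨c + d, fun k hk φ hφ => ?_⟩
  have hpp : Prime (p : ℤ_[p]) := PadicInt.prime_p
  have h1 := hφ _ hxy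
  rw [map_mul] at h1
  have h2 : (p : ℤ_[p]) ^ (c * k) ∣ φ x ∨ (p : ℤ_[p]) ^ (d * k) ∣ φ y := by
    by_contra hcon
    push Not at hcon
    have a1 := lt_of_not_ge (fun h => hcon.1 (pow_dvd_of_le_emultiplicity h))
    have a2 := lt_of_not_ge (fun h => hcon.2 (pow_dvd_of_le_emultiplicity h))
    have a3 := le_emultiplicity_of_pow_dvd h1
    rw [emultiplicity_mul hpp] at a3
    have := ENat.add_lt_add a1 a2
    rw [add_mul, Nat.cast_add] at a3
    exact absurd a3 (not_le.2 this)
  rcases h2 with h2 | h2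
  · obtain ⟨ψ, e1, e2⟩ := hc k hk φ (by
      intro a ha
      obtain ⟨u, hu, v, hv, rfl⟩ := Submodule.mem_sup.1 ha
      rw [map_add]
      refine dvd_add ((pow_dvd_pow _ (Nat.mul_le_mul_right k (by omega))).trans (hφ _ hu)) ?_
      obtain ⟨w, rfl⟩ := Ideal.mem_span_singleton.1 hv
      rw [map_mul]
      exact h2.mul_right _)
    exact ⟨ψ, fun a ha => e1 a (Ideal.mem_sup_left ha), e2⟩
  · obtain ⟨ψ, e1, e2⟩ := hd k hk φ (by
      intro a ha
      obtain ⟨u, hu, v, hv, rfl⟩ := Submodule.mem_sup.1 ha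
      rw [map_add]
      refine dvd_add ((pow_dvd_pow _ (Nat.mul_le_mul_right k (by omega))).trans (hφ _ hu)) ?_
      obtain ⟨w, rfl⟩ := Ideal.mem_span_singleton.1 hv
      rw [map_mul]
      exact h2.mul_right _)
    exact ⟨ψ, fun a ha => e1 a (Ideal.mem_sup_left ha), e2⟩

open Polynomial in
/-- evaluation close -/
theorem gr_close {p : ℕ} [Fact p.Prime] {A : Type*} [CommRing A] [Algebra ℤ_[p] A]
    (φ ψ : A[X] →ₐ[ℤ_[p]] ℤ_[p]) (q : ℤ_[p]) (h1 : ∀ a, q ∣ φ (C a) - ψ (C a))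
    (h2 : q ∣ φ X - ψ X) (f : A[X]) : q ∣ φ f - ψ f := by
  induction f using Polynomial.induction_on with
  | C a => exact h1 a
  | add f g hf hg =>
    have : φ (f + g) - ψ (f + g) = (φ f - ψ f) + (φ g - ψ g) := by simp only [map_add]; ring
    rw [this]; exact dvd_add hf hg
  | monomial n a ih =>
    have : φ (C a * X ^ (n + 1)) - ψ (C a * X ^ (n + 1)) =
        (φ (C a * X ^ n) - ψ (C a * X ^ n)) * φ X + ψ (C a * X ^ n) * (φ X - ψ X) := by
      simp only [map_mul, map_pow]; ring
    rw [this]; exact dvd_add (ih.mul_right _) (h2.mul_left _)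

open Polynomial in
theorem gr_prime {p : ℕ} [Fact p.Prime] {A : Type*} [CommRing A] [Algebra ℤ_[p] A]
    (hA : ∀ I : Ideal A, GrProp p I) (P : Ideal A[X]) (hP : P.IsPrime)
    (ih : ∀ J : Ideal A[X], P < J → GrProp p J) : GrProp p P := by
  by_cases hch : ∃ d : ℕ, d ≠ 0 ∧ (d : A[X]) ∈ P
  · obtain ⟨d, hd, h⟩ := hch
    exact gr_nat P d hd h
  push Not at hch
  set Q : Ideal A := P.comap C with hQ
  obtain ⟨cQ, hcQ⟩ := hA Q
  -- extension of homs
  let ext : (A →ₐ[ℤ_[p]] ℤ_[p]) → ℤ_[p] → (A[X] →ₐ[ℤ_[p]] ℤ_[p]) := fun ψ z =>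
    { Polynomial.eval₂RingHom (ψ : A →+* ℤ_[p]) z with
      commutes' := fun r => by
        simp [Polynomial.algebraMap_apply] }
  have extC : ∀ ψ z a, ext ψ z (C a) = ψ a := fun ψ z a =>
    (Polynomial.eval₂_C (ψ : A →+* ℤ_[p]) z)
  have extX : ∀ ψ z, ext ψ z X = z := fun ψ z =>
    Polynomial.eval₂_X (ψ : A →+* ℤ_[p]) z
  have extf : ∀ ψ z f, ext ψ z f = (f.map (ψ : A →+* ℤ_[p])).eval z := fun ψ z f => by
    rw [Polynomial.eval_map]; rfl
  let res : (A[X] →ₐ[ℤ_[p]] ℤ_[p]) → (A →ₐ[ℤ_[p]] ℤ_[p]) := fun φ => φ.comp Polynomial.CAlgHom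
  have resa : ∀ φ a, res φ a = φ (C a) := fun φ a => by simp [res]
  have extQ : ∀ ψ z, (∀ a ∈ Q, ψ a = 0) → ∀ f ∈ Q.map (C : A →+* A[X]), ext ψ z f = 0 := by
    intro ψ z h f hf
    have : Q.map (C : A →+* A[X]) ≤ RingHom.ker (ext ψ z) := by
      rw [Ideal.map_le_iff_le_comap]
      intro a ha
      rw [Ideal.mem_comap, RingHom.mem_ker, extC]
      exact h a ha
    exact this hf
  by_cases hPQ : P ≤ Q.map (C : A →+* A[X])
  · refine ⟨cQ, fun k hk φ hφ => ?_⟩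
    obtain ⟨ψ, h1, h2⟩ := hcQ k hk (res φ) (fun a ha => by rw [resa]; exact hφ _ ha)
    refine ⟨ext ψ (φ X), fun f hf => extQ _ _ h1 f (hPQ hf), gr_close _ _ _ ?_ ?_⟩
    · intro a; rw [extC, ← resa]; exact h2 a
    · rw [extX, sub_self]; exact dvd_zero _
  · have hex : ∃ n, ∃ f ∈ P, f ∉ Q.map (C : A →+* A[X]) ∧ f.natDegree = n := by
      obtain ⟨f, hf, hf'⟩ := Set.not_subset.1 hPQ
      exact ⟨_, f, hf, hf', rfl⟩
    classical
    obtain ⟨f, hfP, hfQ, hfd⟩ := Nat.find_spec hex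
    have hmin : ∀ g ∈ P, g.natDegree < f.natDegree → g ∈ Q.map (C : A →+* A[X]) := by
      intro g hg hlt
      by_contra hgQ
      rw [hfd] at hlt
      exact Nat.find_min hex hlt ⟨g, hg, hgQ, rfl⟩
    have hd0 : f.natDegree ≠ 0 := by
      intro h0
      rw [Polynomial.eq_C_of_natDegree_eq_zero h0] at hfP hfQ
      exact hfQ (Ideal.mem_map_of_mem _ hfP)
    set a := f.leadingCoeff with ha
    have haQ : a ∉ Q := by
      intro haQ
      have h1 : C a * X ^ f.natDegree ∈ Q.map (C : A →+* A[X]) :=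
        Ideal.mul_mem_right _ _ (Ideal.mem_map_of_mem _ haQ)
      have h2 : f.eraseLead ∈ Q.map (C : A →+* A[X]) := by
        refine hmin _ ?_ ?_
        · rw [← Polynomial.self_sub_C_mul_X_pow]
          exact P.sub_mem hfP (P.mul_mem_right _ haQ)
        · exact Polynomial.eraseLead_natDegree_lt_or_eraseLead_eq_zero f |>.resolve_right (by
            intro h0
            have := Polynomial.eraseLead_add_C_mul_X_pow f
            rw [h0, zero_add] at this
            exact hfQ (this ▸ h1))
      have := Polynomial.eraseLead_add_C_mul_X_pow f
      exact hfQ (this ▸ Ideal.add_mem _ h2 h1)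
    have hdP : derivative f ∉ P := by
      intro hd
      have h1 := hmin _ hd (Polynomial.natDegree_derivative_lt hd0)
      rw [Ideal.mem_map_C_iff] at h1
      have h2 := h1 (f.natDegree - 1)
      rw [Polynomial.coeff_derivative, Nat.sub_add_cancel (Nat.pos_of_ne_zero hd0)] at h2
      have h3 : C a * ((f.natDegree : ℕ) : A[X]) ∈ P := by
        have h4 : C (f.coeff f.natDegree * (((f.natDegree - 1 : ℕ) : A) + 1)) ∈ P := h2
        have h5 : (((f.natDegree - 1 : ℕ) : A) + 1) = (f.natDegree : A) := by
          rw [← Nat.cast_succ, Nat.succ_eq_add_one, Nat.sub_add_cancel (Nat.pos_of_ne_zero hd0)]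
        rw [h5, map_mul, map_natCast] at h4
        exact h4
      rcases hP.mem_or_mem h3 with h | h
      · exact haQ h
      · exact hch _ hd0 h
    set D := C a * derivative f with hD
    have hDP : D ∉ P := fun h => (hP.mem_or_mem h).elim haQ hdP
    obtain ⟨cD, hcD⟩ := ih (P ⊔ Ideal.span {D}) (by
      refine lt_of_le_of_ne le_sup_left fun h => hDP ?_
      rw [h]; exact Ideal.mem_sup_right (Ideal.mem_span_singleton_self _))
    have hvan : ∀ ψ z, (∀ b ∈ Q, ψ b = 0) → ψ a ≠ 0 → ext ψ z f = 0 →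
        ∀ n, ∀ g ∈ P, g.natDegree = n → ext ψ z g = 0 := by
      intro ψ z hψ hψa hψf n
      induction n using Nat.strong_induction_on with
      | _ n ihn =>
        intro g hg hgn
        by_cases hlt : g.natDegree < f.natDegree
        · exact extQ _ _ hψ _ (hmin g hg hlt)
        · push Not at hlt
          set g' := C a * g - C g.leadingCoeff * X ^ (g.natDegree - f.natDegree) * f with hg'
          have hg'P : g' ∈ P := P.sub_mem (P.mul_mem_left _ hg) (P.mul_mem_left _ hfP)
          have hdeg : g'.natDegree < g.natDegree := by
            have hle : g'.natDegree ≤ g.natDegree := by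
              refine (natDegree_sub_le _ _).trans (max_le (natDegree_C_mul_le _ _) ?_)
              rw [mul_assoc]
              refine (natDegree_C_mul_le _ _).trans (natDegree_mul_le.trans ?_)
              have := natDegree_X_pow_le (R := A) (g.natDegree - f.natDegree)
              omega
            have hco : g'.coeff g.natDegree = 0 := by
              rw [hg', coeff_sub, coeff_C_mul, mul_assoc, coeff_C_mul, coeff_X_pow_mul',
                if_pos (Nat.sub_le _ _), Nat.sub_sub_self hlt, ha, leadingCoeff, leadingCoeff]
              ring
            refine lt_of_le_of_ne hle fun heq => ?_
            rw [← heq] at hco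
            have : g' = 0 := leadingCoeff_eq_zero.1 hco
            rw [this, natDegree_zero] at heq
            omega
          have h0 := ihn _ (hgn ▸ hdeg) g' hg'P rfl
          rw [hg', map_sub, map_mul, map_mul, hψf, mul_zero, sub_zero, extC] at h0
          exact (mul_eq_zero.1 h0).resolve_left hψa
    refine ⟨cD + cQ * (2 * cD + 1) + (2 * cD + 1), fun k hk φ hφ => ?_⟩
    by_cases hφD : (p : ℤ_[p]) ^ (cD * k) ∣ φ D
    · obtain ⟨ψ, e1, e2⟩ := hcD k hk φ (by
        intro b hb
        obtain ⟨u, hu, v, hv, rfl⟩ := Submodule.mem_sup.1 hb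
        rw [map_add]
        refine dvd_add ((pow_dvd_pow _ (Nat.mul_le_mul_right k (by omega))).trans (hφ _ hu)) ?_
        obtain ⟨w, rfl⟩ := Ideal.mem_span_singleton.1 hv
        rw [map_mul]
        exact hφD.mul_right _)
      exact ⟨ψ, fun a ha => e1 a (Ideal.mem_sup_left ha), e2⟩
    · obtain ⟨ψ, h1, h2⟩ := hcQ ((2 * cD + 1) * k) (Nat.mul_pos (by omega) hk) (res φ) (by
        intro b hb
        rw [resa, ← mul_assoc]
        exact (pow_dvd_pow _ (Nat.mul_le_mul_right k (by omega))).trans (hφ _ hb))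
      have hcl : ∀ g, (p : ℤ_[p]) ^ ((2 * cD + 1) * k) ∣ φ g - ext ψ (φ X) g := by
        refine gr_close _ _ _ ?_ ?_
        · intro a; rw [extC, ← resa]; exact h2 a
        · rw [extX, sub_self]; exact dvd_zero _
      have hf1 : (p : ℤ_[p]) ^ (2 * (cD * k) + k) ∣ ext ψ (φ X) f := by
        have e1 : (p : ℤ_[p]) ^ ((2 * cD + 1) * k) ∣ φ f :=
          (pow_dvd_pow _ (Nat.mul_le_mul_right k (by omega))).trans (hφ _ hfP)
        have e2 := dvd_sub e1 (hcl f)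
        rw [sub_sub_cancel] at e2
        convert e2 using 2
        ring
      have hD1 : ¬ (p : ℤ_[p]) ^ (cD * k) ∣ ext ψ (φ X) D := by
        intro h
        have e1 := (pow_dvd_pow (p : ℤ_[p])
          (Nat.mul_le_mul_right k (show cD ≤ 2 * cD + 1 by omega))).trans (hcl D)
        have e2 := dvd_add e1 h
        rw [sub_add_cancel] at e2
        exact hφD e2
      rw [hD, map_mul, extC] at hD1
      have hψa : ψ a ≠ 0 := fun h => hD1 (by rw [h, zero_mul]; exact dvd_zero _)
      have hD2 : ¬ (p : ℤ_[p]) ^ (cD * k) ∣ ext ψ (φ X) (derivative f) :=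
        fun h => hD1 (h.mul_left _)
      rw [extf] at hf1 hD2
      rw [← derivative_map] at hD2
      obtain ⟨z, hz, hzx⟩ := gr_hensel _ _ _ _ hf1 hD2
      rw [← extf] at hz
      refine ⟨ext ψ z, fun g hg => hvan ψ z h1 hψa hz _ g hg rfl, gr_close _ _ _ ?_ ?_⟩
      · intro b; rw [extC, ← resa]
        exact (pow_dvd_pow _ (Nat.le_mul_of_pos_left k (by omega))).trans (h2 b)
      · rw [extX]; exact hzx

open Polynomial in
theorem gr_poly {p : ℕ} [Fact p.Prime] {A : Type*} [CommRing A] [Algebra ℤ_[p] A]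
    [IsNoetherianRing A] (hA : ∀ I : Ideal A, GrProp p I) (I : Ideal A[X]) : GrProp p I := by
  induction I using IsNoetherian.induction with
  | hgt I ih =>
    by_cases hI : Ideal.IsPrime I
    · exact gr_prime hA I hI ih
    by_cases hT : I = ⊤
    · refine gr_nat I 1 one_ne_zero ?_
      rw [hT]; trivial
    rw [Ideal.isPrime_iff] at hI
    push Not at hI
    obtain ⟨x, y, hxy, hx, hy⟩ := hI hT
    refine gr_mul I x y hxy (ih _ ?_) (ih _ ?_)
    · refine lt_of_le_of_ne le_sup_left fun h => hx ?_
      rw [h]; exact Ideal.mem_sup_right (Ideal.mem_span_singleton_self _)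
    · refine lt_of_le_of_ne le_sup_left fun h => hy ?_
      rw [h]; exact Ideal.mem_sup_right (Ideal.mem_span_singleton_self _)

theorem gr_fin (p : ℕ) [Fact p.Prime] (n : ℕ) (I : Ideal (MvPolynomial (Fin n) ℤ_[p])) :
    GrProp p I := by
  induction n with
  | zero => exact gr_equiv (MvPolynomial.isEmptyAlgEquiv ℤ_[p] (Fin 0)).symm (gr_base p) I
  | succ n ih => exact gr_equiv (MvPolynomial.finSuccEquiv ℤ_[p] n).symm (gr_poly ih) I

theorem gr_mv (p : ℕ) [Fact p.Prime] (σ : Type*) [Finite σ] (I : Ideal (MvPolynomial σ ℤ_[p])) :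
    GrProp p I := by
  obtain ⟨n, ⟨e⟩⟩ := Finite.exists_equiv_fin σ
  exact gr_equiv (MvPolynomial.renameEquiv ℤ_[p] e).symm (gr_fin p n) I

open MvPolynomial in
theorem gr_lie (p : ℕ) [Fact p.Prime] {L : Type*} [LieRing L] [LieAlgebra ℤ_[p] L]
    {ι : Type} [Fintype ι] [DecidableEq ι] (b : Module.Basis ι ℤ_[p] L) (S : Finset ι) :
    ∃ c : ℕ, ∀ k : ℕ, 1 ≤ k → ∀ e : Module.Basis ι ℤ_[p] L,
      (∀ i ∈ S, ∀ j ∈ S, ∀ l ∉ S, (p : ℤ_[p]) ^ (c * k) ∣ e.repr ⁅e i, e j⁆ l) →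
      ∃ (e' : ι → L) (h' : ι → L →ₗ[ℤ_[p]] ℤ_[p]),
        (∀ x, x = ∑ j, h' j x • e' j) ∧ (∀ j l, h' l (e' j) = if l = j then 1 else 0) ∧
        (∀ i ∈ S, ∀ j ∈ S, ∀ l ∉ S, h' l ⁅e' i, e' j⁆ = 0) ∧
        ∀ j, ∃ z, e j - e' j = (p : ℤ_[p]) ^ k • z := by
  let σ := (ι × ι) ⊕ (ι × ι)
  let R := MvPolynomial σ ℤ_[p]
  let G : ι → ι → R := fun s j => X (Sum.inl (s, j))
  let H : ι → ι → R := fun l s => X (Sum.inr (l, s))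
  let E1 : ι → ι → R := fun l j => (∑ s, G s j * H l s) - if l = j then 1 else 0
  let E2 : ι → ι → R := fun s t => (∑ j, H j t * G s j) - if s = t then 1 else 0
  let E3 : ι → ι → ι → R := fun i j l =>
    ∑ s, ∑ t, ∑ u, G s i * (G t j * (C (b.repr ⁅b s, b t⁆ u) * H l u))
  let gen : Set R := {f | (∃ l j, f = E1 l j) ∨ (∃ s t, f = E2 s t) ∨
    ∃ i ∈ S, ∃ j ∈ S, ∃ l ∉ S, f = E3 i j l}
  let g : (R →ₐ[ℤ_[p]] ℤ_[p]) → ι → L := fun φ j => ∑ s, φ (G s j) • b s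
  let h : (R →ₐ[ℤ_[p]] ℤ_[p]) → ι → L →ₗ[ℤ_[p]] ℤ_[p] := fun φ l =>
    b.constr ℤ_[p] (fun s => φ (H l s))
  have hb : ∀ φ l s, h φ l (b s) = φ (H l s) := fun φ l s => by simp [h]
  have hx : ∀ φ l x, h φ l x = ∑ u, b.repr x u * φ (H l u) := fun φ l x => by
    simp [h, Module.Basis.constr_apply_fintype]
  have v1 : ∀ φ l j, φ (E1 l j) = h φ l (g φ j) - if l = j then 1 else 0 := by
    intro φ l j
    simp only [E1, g, map_sub, map_sum, map_mul, map_smul, hb, smul_eq_mul]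
    congr 1
    split_ifs <;> simp
  have v2 : ∀ φ s t, φ (E2 s t) = b.repr (∑ j, h φ j (b t) • g φ j) s - if s = t then 1 else 0 := by
    intro φ s t
    simp only [E2, g, map_sub, map_sum, map_mul, map_smul, hb, smul_eq_mul]
    congr 1
    · simp [Finsupp.single_apply]
    split_ifs <;> simp
  have v3 : ∀ φ i j l, φ (E3 i j l) = h φ l ⁅g φ i, g φ j⁆ := by
    intro φ i j l
    have hC : ∀ r : ℤ_[p], φ (C r) = r := fun r => by
      exact φ.commutes r
    simp only [E3, g, map_sum, map_mul, hC]
    rw [sum_lie, map_sum]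
    refine Finset.sum_congr rfl fun s _ => ?_
    rw [lie_sum, map_sum]
    refine Finset.sum_congr rfl fun t _ => ?_
    rw [smul_lie, lie_smul, map_smul, map_smul, hx, smul_eq_mul, smul_eq_mul, Finset.mul_sum,
      Finset.mul_sum]
  obtain ⟨c, hc⟩ := gr_mv p σ (Ideal.span gen)
  refine ⟨c, fun k hk e he => ?_⟩
  let φ : R →ₐ[ℤ_[p]] ℤ_[p] := aeval
    (Sum.elim (fun q => b.repr (e q.2) q.1) (fun q => e.repr (b q.2) q.1))
  have gφ : ∀ j, g φ j = e j := by
    intro j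
    have h1 : ∀ s, φ (G s j) = b.repr (e j) s := fun s => aeval_X _ _
    simp only [g, h1]
    exact b.sum_repr (e j)
  have hφ : ∀ l x, h φ l x = e.repr x l := by
    intro l x
    have : h φ l = e.coord l := by
      refine b.ext fun s => ?_
      rw [hb]
      exact aeval_X _ _
    rw [this, Module.Basis.coord_apply]
  obtain ⟨ψ, hψ, hcl⟩ := hc k hk φ (by
    have : Ideal.span gen ≤ (Ideal.span {(p : ℤ_[p]) ^ (c * k)}).comap φ := by
      rw [Ideal.span_le]
      rintro f (⟨l, j, rfl⟩ | ⟨s, t, rfl⟩ | ⟨i, hi, j, hj, l, hl, rfl⟩)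
      · rw [SetLike.mem_coe, Ideal.mem_comap, v1, hφ, gφ, e.repr_self, Finsupp.single_apply]
        simp [eq_comm]
      · rw [SetLike.mem_coe, Ideal.mem_comap, v2]
        simp only [hφ, gφ, e.sum_repr, b.repr_self, Finsupp.single_apply]
        simp [eq_comm]
      · rw [SetLike.mem_coe, Ideal.mem_comap, v3, hφ, gφ, gφ, Ideal.mem_span_singleton]
        exact he i hi j hj l hl
    intro a ha
    exact Ideal.mem_span_singleton.1 (this ha))
  refine ⟨g ψ, h ψ, ?_, ?_, ?_, ?_⟩
  · intro x
    have h1 : (LinearMap.id : L →ₗ[ℤ_[p]] L) = ∑ j, (h ψ j).smulRight (g ψ j) := by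
      refine b.ext fun t => ?_
      apply b.repr.injective
      ext s
      have := hψ (E2 s t) (Ideal.subset_span (Or.inr (Or.inl ⟨s, t, rfl⟩)))
      rw [v2, sub_eq_zero] at this
      simp only [LinearMap.id_apply, LinearMap.sum_apply, LinearMap.smulRight_apply]
      rw [this, b.repr_self, Finsupp.single_apply]
      simp [eq_comm]
    have h2 := congrArg (fun T : L →ₗ[ℤ_[p]] L => T x) h1
    simpa only [LinearMap.id_apply, LinearMap.sum_apply, LinearMap.smulRight_apply] using h2
  · intro j l
    have := hψ (E1 l j) (Ideal.subset_span (Or.inl ⟨l, j, rfl⟩))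
    rwa [v1, sub_eq_zero] at this
  · intro i hi j hj l hl
    have := hψ (E3 i j l) (Ideal.subset_span (Or.inr (Or.inr ⟨i, hi, j, hj, l, hl, rfl⟩)))
    rwa [v3] at this
  · intro j
    choose w hw using fun s => hcl (G s j)
    refine ⟨∑ s, w s • b s, ?_⟩
    rw [← gφ j]
    simp only [g]
    rw [← Finset.sum_sub_distrib, Finset.smul_sum]
    refine Finset.sum_congr rfl fun s _ => ?_
    rw [← sub_smul, hw, mul_smul]

theorem gr_smith (p : ℕ) [Fact p.Prime] {L : Type*} [AddCommGroup L] [Module ℤ_[p] L]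
    {ι : Type} [Fintype ι] (b : Module.Basis ι ℤ_[p] L) (M : Submodule ℤ_[p] L)
    (n : ℕ) (hn : ∀ x : L, (p : ℤ_[p]) ^ n • x ∈ M) :
    ∃ (e : Module.Basis ι ℤ_[p] L) (α : ι → ℕ), (∀ j, (p : ℤ_[p]) ^ α j • e j ∈ M) ∧
      ∀ x ∈ M, ∀ j, (p : ℤ_[p]) ^ α j ∣ e.repr x j := by
  have hpp : Prime (p : ℤ_[p]) := PadicInt.prime_p
  have := Module.Finite.of_basis b
  have := Module.Free.of_basis b
  have hr : Module.finrank ℤ_[p] M = Module.finrank ℤ_[p] L := by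
    refine le_antisymm (Submodule.finrank_le M) ?_
    let T : L →ₗ[ℤ_[p]] M := (LinearMap.lsmul ℤ_[p] L ((p : ℤ_[p]) ^ n)).codRestrict M hn
    refine LinearMap.finrank_le_finrank_of_injective (f := T) ?_
    intro x y hxy
    have h1 : (p : ℤ_[p]) ^ n • x = (p : ℤ_[p]) ^ n • y := congrArg Subtype.val hxy
    exact smul_right_injective L (pow_ne_zero n hpp.ne_zero) h1
  obtain ⟨e, a, ab, hab⟩ := Submodule.exists_smith_normal_form_of_rank_eq b hr
  have key : ∀ x (hx : x ∈ M) j, e.repr x j = ab.repr ⟨x, hx⟩ j * a j := by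
    intro x hx j
    have h1 := congrArg Subtype.val (ab.sum_repr ⟨x, hx⟩)
    simp only [Submodule.coe_sum, Submodule.coe_smul, hab, smul_smul] at h1
    conv_lhs => rw [← h1]
    classical
    rw [Module.Basis.repr_sum_self]
  have hd : ∀ j, a j ∣ (p : ℤ_[p]) ^ n := by
    intro j
    have h1 := key _ (hn (e j)) j
    rw [map_smul, e.repr_self, Finsupp.smul_apply, Finsupp.single_eq_same, smul_eq_mul,
      mul_one] at h1
    exact ⟨_, h1.trans (mul_comm _ _)⟩
  choose α _ hα using fun j => (dvd_prime_pow hpp n).1 (hd j)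
  refine ⟨e, α, fun j => ?_, fun x hx j => ?_⟩
  · obtain ⟨u, hu⟩ := hα j
    rw [← hu, mul_comm, mul_smul, ← hab]
    exact M.smul_mem _ (ab j).2
  · rw [key x hx j]
    exact (hα j).symm.dvd.mul_left _

theorem gr_pigeon {ι : Type*} [Fintype ι] (α : ι → ℕ) (T : ℕ → ℕ) (hT : Monotone T)
    (j₀ : ι) (hj₀ : T (Fintype.card ι) < α j₀) :
    ∃ r < Fintype.card ι, ∀ j, α j ≤ T r ∨ T (r + 1) < α j := by
  by_contra hcon
  push Not at hcon
  choose f hf1 hf2 using fun r : Fin (Fintype.card ι) => hcon r r.2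
  have hinj : Function.Injective f := by
    intro r s hrs
    rcases lt_trichotomy (r : ℕ) s with h | h | h
    · have h1 := hf2 r
      have h2 := hf1 s
      have h3 := hT (Nat.succ_le_of_lt h)
      rw [hrs] at h1
      simp only [Nat.succ_eq_add_one] at h3
      omega
    · exact Fin.ext h
    · have h1 := hf2 s
      have h2 := hf1 r
      have h3 := hT (Nat.succ_le_of_lt h)
      rw [← hrs] at h1
      simp only [Nat.succ_eq_add_one] at h3
      omega
  have hsurj := ((Fintype.bijective_iff_injective_and_card f).2 ⟨hinj, by simp⟩).2
  obtain ⟨r, hr⟩ := hsurj j₀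
  have h1 := hf2 r
  rw [hr] at h1
  have := hT (Nat.succ_le_of_lt r.2)
  simp only [Nat.succ_eq_add_one] at this
  omega

theorem gr_main (p : ℕ) [Fact p.Prime] (L : Type) [LieRing L] [LieAlgebra ℤ_[p] L]
    [Module.Free ℤ_[p] L] [Module.Finite ℤ_[p] L] :
    ∃ c : ℕ, 1 ≤ c ∧ ∀ n k : ℕ, 1 ≤ k → c * k ≤ n → ∀ M : LieSubalgebra ℤ_[p] L,
      IsLeast {k : ℕ | ∀ x : L, (p : ℤ_[p]) ^ k • x ∈ M} n →
          ∃ I : LieSubalgebra ℤ_[p] L,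
            I ≠ ⊤ ∧ (∀ x : L, (p : ℤ_[p]) • x ∈ I → x ∈ I) ∧
            ∀ m ∈ M, ∃ y ∈ I, ∃ z : L, m = y + (p : ℤ_[p]) ^ k • z := by
  classical
  have hpp : Prime (p : ℤ_[p]) := PadicInt.prime_p
  let ι := Fin (Module.finrank ℤ_[p] L)
  let b : Module.Basis ι ℤ_[p] L := Module.finBasis ℤ_[p] L
  choose c hc using fun S : Finset ι => gr_lie p b S
  set Cc : ℕ := (∑ S : Finset ι, c S) + 1 with hCc
  have hcC : ∀ S, c S ≤ Cc := fun S =>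
    (Finset.single_le_sum (fun _ _ => Nat.zero_le _) (Finset.mem_univ S)).trans (Nat.le_succ _)
  refine ⟨2 ^ Fintype.card ι * Cc, Nat.mul_pos (by positivity) (by omega), ?_⟩
  intro n k hk hn M hM
  have hCk : 1 ≤ Cc * k := Nat.mul_pos (by omega) hk
  obtain ⟨e, α, hα1, hα2⟩ := gr_smith p b M.toSubmodule n hM.1
  have hn1 : 1 ≤ n := by
    refine le_trans ?_ hn
    exact Nat.mul_pos (Nat.mul_pos (by positivity) (by omega)) hk
  have hbig : ∃ j, n ≤ α j := by
    by_contra hcon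
    push Not at hcon
    have : n ≤ n - 1 := hM.2 (by
      intro x
      change _ ∈ M.toSubmodule
      rw [← e.sum_repr x, Finset.smul_sum]
      refine Submodule.sum_mem _ fun j _ => ?_
      rw [smul_comm]
      refine Submodule.smul_mem _ _ ?_
      have h1 : n - 1 = (n - 1 - α j) + α j := by have := hcon j; omega
      rw [h1, pow_add, mul_smul]
      exact Submodule.smul_mem _ _ (hα1 j))
    omega
  obtain ⟨j₀, hj₀⟩ := hbig
  let T : ℕ → ℕ := fun r => (2 ^ r - 1) * (Cc * k)
  have hTs : ∀ r, T (r + 1) = 2 * T r + Cc * k := by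
    intro r
    simp only [T]
    have h1 : 1 ≤ 2 ^ r := Nat.one_le_two_pow
    have h2 : 2 ^ (r + 1) - 1 = 2 * (2 ^ r - 1) + 1 := by rw [pow_succ]; omega
    rw [h2]; ring
  have hT : Monotone T := monotone_nat_of_le_succ fun r => by rw [hTs]; omega
  have hTd : T (Fintype.card ι) < α j₀ := by
    refine lt_of_lt_of_le ?_ hj₀
    refine lt_of_lt_of_le ?_ hn
    simp only [T]
    rw [mul_assoc]
    refine Nat.mul_lt_mul_of_pos_right ?_ hCk
    have h1 : 1 ≤ 2 ^ Fintype.card ι := Nat.one_le_two_pow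
    omega
  obtain ⟨r, hr, hgap⟩ := gr_pigeon α T hT j₀ hTd
  let S : Finset ι := Finset.univ.filter fun j => α j ≤ T r
  have hS : ∀ j, j ∈ S ↔ α j ≤ T r := fun j => by simp [S]
  have hSc : ∀ l, l ∉ S → 2 * T r + Cc * k < α l := by
    intro l hl
    rw [hS] at hl
    have := (hgap l).resolve_left hl
    rwa [hTs] at this
  obtain ⟨e', h', hsum, hdual, hbr, hclose⟩ := hc S k hk e (by
    intro i hi j hj l hl
    have h1 : ((p : ℤ_[p]) ^ α i * (p : ℤ_[p]) ^ α j) • ⁅e i, e j⁆ ∈ M := by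
      have := M.lie_mem (hα1 i) (hα1 j)
      rwa [smul_lie, lie_smul, smul_smul] at this
    have h2 := hα2 _ h1 l
    rw [map_smul, Finsupp.smul_apply, smul_eq_mul, ← pow_add] at h2
    have h3 := hSc l hl
    rw [hS] at hi hj
    have h4 : c S * k ≤ Cc * k := Nat.mul_le_mul_right k (hcC S)
    have h5 : (p : ℤ_[p]) ^ (α i + α j + c S * k) ∣
        (p : ℤ_[p]) ^ (α i + α j) * e.repr ⁅e i, e j⁆ l :=
      (pow_dvd_pow _ (by omega)).trans h2
    rw [pow_add _ (α i + α j)] at h5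
    exact (mul_dvd_mul_iff_left (pow_ne_zero _ hpp.ne_zero)).1 h5)
  have hexp : ∀ x, (∀ l ∉ S, h' l x = 0) → x = ∑ j ∈ S, h' j x • e' j := by
    intro x hx
    conv_lhs => rw [hsum x]
    symm
    refine Finset.sum_subset (Finset.subset_univ S) fun l _ hl => ?_
    rw [hx l hl, zero_smul]
  let I : LieSubalgebra ℤ_[p] L :=
    { carrier := {x | ∀ l ∉ S, h' l x = 0}
      add_mem' := fun {x y} hx hy l hl => by rw [map_add, hx l hl, hy l hl, add_zero]
      zero_mem' := fun l _ => map_zero _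
      smul_mem' := fun r x hx l hl => by rw [map_smul, hx l hl, smul_zero]
      lie_mem' := fun {x y} hx hy l hl => by
        rw [hexp x hx, hexp y hy]
        rw [sum_lie, map_sum]
        refine Finset.sum_eq_zero fun i hi => ?_
        rw [lie_sum, map_sum]
        refine Finset.sum_eq_zero fun j hj => ?_
        rw [smul_lie, lie_smul, map_smul, map_smul, hbr i hi j hj l hl, smul_zero, smul_zero] }
  have hI : ∀ x, x ∈ I ↔ ∀ l ∉ S, h' l x = 0 := fun x => Iff.rfl
  refine ⟨I, ?_, ?_, ?_⟩
  · intro htop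
    have h1 : e' j₀ ∈ I := by rw [htop]; trivial
    have h2 := (hI _).1 h1 j₀ (by
      rw [hS]; have := hT hr.le; omega)
    rw [hdual, if_pos rfl] at h2
    exact one_ne_zero h2
  · intro x hx l hl
    have := (hI _).1 hx l hl
    rw [map_smul, smul_eq_mul] at this
    exact (mul_eq_zero.1 this).resolve_left hpp.ne_zero
  · intro x hx
    have hk2 : k ≤ Cc * k := Nat.le_mul_of_pos_left k (by omega)
    let W : Submodule ℤ_[p] L := LinearMap.range (LinearMap.lsmul ℤ_[p] L ((p : ℤ_[p]) ^ k))
    have hmem : x - ∑ j ∈ S, e.repr x j • e' j ∈ W := by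
      have h1 : x - ∑ j ∈ S, e.repr x j • e' j =
          ∑ j ∈ S, e.repr x j • (e j - e' j) + ∑ j ∈ Sᶜ, e.repr x j • e j := by
        have h0 : x = ∑ j ∈ S, e.repr x j • e j + ∑ j ∈ Sᶜ, e.repr x j • e j := by
          rw [Finset.sum_add_sum_compl]; exact (e.sum_repr x).symm
        simp only [smul_sub, Finset.sum_sub_distrib]
        rw [sub_add_eq_add_sub, ← h0]
      rw [h1]
      refine W.add_mem (W.sum_mem fun j _ => W.smul_mem _ ?_) (W.sum_mem fun j hj => ?_)
      · obtain ⟨z, hz⟩ := hclose j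
        exact ⟨z, hz.symm⟩
      · rw [Finset.mem_compl] at hj
        have h2 := hSc j hj
        obtain ⟨w, hw⟩ := (pow_dvd_pow (p : ℤ_[p]) (show k ≤ α j by omega)).trans (hα2 x hx j)
        refine ⟨w • e j, ?_⟩
        rw [hw, mul_smul]; rfl
    obtain ⟨z, hz⟩ := hmem
    refine ⟨∑ j ∈ S, e.repr x j • e' j, ?_, z, ?_⟩
    · intro l hl
      rw [map_sum]
      refine Finset.sum_eq_zero fun j hj => ?_
      rw [map_smul, hdual, if_neg (show ¬ l = j from fun h => hl (h ▸ hj)), smul_zero]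
    · have : (p : ℤ_[p]) ^ k • z = x - ∑ j ∈ S, e.repr x j • e' j := hz
      rw [this]; abel

/-- **Theorem (local version).**
Let `p` be a prime and `L` a Lie algebra over `ℤ_[p]` which is free of finite rank as a
`ℤ_[p]`-module. Then there exist `n₀ ≥ 0` and a real constant `0 < ε ≤ 1` such that for every
open `ℤ_[p]`-Lie subalgebra `M ⊆ L` of level `p ^ n`, with `n > n₀`, there exists a proper
isolated `ℤ_[p]`-Lie subalgebra `I` of `L` with `M ⊆ I + p ^ ⌈ε n⌉ L`. -/
theorem stmt_1 (p : ℕ) [Fact p.Prime] (L : Type) [LieRing L] [LieAlgebra ℤ_[p] L]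
    [Module.Free ℤ_[p] L] [Module.Finite ℤ_[p] L] :
    ∃ (n₀ : ℕ) (ε : ℝ), 0 < ε ∧ ε ≤ 1 ∧
      ∀ n : ℕ, n₀ < n →
        ∀ M : LieSubalgebra ℤ_[p] L,
          IsLeast {k : ℕ | ∀ x : L, (p : ℤ_[p]) ^ k • x ∈ M} n →
          ∃ I : LieSubalgebra ℤ_[p] L,
            I ≠ ⊤ ∧ (∀ x : L, (p : ℤ_[p]) • x ∈ I → x ∈ I) ∧
            ∀ m ∈ M, ∃ y ∈ I, ∃ z : L, m = y + (p : ℤ_[p]) ^ ⌈ε * (n : ℝ)⌉₊ • z := by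
  obtain ⟨c, hc, h⟩ := gr_main p L
  have hc' : (1 : ℝ) ≤ c := by exact_mod_cast hc
  refine ⟨2 * c, 1 / (2 * c), by positivity, ?_, fun n hn M hM => h n _ ?_ ?_ M hM⟩
  · rw [div_le_one (by positivity)]; linarith
  · refine Nat.one_le_ceil_iff.2 ?_
    have : (0 : ℝ) < n := by exact_mod_cast (by omega : 0 < n)
    positivity
  · have hn' : (2 * c : ℝ) < n := by exact_mod_cast hn
    have h1 := Nat.ceil_lt_add_one (a := 1 / (2 * (c : ℝ)) * n) (by positivity)
    have h2 : (c : ℝ) * ⌈1 / (2 * (c : ℝ)) * n⌉₊ < c * (1 / (2 * (c : ℝ)) * n + 1) := by gcongr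
    have h3 : (c : ℝ) * (1 / (2 * (c : ℝ)) * n + 1) = n / 2 + c := by field_simp
    have h4 : (c : ℝ) * ⌈1 / (2 * (c : ℝ)) * n⌉₊ ≤ n := by linarith
    exact_mod_cast h4
end

section
/- Let L be a Lie algebra over ℤ that is free of rank d as a ℤ-module. Then there exist an integer D₁ > 0 and a real constant ε₁ with 0 < ε₁ ≤ 1 such that the following holds for every prime p and every r with 1 ≤ r ≤ d−1: if x₁, …, x_r are elements of L_p = L ⊗_ℤ ℤ_p whose images in L_p / p L_p are linearly independent over 𝔽_p, and if [x_i, x_j] ∈ ℤ_p x₁ + … + ℤ_p x_r + p^ν L_p for all 1 ≤ i, j ≤ r, where ν > v_p(D₁), then there exist y₁, …, y_r ∈ L_p with y_i − x_i ∈ p^⌈ε₁·ν⌉ L_p for each i, such that I = ℤ_p y₁ + … + ℤ_p y_r is an isolated ℤ_p-Lie subalgebra of L_p that is free of rank r as a ℤ_p-module. -/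
open scoped TensorProduct

open Polynomial in
theorem hensel_dvd (p : ℕ) [Fact p.Prime] (F : ℤ_[p][X]) (a : ℤ_[p]) (k e : ℕ)
    (hk : (p : ℤ_[p]) ^ k ∣ F.eval a) (he : ¬ (p : ℤ_[p]) ^ (e + 1) ∣ F.derivative.eval a)
    (hke : 2 * e < k) :
    ∃ z : ℤ_[p], F.eval z = 0 ∧ (p : ℤ_[p]) ^ (k - e) ∣ z - a := by
  have key : ∀ (x : ℤ_[p]) (n : ℕ), (p : ℤ_[p]) ^ n ∣ x ↔ ‖x‖ ≤ (p : ℝ) ^ (-n : ℤ) := by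
    intro x n
    rw [PadicInt.norm_le_pow_iff_mem_span_pow, Ideal.mem_span_singleton]
  have hp1 : (1 : ℝ) < p := by exact_mod_cast (Fact.out : p.Prime).one_lt
  have hp0 : (0 : ℝ) < p := by linarith
  have hd : (p : ℝ) ^ (-e : ℤ) ≤ ‖F.derivative.eval a‖ := by
    rw [key, PadicInt.norm_le_pow_iff_norm_lt_pow_add_one] at he
    push Not at he
    refine le_trans (le_of_eq ?_) he
    congr 1
    push_cast
    ring
  have hk' := (key _ _).1 hk
  have hnorm : ‖F.aeval a‖ < ‖F.derivative.aeval a‖ ^ 2 := by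
    simp only [coe_aeval_eq_eval]
    calc ‖F.eval a‖ ≤ (p : ℝ) ^ (-k : ℤ) := hk'
      _ < (p : ℝ) ^ (-(2 * e : ℕ) : ℤ) := by
        apply zpow_lt_zpow_right₀ hp1
        omega
      _ = ((p : ℝ) ^ (-e : ℤ)) ^ 2 := by
        rw [← zpow_natCast, ← zpow_mul]
        congr 1
        push_cast
        ring
      _ ≤ _ := by gcongr
  obtain ⟨z, hz, hlt, -, -⟩ := hensels_lemma hnorm
  simp only [coe_aeval_eq_eval] at hz hlt
  refine ⟨z, hz, ?_⟩
  obtain ⟨u, hu⟩ := F.binomExpansion a (z - a)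
  rw [add_sub_cancel, hz] at hu
  have h1 : ‖F.eval a‖ = ‖F.derivative.eval a‖ * ‖z - a‖ := by
    have : F.eval a = - ((F.derivative.eval a + u * (z - a)) * (z - a)) := by
      linear_combination -hu
    rw [this, norm_neg, norm_mul]
    congr 1
    have hlt2 : ‖u * (z - a)‖ < ‖F.derivative.eval a‖ := by
      rw [norm_mul]
      refine lt_of_le_of_lt ?_ hlt
      exact mul_le_of_le_one_left (norm_nonneg _) (PadicInt.norm_le_one u)
    rw [PadicInt.norm_add_eq_max_of_ne hlt2.ne', max_eq_left hlt2.le]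
  rw [key]
  have h2 : (p : ℝ) ^ (-e : ℤ) * ‖z - a‖ ≤ (p : ℝ) ^ (-k : ℤ) := by
    calc _ ≤ ‖F.derivative.eval a‖ * ‖z - a‖ := by gcongr
      _ ≤ _ := by rw [← h1]; exact hk'
  have h3 : (p : ℝ) ^ (-k : ℤ) = (p : ℝ) ^ (-e : ℤ) * (p : ℝ) ^ (-(k - e : ℕ) : ℤ) := by
    rw [← zpow_add₀ hp0.ne']
    congr 1
    omega
  rw [h3] at h2
  exact le_of_mul_le_mul_left h2 (by positivity)

def GProp (R : Type) [CommRing R] : Prop :=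
  ∀ Q : Ideal R, Q.IsPrime → (∀ n : ℕ, n ≠ 0 → (n : R) ∉ Q) →
    ∃ (h : R) (M : ℕ), h ∉ Q ∧ ∀ (p : ℕ) [Fact p.Prime] (ν e : ℕ) (φ : R →+* ℤ_[p]),
      (∀ q ∈ Q, (p : ℤ_[p]) ^ ν ∣ φ q) → ¬ (p : ℤ_[p]) ^ (e + 1) ∣ φ h → M * e < ν →
      ∃ ψ : R →+* ℤ_[p], (∀ q ∈ Q, ψ q = 0) ∧
        ∀ a, (p : ℤ_[p]) ^ (ν - M * e) ∣ ψ a - φ a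

theorem GProp_int : GProp ℤ := by
  intro Q hQ hn
  refine ⟨1, 0, fun h => hQ.ne_top ((Ideal.eq_top_iff_one _).2 h), ?_⟩
  intro p _ ν e φ h1 h2 h3
  refine ⟨φ, ?_, by simp⟩
  intro q hq
  by_cases h : q = 0
  · simp [h]
  · exfalso
    apply hn q.natAbs (by simpa using h)
    rcases Int.natAbs_eq q with h' | h'
    · exact h' ▸ hq
    · have := Q.neg_mem hq
      rw [h', neg_neg] at this
      simpa using this

theorem GProp_equiv {R S : Type} [CommRing R] [CommRing S] (f : R ≃+* S) (hR : GProp R) :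
    GProp S := by
  intro Q hQ hn
  have hQ' : (Q.comap f.toRingHom).IsPrime := Ideal.IsPrime.comap _
  obtain ⟨h, M, hh, H⟩ := hR (Q.comap f.toRingHom) hQ' (by
    intro n hn0 hmem
    apply hn n hn0
    simpa using hmem)
  refine ⟨f h, M, hh, ?_⟩
  intro p _ ν e φ h1 h2 h3
  obtain ⟨ψ, hψ, hc⟩ := H p ν e (φ.comp f.toRingHom) (fun q hq => h1 _ hq) h2 h3
  refine ⟨ψ.comp f.symm.toRingHom, ?_, ?_⟩
  · intro q hq
    apply hψ
    change f (f.symm q) ∈ Q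
    rwa [f.apply_symm_apply]
  · intro a
    simpa using hc (f.symm a)

open Polynomial in
theorem cong_ext {R : Type} [CommRing R] {S : Type} [CommRing S] (m : S) (φ ψ : R[X] →+* S)
    (h1 : ∀ a, m ∣ ψ (C a) - φ (C a)) (h2 : m ∣ ψ X - φ X) (f : R[X]) : m ∣ ψ f - φ f := by
  have key : (Ideal.Quotient.mk (Ideal.span {m})).comp ψ =
      (Ideal.Quotient.mk (Ideal.span {m})).comp φ := by
    apply Polynomial.ringHom_ext
    · intro a
      exact (Ideal.Quotient.eq.2 (Ideal.mem_span_singleton.2 (h1 a)))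
    · exact (Ideal.Quotient.eq.2 (Ideal.mem_span_singleton.2 h2))
  have := congrArg (fun g => g f) key
  exact Ideal.mem_span_singleton.1 (Ideal.Quotient.eq.1 this)

open Polynomial in
theorem vanish_of_coeffs {R S : Type} [CommRing R] [CommRing S] (ψ : R[X] →+* S) (f : R[X])
    (h : ∀ n, ψ (C (f.coeff n)) = 0) : ψ f = 0 := by
  rw [f.as_sum_range_C_mul_X_pow, map_sum]
  apply Finset.sum_eq_zero
  intro i _
  rw [map_mul, h, zero_mul]

open Polynomial in
theorem vanish_of_min {R S : Type} [CommRing R] [CommRing S] [IsDomain S] (ψ : R[X] →+* S)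
    (P : Ideal R[X]) (f : R[X]) (hf : f ∈ P) (hm : 0 < f.natDegree)
    (hmin : ∀ g ∈ P, g.natDegree < f.natDegree → ∀ n, C (g.coeff n) ∈ P)
    (hQ : ∀ a, C a ∈ P → ψ (C a) = 0) (hψf : ψ f = 0) (hc : ψ (C f.leadingCoeff) ≠ 0) :
    ∀ (n : ℕ) (q : R[X]), q.natDegree = n → q ∈ P → ψ q = 0 := by
  intro n
  induction n using Nat.strong_induction_on with
  | _ n ih =>
    intro q hn hq
    by_cases hlt : q.natDegree < f.natDegree
    · exact vanish_of_coeffs ψ q fun i => hQ _ (hmin q hq hlt i)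
    push Not at hlt
    set q' := C f.leadingCoeff * q - C q.leadingCoeff * X ^ (n - f.natDegree) * f with hq'
    have hmem : q' ∈ P := P.sub_mem (P.mul_mem_left _ hq) (P.mul_mem_left _ hf)
    have hdeg : q'.natDegree ≤ n := by
      apply (natDegree_sub_le _ _).trans
      apply max_le
      · exact (natDegree_C_mul_le _ _).trans hn.le
      · refine natDegree_mul_le.trans ?_
        have := natDegree_C_mul_X_pow_le q.leadingCoeff (n - f.natDegree)
        omega
    have hcoeff : q'.coeff n = 0 := by
      have : n = f.natDegree + (n - f.natDegree) := by omega
      rw [hq', coeff_sub, coeff_C_mul, mul_assoc, coeff_C_mul]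
      have e2 : (X ^ (n - f.natDegree) * f).coeff n = f.leadingCoeff := by
        conv_lhs => rw [this, show f.natDegree + (n - f.natDegree) - f.natDegree
          = n - f.natDegree by omega, coeff_X_pow_mul]
        rfl
      have e3 : q.coeff n = q.leadingCoeff := by rw [← hn]; rfl
      rw [e2, e3]
      ring
    have hlt' : q'.natDegree < n := by
      refine lt_of_le_of_ne hdeg ?_
      intro heq
      have : q' = 0 := by
        rw [← leadingCoeff_eq_zero, leadingCoeff, heq, hcoeff]
      rw [this] at heq
      simp at heq
      omega
    have := ih _ hlt' q' rfl hmem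
    rw [hq', map_sub, map_mul, map_mul _ _ f, hψf, mul_zero, sub_zero] at this
    exact (mul_eq_zero.1 this).resolve_left hc

open Polynomial in
theorem GProp_poly {R : Type} [CommRing R] (hR : GProp R) : GProp R[X] := by
  intro P hP hn
  have hQ : (P.comap (C : R →+* R[X])).IsPrime := Ideal.IsPrime.comap _
  have hnQ : ∀ n : ℕ, n ≠ 0 → (n : R) ∉ P.comap (C : R →+* R[X]) := by
    intro n h0 hmem
    apply hn n h0
    simpa using hmem
  obtain ⟨h, M, hh, H⟩ := hR _ hQ hnQ
  by_cases hcase : ∀ f ∈ P, ∀ n, C (f.coeff n) ∈ P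
  · refine ⟨C h, M, hh, ?_⟩
    intro p _ ν e φ h1 h2 h3
    obtain ⟨ψ, hψ, hc⟩ := H p ν e (φ.comp C) (fun q hq => h1 _ hq) h2 h3
    refine ⟨eval₂RingHom ψ (φ X), ?_, ?_⟩
    · intro q hq
      apply vanish_of_coeffs
      intro n
      simpa using hψ _ (hcase q hq n)
    · apply cong_ext
      · intro a
        simpa using hc a
      · simp
  · have hex : ∃ n : ℕ, ∃ f ∈ P, f.natDegree = n ∧ ¬ ∀ n, C (f.coeff n) ∈ P := by
      push Not at hcase ⊢
      obtain ⟨f, hf, n, hn⟩ := hcase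
      exact ⟨_, f, hf, rfl, n, hn⟩
    classical
    obtain ⟨f, hf, hfd, hfc⟩ := Nat.find_spec hex
    have hmin : ∀ g ∈ P, g.natDegree < f.natDegree → ∀ n, C (g.coeff n) ∈ P := by
      intro g hg hlt
      by_contra hcon
      rw [hfd] at hlt
      exact Nat.find_min hex hlt ⟨g, hg, rfl, hcon⟩
    have hpos : 0 < f.natDegree := by
      by_contra h0
      have h0 : f.natDegree = 0 := by omega
      apply hfc
      intro n
      rw [eq_C_of_natDegree_eq_zero h0] at hf ⊢
      rw [coeff_C]
      split_ifs
      · exact hf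
      · simp
    have hlc : C f.leadingCoeff ∉ P := by
      intro hmem
      have h1 : f.eraseLead ∈ P := by
        have : f.eraseLead = f - C f.leadingCoeff * X ^ f.natDegree := by
          rw [self_sub_C_mul_X_pow]
        rw [this]
        exact P.sub_mem hf (P.mul_mem_right _ hmem)
      have h2 : f.eraseLead.natDegree < f.natDegree := by
        have := eraseLead_natDegree_le f
        omega
      apply hfc
      intro n
      by_cases hne : n = f.natDegree
      · rw [hne]; exact hmem
      · rw [← eraseLead_coeff_of_ne n hne]
        exact hmin _ h1 h2 n
    have hder : derivative f ∉ P := by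
      intro hmem
      have := hmin _ hmem (natDegree_derivative_lt hpos.ne') (f.natDegree - 1)
      rw [coeff_derivative, Nat.sub_add_cancel hpos, map_mul] at this
      rcases hP.mem_or_mem this with h' | h'
      · exact hlc h'
      · apply hn f.natDegree hpos.ne'
        have e1 : ((f.natDegree - 1 : ℕ) : R) + 1 = (f.natDegree : R) := by
          have : f.natDegree - 1 + 1 = f.natDegree := Nat.sub_add_cancel hpos
          exact_mod_cast congrArg (Nat.cast : ℕ → R) this
        rw [e1] at h'
        simpa using h'
    refine ⟨C h * C f.leadingCoeff * derivative f, M + 2, ?_, ?_⟩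
    · intro hmem
      rcases hP.mem_or_mem hmem with h' | h'
      · rcases hP.mem_or_mem h' with h' | h'
        · exact hh h'
        · exact hlc h'
      · exact hder h'
    intro p _ ν e φ h1 h2 h3
    rw [map_mul, map_mul] at h2
    have hlt : M * e + 2 * e < ν := by linarith
    obtain ⟨ψ', hψ', hc⟩ := H p ν e (φ.comp C) (fun q hq => h1 _ hq)
      (fun hd => h2 ((hd.mul_right _).mul_right _)) (by omega)
    -- the intermediate hom
    set χ : R[X] →+* ℤ_[p] := eval₂RingHom ψ' (φ X) with hχ
    have hχc : ∀ g, (p : ℤ_[p]) ^ (ν - M * e) ∣ χ g - φ g := by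
      apply cong_ext
      · intro a
        simpa [hχ] using hc a
      · simp [hχ]
    have hev : ∀ g : R[X], ∀ s, eval₂RingHom ψ' s g = (g.map ψ').eval s := by
      intro g s
      rw [coe_eval₂RingHom, eval_map]
    obtain ⟨s, hs, hst⟩ := hensel_dvd p (f.map ψ') (φ X) (ν - M * e) e
      (by
        rw [← hev]
        have a1 := hχc f
        have a2 := h1 f hf
        have a3 := (pow_dvd_pow (p : ℤ_[p]) (Nat.sub_le ν (M * e))).trans a2
        have a4 := dvd_add a1 a3
        rwa [sub_add_cancel] at a4)
      (by
        rw [derivative_map, ← hev]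
        intro hd
        apply h2
        apply Dvd.dvd.mul_left
        have a1 := (pow_dvd_pow (p : ℤ_[p]) (by omega : e + 1 ≤ ν - M * e)).trans
          (hχc (derivative f))
        have a2 := dvd_sub hd a1
        simpa [hχ] using a2)
      (by omega)
    refine ⟨eval₂RingHom ψ' s, ?_, ?_⟩
    · intro q hq
      refine vanish_of_min _ P f hf hpos hmin ?_ ?_ ?_ _ q rfl hq
      · intro a ha
        simpa using hψ' a ha
      · rw [hev]; exact hs
      · simp only [coe_eval₂RingHom, eval₂_C]
        intro h0
        apply h2
        apply Dvd.dvd.mul_right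
        apply Dvd.dvd.mul_left
        have a1 := hc f.leadingCoeff
        rw [h0, zero_sub, dvd_neg] at a1
        exact (pow_dvd_pow (p : ℤ_[p]) (by omega : e + 1 ≤ ν - M * e)).trans a1
    · have hle : ν - (M + 2) * e ≤ ν - M * e - e := by
        have : (M + 2) * e = M * e + 2 * e := by ring
        omega
      apply cong_ext
      · intro a
        simp only [coe_eval₂RingHom, eval₂_C]
        exact (pow_dvd_pow (p : ℤ_[p]) (by omega)).trans (hc a)
      · simp only [coe_eval₂RingHom, eval₂_X]
        exact (pow_dvd_pow (p : ℤ_[p]) hle).trans hst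

theorem GProp_fin (n : ℕ) : GProp (MvPolynomial (Fin n) ℤ) := by
  induction n with
  | zero => exact GProp_equiv (MvPolynomial.isEmptyRingEquiv ℤ (Fin 0)).symm GProp_int
  | succ n ih => exact GProp_equiv (MvPolynomial.finSuccEquiv ℤ n).toRingEquiv.symm (GProp_poly ih)

theorem GProp_fintype (σ : Type) [Fintype σ] : GProp (MvPolynomial σ ℤ) :=
  GProp_equiv (MvPolynomial.renameEquiv ℤ (Fintype.equivFin σ)).toRingEquiv.symm (GProp_fin _)

theorem greenberg {R : Type} [CommRing R] [IsNoetherianRing R] (hR : GProp R) (I : Ideal R) :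
    ∃ (D c : ℕ), 0 < D ∧ 0 < c ∧ ∀ (p : ℕ) [Fact p.Prime] (ν : ℕ) (φ : R →+* ℤ_[p]),
      padicValNat p D < ν → (∀ q ∈ I, (p : ℤ_[p]) ^ ν ∣ φ q) →
      ∃ ψ : R →+* ℤ_[p], (∀ q ∈ I, ψ q = 0) ∧
        ∃ k, ν ≤ c * k ∧ ∀ a, (p : ℤ_[p]) ^ k ∣ ψ a - φ a := by
  induction I using IsNoetherian.induction with
  | hgt I ih =>
  have hsup : ∀ (a : R) (p : ℕ) [Fact p.Prime] (ν μ : ℕ) (φ : R →+* ℤ_[p]), μ ≤ ν →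
      (∀ q ∈ I, (p : ℤ_[p]) ^ ν ∣ φ q) → (p : ℤ_[p]) ^ μ ∣ φ a →
      ∀ q ∈ I ⊔ Ideal.span {a}, (p : ℤ_[p]) ^ μ ∣ φ q := by
    intro a p _ ν μ φ hle h1 h2 q hq
    have : I ⊔ Ideal.span {a} ≤ (Ideal.span {(p : ℤ_[p]) ^ μ}).comap φ := by
      apply sup_le
      · intro q hq
        exact Ideal.mem_span_singleton.2 ((pow_dvd_pow _ hle).trans (h1 q hq))
      · rw [Ideal.span_singleton_le_iff_mem]
        exact Ideal.mem_span_singleton.2 h2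
    exact Ideal.mem_span_singleton.1 (this hq)
  have hgt : ∀ a ∉ I, I < I ⊔ Ideal.span {a} := by
    intro a ha
    refine lt_of_le_of_ne le_sup_left fun h => ha ?_
    rw [h]
    exact Ideal.mem_sup_right (Ideal.mem_span_singleton_self a)
  by_cases hint : ∃ n : ℕ, n ≠ 0 ∧ (n : R) ∈ I
  · obtain ⟨n, hn, hmem⟩ := hint
    refine ⟨n, 1, Nat.pos_of_ne_zero hn, one_pos, ?_⟩
    intro p _ ν φ h1 h2
    exfalso
    have := h2 _ hmem
    rw [map_natCast] at this
    have h3 : p ^ ν ∣ n := by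
      have h4 : (p : ℤ_[p]) ^ ν ∣ ((n : ℤ) : ℤ_[p]) := by exact_mod_cast this
      have := (PadicInt.pow_p_dvd_int_iff ν (n : ℤ)).1 h4
      exact_mod_cast this
    have := (padicValNat_dvd_iff_le hn).1 h3
    omega
  push Not at hint
  by_cases hprime : Ideal.IsPrime I
  · obtain ⟨h, M, hh, H⟩ := hR I hprime hint
    obtain ⟨D, c, hD, hc, K⟩ := ih _ (hgt h hh)
    refine ⟨D ^ (M + 2), (M + 2) * c, pow_pos hD _, by positivity, ?_⟩
    intro p _ ν φ h1 h2
    rw [padicValNat.pow] at h1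
    -- μ = ceil (ν / (M+2))
    obtain ⟨μ, hμ1, hμ2⟩ : ∃ μ, ν ≤ (M + 2) * (μ + 1) ∧ (M + 2) * μ < ν := by
      refine ⟨(ν - 1) / (M + 2), ?_, ?_⟩
      · have := Nat.lt_mul_div_succ (ν - 1) (by omega : 0 < M + 2)
        omega
      · have := Nat.mul_div_le (ν - 1) (M + 2)
        omega
    have hμν : μ + 1 ≤ ν := by nlinarith
    by_cases hd : (p : ℤ_[p]) ^ (μ + 1) ∣ φ h
    · obtain ⟨ψ, hψ, k, hk, hcong⟩ := K p (μ + 1) φ (by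
        have : (M + 2) * padicValNat p D < (M + 2) * (μ + 1) := by omega
        exact Nat.lt_of_mul_lt_mul_left this) (hsup h p ν (μ + 1) φ hμν h2 hd)
      refine ⟨ψ, fun q hq => hψ q (Ideal.mem_sup_left hq), k, ?_, hcong⟩
      calc ν ≤ (M + 2) * (μ + 1) := hμ1
        _ ≤ (M + 2) * (c * k) := by gcongr
        _ = _ := by ring
    · obtain ⟨ψ, hψ, hcong⟩ := H p ν μ φ h2 hd (by nlinarith)
      refine ⟨ψ, hψ, _, ?_, hcong⟩
      have e1 : μ + 1 ≤ ν - M * μ := by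
        have : (M + 2) * μ = M * μ + 2 * μ := by ring
        omega
      calc ν ≤ (M + 2) * (μ + 1) := hμ1
        _ ≤ (M + 2) * (c * (ν - M * μ)) := by
          gcongr
          exact e1.trans (Nat.le_mul_of_pos_left _ hc)
        _ = _ := by ring
  · have htop : I ≠ ⊤ := by
      intro h
      apply hint 1 one_ne_zero
      rw [h]; exact Submodule.mem_top
    obtain ⟨a, ha, b, hb, hab⟩ : ∃ a, a ∉ I ∧ ∃ b, b ∉ I ∧ a * b ∈ I := by
      by_contra hcon
      push Not at hcon
      apply hprime
      refine ⟨htop, ?_⟩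
      intro a b hab
      by_contra h
      push Not at h
      exact hcon a h.1 b h.2 hab
    obtain ⟨D1, c1, hD1, hc1, K1⟩ := ih _ (hgt a ha)
    obtain ⟨D2, c2, hD2, hc2, K2⟩ := ih _ (hgt b hb)
    refine ⟨(D1 * D2) ^ 2, 2 * (c1 + c2), by positivity, by positivity, ?_⟩
    intro p _ ν φ h1 h2
    rw [padicValNat.pow, padicValNat.mul hD1.ne' hD2.ne'] at h1
    obtain ⟨μ, hμ1, hμ2⟩ : ∃ μ, ν ≤ 2 * (μ + 1) ∧ 2 * μ < ν := ⟨(ν - 1) / 2, by omega, by omega⟩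
    have hor : (p : ℤ_[p]) ^ (μ + 1) ∣ φ a ∨ (p : ℤ_[p]) ^ (μ + 1) ∣ φ b := by
      have hab' := h2 _ hab
      rw [map_mul] at hab'
      have hpp : Prime (p : ℤ_[p]) := PadicInt.prime_p
      have : (p : ℤ_[p]) ^ (μ + μ + 1) ∣ φ a * φ b := (pow_dvd_pow _ (by omega)).trans hab'
      by_contra hcon
      push Not at hcon
      rw [← emultiplicity_lt_iff_not_dvd, ← emultiplicity_lt_iff_not_dvd] at hcon
      rw [pow_dvd_iff_le_emultiplicity, emultiplicity_mul hpp] at this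
      obtain ⟨ha', hb'⟩ := hcon
      lift emultiplicity (p : ℤ_[p]) (φ a) to ℕ using ha'.ne_top with A
      lift emultiplicity (p : ℤ_[p]) (φ b) to ℕ using hb'.ne_top with B
      norm_cast at this ha' hb'
      omega
    rcases hor with hd | hd
    · obtain ⟨ψ, hψ, k, hk, hcong⟩ := K1 p (μ + 1) φ (by omega)
        (hsup a p ν (μ + 1) φ (by omega) h2 hd)
      refine ⟨ψ, fun q hq => hψ q (Ideal.mem_sup_left hq), k, ?_, hcong⟩
      nlinarith
    · obtain ⟨ψ, hψ, k, hk, hcong⟩ := K2 p (μ + 1) φ (by omega)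
        (hsup b p ν (μ + 1) φ (by omega) h2 hd)
      refine ⟨ψ, fun q hq => hψ q (Ideal.mem_sup_left hq), k, ?_, hcong⟩
      nlinarith

section
open scoped TensorProduct
theorem tlie_add {L : Type} [LieRing L] {p : ℕ} [Fact p.Prime] (x y z : ℤ_[p] ⊗[ℤ] L) :
    ⁅x, y + z⁆ = ⁅x, y⁆ + ⁅x, z⁆ := lie_add x y z

theorem tlie_smul {L : Type} [LieRing L] {p : ℕ} [Fact p.Prime] (t : ℤ_[p])
    (x y : ℤ_[p] ⊗[ℤ] L) : ⁅x, t • y⁆ = t • ⁅x, y⁆ := lie_smul t x y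

theorem tsmul_lie {L : Type} [LieRing L] {p : ℕ} [Fact p.Prime] (t : ℤ_[p])
    (x y : ℤ_[p] ⊗[ℤ] L) : ⁅t • x, y⁆ = t • ⁅x, y⁆ := smul_lie t x y

theorem tlie_zero {L : Type} [LieRing L] {p : ℕ} [Fact p.Prime] (x : ℤ_[p] ⊗[ℤ] L) :
    ⁅x, (0 : ℤ_[p] ⊗[ℤ] L)⁆ = 0 := lie_zero x

theorem tlie_sum {L ι : Type} [LieRing L] [Fintype ι] {p : ℕ} [Fact p.Prime]
    (x : ℤ_[p] ⊗[ℤ] L) (f : ι → ℤ_[p] ⊗[ℤ] L) : ⁅x, ∑ i, f i⁆ = ∑ i, ⁅x, f i⁆ :=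
  lie_sum Finset.univ f x

theorem tsum_lie {L ι : Type} [LieRing L] [Fintype ι] {p : ℕ} [Fact p.Prime]
    (x : ℤ_[p] ⊗[ℤ] L) (f : ι → ℤ_[p] ⊗[ℤ] L) : ⁅∑ i, f i, x⁆ = ∑ i, ⁅f i, x⁆ :=
  sum_lie Finset.univ f x
end

open scoped TensorProduct in
theorem lie_repr {L ι : Type} [LieRing L] [Fintype ι] (b : Module.Basis ι ℤ L)
    (p : ℕ) [Fact p.Prime] (X Y : ι → ℤ_[p]) (u : ι) :
    (b.baseChange ℤ_[p]).repr ⁅∑ s, X s • (b.baseChange ℤ_[p]) s,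
      ∑ t, Y t • (b.baseChange ℤ_[p]) t⁆ u
      = ∑ s, ∑ t, ((b.repr ⁅b s, b t⁆ u : ℤ) : ℤ_[p]) * X s * Y t := by
  rw [tsum_lie]
  simp only [tlie_sum, map_sum, Finset.sum_apply, Finsupp.coe_finsetSum]
  refine Finset.sum_congr rfl fun s _ => Finset.sum_congr rfl fun t _ => ?_
  rw [tsmul_lie, tlie_smul, Module.Basis.baseChange_apply, Module.Basis.baseChange_apply,
    LieAlgebra.ExtendScalars.bracket_tmul, map_smul, map_smul, Finsupp.smul_apply,
    Finsupp.smul_apply, Module.Basis.baseChange_repr_tmul]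
  simp
  ring

open MvPolynomial in
theorem lie_greenberg {L ι : Type} [LieRing L] [Fintype ι] (b : Module.Basis ι ℤ L) (r : ℕ) :
    ∃ (D c : ℕ), 0 < D ∧ 0 < c ∧ ∀ (p : ℕ) [Fact p.Prime] (ν : ℕ)
      (X : Fin r → ι → ℤ_[p]) (A : Fin r → Fin r → Fin r → ℤ_[p]),
      padicValNat p D < ν →
      (∀ i j u, (p : ℤ_[p]) ^ ν ∣
        (∑ s, ∑ t, ((b.repr ⁅b s, b t⁆ u : ℤ) : ℤ_[p]) * X i s * X j t)
          - ∑ k, A i j k * X k u) →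
      ∃ (Y : Fin r → ι → ℤ_[p]) (A' : Fin r → Fin r → Fin r → ℤ_[p]) (k : ℕ), ν ≤ c * k ∧
        (∀ i s, (p : ℤ_[p]) ^ k ∣ Y i s - X i s) ∧
        (∀ i j u, (∑ s, ∑ t, ((b.repr ⁅b s, b t⁆ u : ℤ) : ℤ_[p]) * Y i s * Y j t)
          = ∑ k, A' i j k * Y k u) := by
  classical
  let σ := (Fin r × ι) ⊕ (Fin r × Fin r × Fin r)
  let F : Fin r × Fin r × ι → MvPolynomial σ ℤ := fun w =>
    (∑ s, ∑ t, C (b.repr ⁅b s, b t⁆ w.2.2) * X (Sum.inl (w.1, s)) * X (Sum.inl (w.2.1, t)))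
      - ∑ k, X (Sum.inr (w.1, w.2.1, k)) * X (Sum.inl (k, w.2.2))
  obtain ⟨D, c, hD, hc, H⟩ := greenberg (GProp_fintype σ) (Ideal.span (Set.range F))
  refine ⟨D, c, hD, hc, ?_⟩
  intro p _ ν X' A hν hdvd
  let pt : σ → ℤ_[p] := Sum.elim (fun w => X' w.1 w.2) (fun w => A w.1 w.2.1 w.2.2)
  obtain ⟨ψ, hψ, k, hk, hcong⟩ := H p ν (eval₂Hom (Int.castRingHom ℤ_[p]) pt) hν (by
    have : Ideal.span (Set.range F) ≤ (Ideal.span {(p : ℤ_[p]) ^ ν}).comap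
        (eval₂Hom (Int.castRingHom ℤ_[p]) pt) := by
      rw [Ideal.span_le]
      rintro _ ⟨⟨i, j, u⟩, rfl⟩
      refine Ideal.mem_span_singleton.2 ?_
      have hC : ∀ n : ℤ, eval₂Hom (Int.castRingHom ℤ_[p]) pt (C n) = n := fun n => by simp
      simp only [F, map_sub, map_sum, map_mul, hC, eval₂Hom_X']
      exact hdvd i j u
    intro q hq
    exact Ideal.mem_span_singleton.1 (this hq))
  refine ⟨fun i s => ψ (X (Sum.inl (i, s))), fun i j k => ψ (X (Sum.inr (i, j, k))), k, hk, ?_, ?_⟩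
  · intro i s
    simpa [pt] using hcong (X (Sum.inl (i, s)))
  · intro i j u
    have := hψ _ (Ideal.subset_span ⟨(i, j, u), rfl⟩)
    have hC : ∀ n : ℤ, ψ (C n) = n := fun n => by
      rw [show (C n : MvPolynomial σ ℤ) = (n : MvPolynomial σ ℤ) from by simp, map_intCast]
    simp only [F, map_sub, map_sum, map_mul, hC] at this
    exact sub_eq_zero.1 this

theorem span_isolated (p : ℕ) [Fact p.Prime] {V ι : Type} [AddCommGroup V] [Module ℤ_[p] V]
    (B : Module.Basis ι ℤ_[p] V) (r : ℕ) (y : Fin r → V)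
    (h : ∀ c : Fin r → ℤ_[p],
            (∃ z : V, ∑ i, c i • y i = (p : ℤ_[p]) • z) → ∀ i, (p : ℤ_[p]) ∣ c i) :
    LinearIndependent ℤ_[p] y ∧
            (∀ v : V, (p : ℤ_[p]) • v ∈ Submodule.span ℤ_[p] (Set.range y) →
              v ∈ Submodule.span ℤ_[p] (Set.range y)) := by
  have hp0 : (p : ℤ_[p]) ≠ 0 := PadicInt.prime_p.ne_zero
  have hcan : ∀ v w : V, (p : ℤ_[p]) • v = (p : ℤ_[p]) • w → v = w := by
    intro v w hvw
    apply B.repr.injective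
    ext i
    have := congrArg (fun a => B.repr a i) hvw
    simpa [hp0] using this
  have hdiv : ∀ (c : Fin r → ℤ_[p]) (v : V), ∑ i, c i • y i = (p : ℤ_[p]) • v →
      ∃ c' : Fin r → ℤ_[p], (∀ i, c i = p * c' i) ∧ ∑ i, c' i • y i = v := by
    intro c v hv
    choose c' hc' using h c ⟨v, hv⟩
    refine ⟨c', hc', hcan _ _ ?_⟩
    rw [← hv, Finset.smul_sum]
    exact Finset.sum_congr rfl fun i _ => by rw [hc' i, mul_smul]
  constructor
  · rw [Fintype.linearIndependent_iff]
    intro c hc i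
    have : ∀ n : ℕ, ∀ c : Fin r → ℤ_[p], ∑ i, c i • y i = 0 → (p : ℤ_[p]) ^ n ∣ c i := by
      intro n
      induction n with
      | zero => simp
      | succ n ih =>
        intro c hc
        obtain ⟨c', h1, h2⟩ := hdiv c 0 (by simpa using hc)
        rw [h1, pow_succ']
        exact mul_dvd_mul_left _ (ih c' h2)
    by_contra hne
    obtain ⟨n, hn⟩ := FiniteMultiplicity.of_prime_left (PadicInt.prime_p (p := p)) hne
    exact hn (this _ c hc)
  · intro v hv
    obtain ⟨c, hc⟩ := (Submodule.mem_span_range_iff_exists_fun ℤ_[p]).1 hv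
    obtain ⟨c', -, h2⟩ := hdiv c v hc
    exact (Submodule.mem_span_range_iff_exists_fun ℤ_[p]).2 ⟨c', h2⟩

/-- **Lemma (lifting of approximate Lie subalgebras).**
Let `L` be a Lie algebra over `ℤ`, free of rank `d` as a `ℤ`-module. There exist `D₁ > 0` and
`0 < ε₁ ≤ 1` such that for every prime `p`, every `1 ≤ r ≤ d - 1`, and all
`x₁, …, x_r ∈ L ⊗ ℤ_[p]` which are linearly independent modulo `p` and satisfy
`[xᵢ, xⱼ] ∈ ∑ ℤ_[p] x_k + p^ν (L ⊗ ℤ_[p])` with `ν > v_p D₁`, there are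
`yᵢ ≡ xᵢ (mod p^⌈ε₁ ν⌉)` spanning an isolated Lie subalgebra `I = ∑ ℤ_[p] yᵢ`
free of rank `r`. -/
theorem stmt_2 (L : Type) [LieRing L] [Module.Free ℤ L] [Module.Finite ℤ L]
    (d : ℕ) (hrank : Module.finrank ℤ L = d) :
    ∃ (D₁ : ℕ) (ε₁ : ℝ), 0 < D₁ ∧ 0 < ε₁ ∧ ε₁ ≤ 1 ∧
      ∀ (p : ℕ) [Fact p.Prime], ∀ r : ℕ, 1 ≤ r → r < d →
        ∀ (x : Fin r → ℤ_[p] ⊗[ℤ] L) (ν : ℕ), padicValNat p D₁ < ν →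
          (∀ c : Fin r → ℤ_[p],
            (∃ z : ℤ_[p] ⊗[ℤ] L, ∑ i, c i • x i = (p : ℤ_[p]) • z) → ∀ i, (p : ℤ_[p]) ∣ c i) →
          (∀ i j : Fin r, ∃ (c : Fin r → ℤ_[p]) (z : ℤ_[p] ⊗[ℤ] L),
            ⁅x i, x j⁆ = (∑ k, c k • x k) + (p : ℤ_[p]) ^ ν • z) →
          ∃ y : Fin r → ℤ_[p] ⊗[ℤ] L,
            (∀ i, ∃ z : ℤ_[p] ⊗[ℤ] L, y i - x i = (p : ℤ_[p]) ^ ⌈ε₁ * (ν : ℝ)⌉₊ • z) ∧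
            LinearIndependent ℤ_[p] y ∧
            (∀ v : ℤ_[p] ⊗[ℤ] L, (p : ℤ_[p]) • v ∈ Submodule.span ℤ_[p] (Set.range y) →
              v ∈ Submodule.span ℤ_[p] (Set.range y)) ∧
            (∀ a ∈ Submodule.span ℤ_[p] (Set.range y), ∀ b ∈ Submodule.span ℤ_[p] (Set.range y),
              ⁅a, b⁆ ∈ Submodule.span ℤ_[p] (Set.range y)) := by
  classical
  let b := Module.finBasis ℤ L
  choose D c hD hc H using fun r => lie_greenberg b r
  have hDpos : 0 < ∏ r ∈ Finset.range d, D r := Finset.prod_pos fun r _ => hD r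
  refine ⟨∏ r ∈ Finset.range d, D r, 1 / ((∑ r ∈ Finset.range d, c r : ℕ) + 1 : ℝ), hDpos,
    by positivity, ?_, ?_⟩
  · rw [div_le_one (by positivity)]
    have : (0 : ℝ) ≤ (∑ r ∈ Finset.range d, c r : ℕ) := by positivity
    linarith
  intro p _ r hr1 hrd x ν hν hind happ
  let B := b.baseChange ℤ_[p]
  have hmem : r ∈ Finset.range d := Finset.mem_range.2 hrd
  have hν' : padicValNat p (D r) < ν := by
    refine lt_of_le_of_lt ?_ hν
    rw [← padicValNat_dvd_iff_le hDpos.ne']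
    exact pow_padicValNat_dvd.trans (Finset.dvd_prod_of_mem D hmem)
  have hx : ∀ i, x i = ∑ s, B.repr (x i) s • B s := fun i => (B.sum_repr (x i)).symm
  choose A z hA using happ
  obtain ⟨Y, A', k, hk, hcong, heq⟩ := H r p ν (fun i s => B.repr (x i) s) A hν' (by
    intro i j u
    rw [← lie_repr b p (fun s => B.repr (x i) s) (fun s => B.repr (x j) s) u]
    change _ ∣ B.repr ⁅∑ s, B.repr (x i) s • B s, ∑ s, B.repr (x j) s • B s⁆ u - _
    rw [← hx i, ← hx j, hA i j]
    simp)
  let y : Fin r → ℤ_[p] ⊗[ℤ] L := fun i => ∑ s, Y i s • B s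
  have hyrepr : ∀ i s, B.repr (y i) s = Y i s := fun i s => by
    simp only [y]
    rw [B.repr_sum_self]
  set n := ⌈1 / ((∑ r ∈ Finset.range d, c r : ℕ) + 1 : ℝ) * (ν : ℝ)⌉₊ with hn
  have hnk : n ≤ k := by
    rw [hn, Nat.ceil_le, one_div, inv_mul_le_iff₀ (by positivity)]
    have h1 : c r ≤ ∑ r ∈ Finset.range d, c r :=
      Finset.single_le_sum (f := c) (fun _ _ => Nat.zero_le _) hmem
    have h2 : ν ≤ ((∑ r ∈ Finset.range d, c r) + 1) * k :=
      hk.trans (Nat.mul_le_mul_right _ (by omega))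
    exact_mod_cast h2
  have hn1 : 1 ≤ n := by
    rw [hn, Nat.one_le_ceil_iff]
    have : (0 : ℝ) < ν := by exact_mod_cast (Nat.zero_le _).trans_lt hν
    positivity
  have hyx : ∀ i, ∃ z : ℤ_[p] ⊗[ℤ] L, y i - x i = (p : ℤ_[p]) ^ n • z := by
    intro i
    choose w hw using fun s => (pow_dvd_pow (p : ℤ_[p]) hnk).trans (hcong i s)
    refine ⟨∑ s, w s • B s, ?_⟩
    apply B.ext_elem
    intro s
    rw [map_sub, map_smul, Finsupp.sub_apply, Finsupp.smul_apply, hyrepr, B.repr_sum_self, hw s,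
      smul_eq_mul]
  have hyind : ∀ c : Fin r → ℤ_[p],
      (∃ z : ℤ_[p] ⊗[ℤ] L, ∑ i, c i • y i = (p : ℤ_[p]) • z) → ∀ i, (p : ℤ_[p]) ∣ c i := by
    rintro c ⟨z, hz⟩
    apply hind
    choose w hw using hyx
    refine ⟨z - ∑ i, c i • (p : ℤ_[p]) ^ (n - 1) • w i, ?_⟩
    have h1 : ∀ i, x i = y i - (p : ℤ_[p]) • (p : ℤ_[p]) ^ (n - 1) • w i := by
      intro i
      rw [smul_smul, ← pow_succ', Nat.sub_add_cancel hn1, ← hw i]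
      abel
    rw [smul_sub, ← hz, Finset.smul_sum, ← Finset.sum_sub_distrib]
    refine Finset.sum_congr rfl fun i _ => ?_
    rw [h1 i, smul_sub, smul_comm (p : ℤ_[p]) (c i)]
  have hylie : ∀ i j, ⁅y i, y j⁆ ∈ Submodule.span ℤ_[p] (Set.range y) := by
    intro i j
    refine (Submodule.mem_span_range_iff_exists_fun ℤ_[p]).2 ⟨A' i j, ?_⟩
    apply B.ext_elem
    intro u
    have h1 := lie_repr b p (Y i) (Y j) u
    rw [heq] at h1
    refine Eq.trans ?_ h1.symm
    simp [hyrepr]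
  obtain ⟨hli, hiso⟩ := span_isolated p B r y hyind
  refine ⟨y, hyx, hli, hiso, ?_⟩
  intro a ha b' hb'
  induction ha using Submodule.span_induction with
  | mem a ha =>
    obtain ⟨i, rfl⟩ := ha
    induction hb' using Submodule.span_induction with
    | mem b' hb' => obtain ⟨j, rfl⟩ := hb'; exact hylie i j
    | zero => rw [tlie_zero]; exact Submodule.zero_mem _
    | add u v _ _ h1 h2 => rw [tlie_add]; exact Submodule.add_mem _ h1 h2
    | smul t u _ h1 => rw [tlie_smul]; exact Submodule.smul_mem _ _ h1
  | zero => simp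
  | add u v _ _ h1 h2 => rw [add_lie]; exact Submodule.add_mem _ h1 h2
  | smul t u _ h1 => rw [smul_lie]; exact Submodule.smul_mem _ _ h1
end

section
/- Let p be an odd prime and let sl₂(ℤ_p) be the Lie algebra of traceless 2×2 matrices over ℤ_p. Then for every n ≥ 1 and every ℤ_p-Lie subalgebra M of sl₂(ℤ_p) that is an open ℤ_p-submodule of level p^n, there exists a proper isolated ℤ_p-Lie subalgebra I of sl₂(ℤ_p) such that M ⊆ I + p^⌈n/2⌉ sl₂(ℤ_p). -/
open LieAlgebra.SpecialLinear

namespace Stmt4Aux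

variable {p : ℕ} [Fact p.Prime]

theorem d11 (x : ↥(sl (Fin 2) ℤ_[p])) : x.1 1 1 = - x.1 0 0 := by
  have h := x.2
  have h2 : Matrix.trace x.1 = 0 := h
  rw [Matrix.trace_fin_two] at h2
  linear_combination h2

/-- build -/
noncomputable def mk (a b c : ℤ_[p]) : ↥(sl (Fin 2) ℤ_[p]) :=
  ⟨!![a, b; c, -a], by
    change Matrix.trace !![a, b; c, -a] = 0
    simp [Matrix.trace_fin_two]⟩

theorem ext3 {x y : ↥(sl (Fin 2) ℤ_[p])} (h0 : x.1 0 0 = y.1 0 0) (h1 : x.1 0 1 = y.1 0 1)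
    (h2 : x.1 1 0 = y.1 1 0) : x = y := by
  apply Subtype.ext
  ext i j
  fin_cases i <;> fin_cases j
  · exact h0
  · exact h1
  · exact h2
  · change x.1 1 1 = y.1 1 1
    rw [d11, d11, h0]

theorem br00 (x y : ↥(sl (Fin 2) ℤ_[p])) :
    (⁅x, y⁆).1 0 0 = x.1 0 1 * y.1 1 0 - y.1 0 1 * x.1 1 0 := by
  rw [sl_bracket]
  simp only [Matrix.sub_apply, Matrix.mul_apply, Fin.sum_univ_two]
  ring

theorem br01 (x y : ↥(sl (Fin 2) ℤ_[p])) :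
    (⁅x, y⁆).1 0 1 = 2 * (x.1 0 0 * y.1 0 1 - y.1 0 0 * x.1 0 1) := by
  rw [sl_bracket]
  simp only [Matrix.sub_apply, Matrix.mul_apply, Fin.sum_univ_two, d11]
  ring

theorem br10 (x y : ↥(sl (Fin 2) ℤ_[p])) :
    (⁅x, y⁆).1 1 0 = 2 * (x.1 1 0 * y.1 0 0 - y.1 1 0 * x.1 0 0) := by
  rw [sl_bracket]
  simp only [Matrix.sub_apply, Matrix.mul_apply, Fin.sum_univ_two, d11]
  ring

/-- coordinates -/
noncomputable def E : ↥(sl (Fin 2) ℤ_[p]) ≃ₗ[ℤ_[p]] (Fin 3 → ℤ_[p]) where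
  toFun x := ![x.1 0 0, x.1 0 1, x.1 1 0]
  map_add' x y := by ext i; fin_cases i <;> rfl
  map_smul' c x := by ext i; fin_cases i <;> rfl
  invFun v := mk (v 0) (v 1) (v 2)
  left_inv x := ext3 rfl rfl rfl
  right_inv v := by ext i; fin_cases i <;> rfl

/-- the form `x ↦ tr (x w)` -/
noncomputable def q (A B C : ℤ_[p]) : ↥(sl (Fin 2) ℤ_[p]) →ₗ[ℤ_[p]] ℤ_[p] where
  toFun x := 2 * x.1 0 0 * A + x.1 0 1 * C + x.1 1 0 * B
  map_add' x y := by
    change 2 * (x.1 0 0 + y.1 0 0) * A + (x.1 0 1 + y.1 0 1) * C + (x.1 1 0 + y.1 1 0) * B = _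
    ring
  map_smul' c x := by
    change 2 * (c * x.1 0 0) * A + (c * x.1 0 1) * C + (c * x.1 1 0) * B = c * _
    ring

theorem q_apply (A B C : ℤ_[p]) (x : ↥(sl (Fin 2) ℤ_[p])) :
    q A B C x = 2 * x.1 0 0 * A + x.1 0 1 * C + x.1 1 0 * B := rfl

/-- orthogonal of an isotropic vector -/
noncomputable def perp (A B C : ℤ_[p]) (h : A * A + B * C = 0) : LieSubalgebra ℤ_[p] ↥(sl (Fin 2) ℤ_[p]) :=
  { LinearMap.ker (q A B C) with
    lie_mem' := by
      intro x y hx hy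
      have hx' : q A B C x = 0 := hx
      have hy' : q A B C y = 0 := hy
      change q A B C ⁅x, y⁆ = 0
      have key : (q A B C ⁅x, y⁆) ^ 2 = 0 := by
        rw [q_apply] at hx' hy' ⊢
        rw [br00, br01, br10]
        generalize x.1 0 0 = a at *
        generalize x.1 0 1 = b at *
        generalize x.1 1 0 = c at *
        generalize y.1 0 0 = a' at *
        generalize y.1 0 1 = b' at *
        generalize y.1 1 0 = c' at *
        have id : (2 * (b * c' - b' * c) * A + 2 * (a * b' - a' * b) * C
            + 2 * (c * a' - c' * a) * B) ^ 2 = -2 * (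
            (2*a*a+2*b*c) * ((2*a'*a'+2*b'*c') * (2 * (A * A + B * C))
              - (2 * a' * A + b' * C + c' * B) ^ 2)
            - (2*a*a'+b*c'+c*b') * ((2*a*a'+b*c'+c*b') * (2 * (A * A + B * C))
              - (2 * a' * A + b' * C + c' * B) * (2 * a * A + b * C + c * B))
            + (2 * a * A + b * C + c * B) * ((2*a*a'+b*c'+c*b') * (2 * a' * A + b' * C + c' * B)
              - (2*a'*a'+2*b'*c') * (2 * a * A + b * C + c * B))) := by ring
        rw [id, h, hx', hy']
        ring
      exact pow_eq_zero_iff (two_ne_zero) |>.1 key }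

theorem mem_perp {A B C : ℤ_[p]} {h : A * A + B * C = 0} {x : ↥(sl (Fin 2) ℤ_[p])} :
    x ∈ perp A B C h ↔ q A B C x = 0 := Iff.rfl

theorem det_unit (X : Module.Basis (Fin 3) ℤ_[p] ↥(sl (Fin 2) ℤ_[p])) :
    IsUnit (Matrix.det (Matrix.of fun i => E (X i))) := by
  have h : (Matrix.of fun i j => X.repr (E.symm (Pi.single i 1)) j) *
      (Matrix.of fun i => E (X i)) = 1 := by
    ext i j
    have h1 := congrFun (congrArg E (X.sum_repr (E.symm (Pi.single i 1)))) j
    rw [map_sum, LinearEquiv.apply_symm_apply] at h1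
    rw [Matrix.mul_apply, Matrix.one_apply]
    rw [Finset.sum_apply] at h1
    simp only [map_smul, Pi.smul_apply, smul_eq_mul] at h1
    simp only [Matrix.of_apply]
    rw [h1, Pi.single_apply]
    simp [eq_comm]
  have h2 := congrArg Matrix.det h
  rw [Matrix.det_mul, Matrix.det_one] at h2
  exact IsUnit.of_mul_eq_one_right _ h2

theorem nonunit_iff (x : ℤ_[p]) : ¬ IsUnit x ↔ (p : ℤ_[p]) ∣ x := by
  rw [PadicInt.not_isUnit_iff, PadicInt.norm_lt_one_iff_dvd]

theorem two_unit (hp : p ≠ 2) : IsUnit (2 : ℤ_[p]) := by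
  by_contra h
  rw [PadicInt.not_isUnit_iff] at h
  have h2 : ((2 : ℕ) : ℤ_[p]) = 2 := by norm_num
  rw [← h2] at h
  have := (PadicInt.norm_natCast_lt_one_iff).1 h
  exact hp ((Nat.prime_dvd_prime_iff_eq Fact.out Nat.prime_two).1 this)

/-- lift to isotropic vector -/
theorem lift (A B C : ℤ_[p]) (m : ℕ) (hm : 1 ≤ m) (hprim : IsUnit A ∨ IsUnit B ∨ IsUnit C)
    (h : (p : ℤ_[p]) ^ m ∣ A * A + B * C) :
    ∃ A' B' C' : ℤ_[p], A' * A' + B' * C' = 0 ∧ (∃ z, q A' B' C' z = 1) ∧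
      (p : ℤ_[p]) ^ m ∣ A' - A ∧ (p : ℤ_[p]) ^ m ∣ B' - B ∧ (p : ℤ_[p]) ^ m ∣ C' - C := by
  have hBC : IsUnit B ∨ IsUnit C := by
    by_contra hn
    push Not at hn
    have hA : IsUnit A := by tauto
    have hB := (nonunit_iff B).1 hn.1
    have h1 : (p : ℤ_[p]) ∣ A * A + B * C := dvd_trans (dvd_pow_self _ (by omega)) h
    have h2 : (p : ℤ_[p]) ∣ A * A := (dvd_add_left (hB.mul_right C)).1 h1
    exact (nonunit_iff _).2 h2 (hA.mul hA)
  obtain ⟨t, ht⟩ := h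
  rcases hBC with hB | hC
  · obtain ⟨u, hu⟩ := hB.exists_right_inv
    refine ⟨A, B, -(A * A * u), ?_, ⟨mk 0 0 u, ?_⟩, by simp, by simp, ⟨-t * u, ?_⟩⟩
    · linear_combination -A * A * hu
    · rw [q_apply]; simp [mk]; linear_combination hu
    · linear_combination (-u) * ht + C * hu
  · obtain ⟨u, hu⟩ := hC.exists_right_inv
    refine ⟨A, -(A * A * u), C, ?_, ⟨mk 0 u 0, ?_⟩, by simp, ⟨-t * u, ?_⟩, by simp⟩
    · linear_combination -A * A * hu
    · rw [q_apply]; simp [mk]; linear_combination hu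
    · linear_combination (-u) * ht + B * hu

theorem smith (M : Submodule ℤ_[p] ↥(sl (Fin 2) ℤ_[p])) (n : ℕ)
    (hM : ∀ x : ↥(sl (Fin 2) ℤ_[p]), (p : ℤ_[p]) ^ n • x ∈ M) :
    ∃ (X : Module.Basis (Fin 3) ℤ_[p] ↥(sl (Fin 2) ℤ_[p])) (e : Fin 3 → ℕ), Monotone e ∧
      (∀ i, (p : ℤ_[p]) ^ e i • X i ∈ M) ∧ ∀ m ∈ M, ∀ i, (p : ℤ_[p]) ^ e i ∣ X.repr m i := by
  have hp0 : (p : ℤ_[p]) ^ n ≠ 0 := pow_ne_zero _ PadicInt.prime_p.ne_zero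
  let b0 : Module.Basis (Fin 3) ℤ_[p] ↥(sl (Fin 2) ℤ_[p]) := Module.Basis.ofEquivFun E
  haveI : Module.Finite ℤ_[p] ↥(sl (Fin 2) ℤ_[p]) := Module.Finite.of_basis b0
  haveI : Module.Free ℤ_[p] ↥(sl (Fin 2) ℤ_[p]) := Module.Free.of_basis b0
  let φ : ↥(sl (Fin 2) ℤ_[p]) →ₗ[ℤ_[p]] M :=
    LinearMap.codRestrict M ((p : ℤ_[p]) ^ n • LinearMap.id) hM
  have hφ : Function.Injective φ := by
    intro x y hxy
    have h : (p : ℤ_[p]) ^ n • x = (p : ℤ_[p]) ^ n • y := congrArg Subtype.val hxy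
    exact smul_right_injective _ hp0 h
  have hr : Module.finrank ℤ_[p] M = Module.finrank ℤ_[p] ↥(sl (Fin 2) ℤ_[p]) :=
    le_antisymm (Submodule.finrank_le M) (LinearMap.finrank_le_finrank_of_injective hφ)
  obtain ⟨X, a, Y, hXY⟩ := Submodule.exists_smith_normal_form_of_rank_eq b0 hr
  have ha : ∀ i, a i ≠ 0 := by
    intro i h0
    have h1 := hXY i
    rw [h0, zero_smul] at h1
    exact Y.ne_zero i (Subtype.ext h1)
  let e : Fin 3 → ℕ := fun i => (a i).valuation
  have hae : ∀ i, a i = PadicInt.unitCoeff (ha i) * (p : ℤ_[p]) ^ e i :=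
    fun i => PadicInt.unitCoeff_spec (ha i)
  refine ⟨X.reindex (Tuple.sort e).symm, e ∘ Tuple.sort e, Tuple.monotone_sort e, ?_, ?_⟩
  · intro i
    rw [Module.Basis.reindex_apply, Equiv.symm_symm, Function.comp_apply]
    generalize Tuple.sort e i = j
    have h1 : a j • X j ∈ M := by rw [← hXY]; exact (Y j).2
    have h3 := hae j
    generalize PadicInt.unitCoeff (ha j) = u at h3
    have h2 := M.smul_mem ((u⁻¹ : ℤ_[p]ˣ) : ℤ_[p]) h1
    rw [h3, smul_smul, ← mul_assoc, Units.inv_mul, one_mul] at h2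
    exact h2
  · intro m hm i
    rw [Module.Basis.repr_reindex_apply, Equiv.symm_symm, Function.comp_apply]
    generalize Tuple.sort e i = j
    have h1 := congrArg Subtype.val (Y.sum_repr ⟨m, hm⟩)
    simp only [Submodule.coe_sum, Submodule.coe_smul, hXY] at h1
    rw [← h1]
    simp only [map_sum, map_smul, Module.Basis.repr_self, Finsupp.coe_finsetSum,
      Finset.sum_apply, Finsupp.smul_apply, smul_eq_mul]
    apply Finset.dvd_sum
    intro s _
    by_cases hs : s = j
    · subst hs
      rw [Finsupp.single_eq_same, mul_one]
      exact Dvd.dvd.mul_left ⟨_, (hae s).trans (mul_comm _ _)⟩ _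
    · simp [Finsupp.single_apply, hs]

end Stmt4Aux

open Stmt4Aux in
/-- **Lemma (sl₂, odd p).**
For an odd prime `p`, every open `ℤ_[p]`-Lie subalgebra `M` of `sl₂(ℤ_[p])` of level `p ^ n`
(`n ≥ 1`) is contained in `I + p ^ ⌈n/2⌉ sl₂(ℤ_[p])` for some proper isolated
`ℤ_[p]`-Lie subalgebra `I` of `sl₂(ℤ_[p])`. -/
theorem stmt_4 (p : ℕ) [Fact p.Prime] (hp : p ≠ 2) (n : ℕ) (hn : 1 ≤ n)
    (M : LieSubalgebra ℤ_[p] ↥(sl (Fin 2) ℤ_[p]))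
    (hlevel : IsLeast {k : ℕ | ∀ x : ↥(sl (Fin 2) ℤ_[p]), (p : ℤ_[p]) ^ k • x ∈ M} n) :
    ∃ I : LieSubalgebra ℤ_[p] ↥(sl (Fin 2) ℤ_[p]),
      I ≠ ⊤ ∧ (∀ x : ↥(sl (Fin 2) ℤ_[p]), (p : ℤ_[p]) • x ∈ I → x ∈ I) ∧
      ∀ m ∈ M, ∃ y ∈ I, ∃ z : ↥(sl (Fin 2) ℤ_[p]),
        m = y + (p : ℤ_[p]) ^ ((n + 1) / 2) • z := by
  obtain ⟨hM, hmin⟩ := hlevel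
  have hp0 : (p : ℤ_[p]) ≠ 0 := PadicInt.prime_p.ne_zero
  obtain ⟨X, e, hmono, hXM, hdvd⟩ := smith M.toSubmodule n hM
  have h01 : e 0 ≤ e 1 := hmono (by decide)
  have h12 : e 1 ≤ e 2 := hmono (by decide)
  have he2 : n ≤ e 2 := by
    by_contra hlt
    have : n ≤ n - 1 := by
      apply hmin
      intro x
      rw [← X.sum_repr x, Finset.smul_sum]
      apply M.toSubmodule.sum_mem
      intro i _
      have hi : e i ≤ n - 1 := by fin_cases i <;> simp <;> omega
      obtain ⟨d, hd⟩ := Nat.exists_eq_add_of_le hi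
      rw [hd, smul_smul, show (p : ℤ_[p]) ^ (e i + d) * X.repr x i =
        ((p : ℤ_[p]) ^ d * X.repr x i) * (p : ℤ_[p]) ^ e i by ring, mul_smul]
      exact M.toSubmodule.smul_mem _ (hXM i)
    omega
  have hexp : ∀ x, x = X.repr x 0 • X 0 + X.repr x 1 • X 1 + X.repr x 2 • X 2 := by
    intro x
    have := X.sum_repr x
    rw [Fin.sum_univ_three] at this
    exact this.symm
  set k := (n + 1) / 2 with hk
  by_cases hb : k ≤ e 1
  · -- rank one
    let I : LieSubalgebra ℤ_[p] ↥(sl (Fin 2) ℤ_[p]) :=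
      { Submodule.span ℤ_[p] {X 0} with
        lie_mem' := by
          intro x y hx hy
          obtain ⟨a, rfl⟩ := Submodule.mem_span_singleton.1 hx
          obtain ⟨b, rfl⟩ := Submodule.mem_span_singleton.1 hy
          rw [smul_lie, lie_smul, lie_self, smul_zero, smul_zero]
          exact Submodule.zero_mem (Submodule.span ℤ_[p] {X 0}) }
    have hI : ∀ x, x ∈ I ↔ ∃ a : ℤ_[p], a • X 0 = x := fun x => Submodule.mem_span_singleton
    refine ⟨I, ?_, ?_, ?_⟩
    · intro ht
      have h1 : X 1 ∈ I := by rw [ht]; exact LieSubalgebra.mem_top _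
      obtain ⟨a, ha⟩ := (hI _).1 h1
      have := DFunLike.congr_fun (congrArg X.repr ha) 1
      simp at this
    · intro x hx
      obtain ⟨a, ha⟩ := (hI _).1 hx
      have h1 := DFunLike.congr_fun (congrArg X.repr ha) 1
      have h2 := DFunLike.congr_fun (congrArg X.repr ha) 2
      simp [hp0] at h1 h2
      refine (hI _).2 ⟨X.repr x 0, ?_⟩
      conv_rhs => rw [hexp x, h1, h2]
      simp
    · intro m hm
      obtain ⟨s, hs⟩ := (pow_dvd_pow (p : ℤ_[p]) hb).trans (hdvd m hm 1)
      obtain ⟨t, ht⟩ := (pow_dvd_pow (p : ℤ_[p]) (hb.trans h12)).trans (hdvd m hm 2)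
      refine ⟨X.repr m 0 • X 0, (hI _).2 ⟨_, rfl⟩, s • X 1 + t • X 2, ?_⟩
      conv_lhs => rw [hexp m, hs, ht]
      rw [smul_add, smul_smul, smul_smul, add_assoc]
  · push Not at hb
    obtain ⟨m, hm⟩ : ∃ m, n = e 0 + e 1 + m := Nat.exists_eq_add_of_le (by omega)
    have hm1 : 1 ≤ m := by omega
    set w := ⁅X 0, X 1⁆ with hw
    set γ := X.repr w 2 with hγ
    have hγd : (p : ℤ_[p]) ^ m ∣ γ := by
      have h1 : ⁅(p : ℤ_[p]) ^ e 0 • X 0, (p : ℤ_[p]) ^ e 1 • X 1⁆ ∈ M :=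
        M.lie_mem (hXM 0) (hXM 1)
      have h2 := hdvd _ h1 2
      rw [smul_lie, lie_smul, smul_smul, map_smul, Finsupp.smul_apply, smul_eq_mul,
        ← pow_add] at h2
      have h3 := (pow_dvd_pow (p : ℤ_[p]) he2).trans h2
      rw [hm, pow_add] at h3
      exact (mul_dvd_mul_iff_left (pow_ne_zero _ hp0)).1 h3
    have hT : IsUnit (q (w.1 0 0) (w.1 0 1) (w.1 1 0) (X 2)) := by
      have h := (two_unit hp).mul (det_unit X)
      rw [Matrix.det_fin_three] at h
      rw [q_apply, hw, br00, br01, br10]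
      convert h using 1
      simp [E]
      ring
    have q0 : q (w.1 0 0) (w.1 0 1) (w.1 1 0) (X 0) = 0 := by
      rw [q_apply, hw, br00, br01, br10]; ring
    have q1 : q (w.1 0 0) (w.1 0 1) (w.1 1 0) (X 1) = 0 := by
      rw [q_apply, hw, br00, br01, br10]; ring
    have hprim : IsUnit (w.1 0 0) ∨ IsUnit (w.1 0 1) ∨ IsUnit (w.1 1 0) := by
      by_contra hc
      push Not at hc
      obtain ⟨c1, c2, c3⟩ := hc
      rw [nonunit_iff] at c1 c2 c3
      refine (nonunit_iff _).2 ?_ hT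
      rw [q_apply]
      exact dvd_add (dvd_add (c1.mul_left _) (c3.mul_left _)) (c2.mul_left _)
    have hiso : (p : ℤ_[p]) ^ m ∣ w.1 0 0 * w.1 0 0 + w.1 0 1 * w.1 1 0 := by
      have h1 : q (w.1 0 0) (w.1 0 1) (w.1 1 0) w =
          γ * q (w.1 0 0) (w.1 0 1) (w.1 1 0) (X 2) := by
        generalize q (w.1 0 0) (w.1 0 1) (w.1 1 0) = f at q0 q1 ⊢
        have h2 := congrArg f (hexp w)
        rw [map_add, map_add, map_smul, map_smul, map_smul, q0, q1] at h2
        rw [h2]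
        simp [hγ]
      rw [← (two_unit hp).dvd_mul_left]
      refine (hγd.mul_right (q (w.1 0 0) (w.1 0 1) (w.1 1 0) (X 2))).trans ?_
      rw [← h1, q_apply]
      exact dvd_of_eq (by ring)
    obtain ⟨A, B, C, hABC, ⟨z, hz⟩, dA, dB, dC⟩ := lift _ _ _ m hm1 hprim hiso
    have hq : ∀ x, q (w.1 0 0) (w.1 0 1) (w.1 1 0) x = 0 → (p : ℤ_[p]) ^ m ∣ q A B C x := by
      intro x hx
      rw [← sub_zero (q A B C x), ← hx, q_apply, q_apply]
      have : (p : ℤ_[p]) ^ m ∣ 2 * x.1 0 0 * (A - w.1 0 0) + x.1 0 1 * (C - w.1 1 0)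
          + x.1 1 0 * (B - w.1 0 1) :=
        dvd_add (dvd_add (dA.mul_left _) (dC.mul_left _)) (dB.mul_left _)
      exact this.trans (dvd_of_eq (by ring))
    refine ⟨perp A B C hABC, ?_, ?_, ?_⟩
    · intro ht
      have h1 : z ∈ perp A B C hABC := by rw [ht]; exact LieSubalgebra.mem_top _
      rw [mem_perp, hz] at h1
      exact one_ne_zero h1
    · intro x hx
      rw [mem_perp, map_smul, smul_eq_mul] at hx
      exact mem_perp.2 ((mul_eq_zero.1 hx).resolve_left hp0)
    · intro x hx
      have hd : (p : ℤ_[p]) ^ k ∣ q A B C x := by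
        rw [hexp x, map_add, map_add, map_smul, map_smul, map_smul]
        simp only [smul_eq_mul]
        refine dvd_add (dvd_add ?_ ?_) ?_
        · refine (pow_dvd_pow (p : ℤ_[p]) (show k ≤ e 0 + m by omega)).trans ?_
          rw [pow_add]
          exact mul_dvd_mul (hdvd x hx 0) (hq _ q0)
        · refine (pow_dvd_pow (p : ℤ_[p]) (show k ≤ e 1 + m by omega)).trans ?_
          rw [pow_add]
          exact mul_dvd_mul (hdvd x hx 1) (hq _ q1)
        · exact ((pow_dvd_pow (p : ℤ_[p]) (show k ≤ e 2 by omega)).trans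
            (hdvd x hx 2)).mul_right _
      obtain ⟨t, ht⟩ := hd
      refine ⟨x - (p : ℤ_[p]) ^ k • t • z, ?_, t • z, by abel⟩
      rw [mem_perp, map_sub, map_smul, map_smul, hz, ht]
      simp
end

section
/- Let p = 2 and let sl₂(ℤ₂) be the Lie algebra of traceless 2×2 matrices over the 2-adic integers ℤ₂. Then for every n ≥ 3 and every ℤ₂-Lie subalgebra M of sl₂(ℤ₂) that is an open ℤ₂-submodule of level 2^n, there exists a proper isolated ℤ₂-Lie subalgebra I of sl₂(ℤ₂) such that M ⊆ I + 2^(⌈n/2⌉ − 1) sl₂(ℤ₂). -/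
open LieAlgebra.SpecialLinear

namespace Sl2Aux

abbrev L := ↥(sl (Fin 2) ℤ_[2])

lemma two_prime : Prime (2 : ℤ_[2]) := by
  simpa using PadicInt.prime_p (p := 2)

lemma isUnit_or_dvd (x : ℤ_[2]) : IsUnit x ∨ (2 : ℤ_[2]) ∣ x := by
  by_cases h : IsUnit x
  · exact Or.inl h
  · right
    have := (PadicInt.norm_lt_one_iff_dvd (p := 2) x).1 (PadicInt.mem_nonunits.1 h)
    simpa using this

noncomputable def mk (a b c : ℤ_[2]) : L := ⟨!![c, a; b, -c], by
  simp [sl, LieAlgebra.SpecialLinear.sl, Matrix.trace_fin_two]⟩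

noncomputable def xe (x : L) : ℤ_[2] := x.1 0 1
noncomputable def xf (x : L) : ℤ_[2] := x.1 1 0
noncomputable def xh (x : L) : ℤ_[2] := x.1 0 0

lemma x11 (x : L) : x.1 1 1 = - x.1 0 0 := by
  have h : Matrix.trace x.1 = 0 := x.2
  rw [Matrix.trace_fin_two] at h
  linear_combination h

lemma eq_mk (x : L) : x = mk (xe x) (xf x) (xh x) := by
  apply Subtype.ext
  ext i j
  fin_cases i <;> fin_cases j <;> simp [mk, xe, xf, xh, x11]

@[simp] lemma xe_mk (a b c) : xe (mk a b c) = a := by simp [xe, mk]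
@[simp] lemma xf_mk (a b c) : xf (mk a b c) = b := by simp [xf, mk]
@[simp] lemma xh_mk (a b c) : xh (mk a b c) = c := by simp [xh, mk]
@[simp] lemma xe_add (x y : L) : xe (x + y) = xe x + xe y := rfl
@[simp] lemma xf_add (x y : L) : xf (x + y) = xf x + xf y := rfl
@[simp] lemma xh_add (x y : L) : xh (x + y) = xh x + xh y := rfl
@[simp] lemma xe_smul (c : ℤ_[2]) (y : L) : xe (c • y) = c * xe y := rfl
@[simp] lemma xf_smul (c : ℤ_[2]) (y : L) : xf (c • y) = c * xf y := rfl
@[simp] lemma xh_smul (c : ℤ_[2]) (y : L) : xh (c • y) = c * xh y := rfl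
@[simp] lemma xe_br (x y : L) : xe ⁅x, y⁆ = 2 * (xh x * xe y - xe x * xh y) := by
  simp only [xe, xf, xh, sl_bracket, Matrix.sub_apply, Matrix.mul_apply, Fin.sum_univ_two, x11]
  ring
@[simp] lemma xf_br (x y : L) : xf ⁅x, y⁆ = -2 * (xh x * xf y - xf x * xh y) := by
  simp only [xe, xf, xh, sl_bracket, Matrix.sub_apply, Matrix.mul_apply, Fin.sum_univ_two, x11]
  ring
@[simp] lemma xh_br (x y : L) : xh ⁅x, y⁆ = xe x * xf y - xf x * xe y := by
  simp only [xe, xf, xh, sl_bracket, Matrix.sub_apply, Matrix.mul_apply, Fin.sum_univ_two, x11]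
  ring

lemma ext3 {x y : L} (h1 : xe x = xe y) (h2 : xf x = xf y) (h3 : xh x = xh y) : x = y := by
  rw [eq_mk x, eq_mk y, h1, h2, h3]

noncomputable def E : L ≃ₗ[ℤ_[2]] (Fin 3 → ℤ_[2]) where
  toFun x := ![xe x, xf x, xh x]
  invFun v := mk (v 0) (v 1) (v 2)
  map_add' x y := by ext i; fin_cases i <;> simp
  map_smul' x y := by ext i; fin_cases i <;> simp
  left_inv x := by simpa using (eq_mk x).symm
  right_inv v := by ext i; fin_cases i <;> simp

lemma smith (n : ℕ) (hn : 3 ≤ n) (M : Submodule ℤ_[2] L)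
    (hlevel : IsLeast {k : ℕ | ∀ x : L, (2 : ℤ_[2]) ^ k • x ∈ M} n) :
    ∃ (b : Module.Basis (Fin 3) ℤ_[2] L) (e : Fin 3 → ℕ), e 0 = n ∧
      (∀ i, (2 : ℤ_[2]) ^ e i • b i ∈ M) ∧ ∀ x ∈ M, ∀ i, (2 : ℤ_[2]) ^ e i ∣ b.repr x i := by
  have key : ∃ (b : Module.Basis (Fin 3) ℤ_[2] L) (e : Fin 3 → ℕ), (∀ i, e i ≤ n) ∧
      (∀ i, (2 : ℤ_[2]) ^ e i • b i ∈ M) ∧ ∀ x ∈ M, ∀ i, (2 : ℤ_[2]) ^ e i ∣ b.repr x i := by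
    obtain ⟨m, S⟩ := Submodule.smithNormalForm (Module.Basis.ofEquivFun E) M
    have h2 : ∀ i, (2 : ℤ_[2]) ^ n • S.bM i ∈ M := fun i => hlevel.1 _
    have main : ∀ i, ∃ e : ℕ, e ≤ n ∧ (2 : ℤ_[2]) ^ e • S.bM i ∈ M ∧
        ∀ x ∈ M, (2 : ℤ_[2]) ^ e ∣ S.bM.repr x i := by
      intro i
      have hi : i ∈ Set.range S.f := by
        by_contra hi
        have := S.repr_eq_zero_of_notMem_range ⟨_, h2 i⟩ hi
        simp at this
      obtain ⟨j, rfl⟩ := hi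
      have hd : ∀ x ∈ M, S.a j ∣ S.bM.repr x (S.f j) := by
        intro x hx
        have := S.repr_apply_embedding_eq_repr_smul ⟨x, hx⟩ (i := j)
        refine ⟨S.bN.repr ⟨x, hx⟩ j, ?_⟩
        rw [map_smul, Finsupp.smul_apply, smul_eq_mul] at this
        exact this
      have h3 : S.a j ∣ 2 ^ n := by
        have := hd _ (h2 (S.f j))
        simpa using this
      obtain ⟨e, he, u, hu⟩ := (dvd_prime_pow two_prime n).1 h3
      refine ⟨e, he, ?_, fun x hx => ?_⟩
      · rw [← hu, mul_comm, mul_smul, ← S.snf]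
        exact M.smul_mem _ (S.bN j).2
      · rw [← hu]
        exact (Units.mul_right_dvd).2 (hd x hx)
    choose e h1 h2 h3 using main
    exact ⟨S.bM, e, h1, h2, fun x hx i => h3 i x hx⟩
  obtain ⟨b, e, he, h1, h2⟩ := key
  have hex : ∃ i, e i = n := by
    by_contra! hne
    have : n ≤ n - 1 := hlevel.2 (by
      intro x
      rw [← b.sum_repr x, Finset.smul_sum]
      refine M.sum_mem fun i _ => ?_
      have h4 : e i + (n - 1 - e i) = n - 1 := by
        have := he i
        have := hne i
        omega
      rw [← h4, pow_add, smul_smul,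
        show (2 : ℤ_[2]) ^ e i * 2 ^ (n - 1 - e i) * b.repr x i
          = (2 ^ (n - 1 - e i) * b.repr x i) * 2 ^ e i by ring, mul_smul]
      exact M.smul_mem _ (h1 i))
    omega
  obtain ⟨i, hi⟩ := hex
  refine ⟨b.reindex (Equiv.swap 0 i), fun l => e (Equiv.swap 0 i l), by simp [hi], ?_, ?_⟩
  · intro l
    simpa using h1 _
  · intro x hx l
    simpa using h2 x hx _

/-- the case of a line -/
lemma line (b : Module.Basis (Fin 3) ℤ_[2] L) (m : ℕ) (M : Submodule ℤ_[2] L) (j k : Fin 3)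
    (hjk : ∀ l, l = 0 ∨ l = j ∨ l = k) (hk : k ≠ j) (hj0 : j ≠ 0) (hk0 : k ≠ 0)
    (h : ∀ x ∈ M, (2 : ℤ_[2]) ^ m ∣ b.repr x 0 ∧ (2 : ℤ_[2]) ^ m ∣ b.repr x k) :
    ∃ I : LieSubalgebra ℤ_[2] L, I ≠ ⊤ ∧ (∀ x : L, (2 : ℤ_[2]) • x ∈ I → x ∈ I) ∧
      ∀ x ∈ M, ∃ y ∈ I, ∃ z : L, x = y + (2 : ℤ_[2]) ^ m • z := by
  let I : LieSubalgebra ℤ_[2] L :=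
    { (ℤ_[2] ∙ b j) with
      lie_mem' := by
        intro x y hx hy
        obtain ⟨c, rfl⟩ := Submodule.mem_span_singleton.1 hx
        obtain ⟨d, rfl⟩ := Submodule.mem_span_singleton.1 hy
        simp }
  have hI : ∀ x, x ∈ I ↔ x ∈ (ℤ_[2] ∙ b j) := fun x => Iff.rfl
  have hI' : ∀ x, x ∈ I ↔ ∀ l, l ≠ j → b.repr x l = 0 := by
    intro x
    rw [hI, Submodule.mem_span_singleton]
    constructor
    · rintro ⟨c, rfl⟩ l hl
      simp [Finsupp.single_apply, hl.symm]
    · intro hx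
      refine ⟨b.repr x j, ?_⟩
      conv_rhs => rw [← b.sum_repr x]
      rw [Finset.sum_eq_single j]
      · intro l _ hl
        simp [hx l hl]
      · simp
  refine ⟨I, ?_, ?_, ?_⟩
  · intro htop
    have : b k ∈ I := by rw [htop]; trivial
    have := (hI' _).1 this k hk
    simp at this
  · intro x hx
    rw [hI'] at hx ⊢
    intro l hl
    have := hx l hl
    simpa using this
  · intro x hx
    obtain ⟨⟨c, hc⟩, ⟨d, hd⟩⟩ := h x hx
    refine ⟨b.repr x j • b j, ?_, c • b 0 + d • b k, ?_⟩
    · rw [hI]; exact Submodule.smul_mem _ _ (Submodule.mem_span_singleton_self _)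
    · apply b.repr.injective
      ext l
      rcases hjk l with rfl | rfl | rfl
      · simp [hj0, hk0, hc]
      · simp [hj0.symm, hk]
      · simp [hk.symm, hk0.symm, hd]

lemma plane (p q r : ℤ_[2]) (hQ : r ^ 2 + 4 * (p * q) = 0) (hu : IsUnit p ∨ IsUnit q) (m : ℕ)
    (M : Submodule ℤ_[2] L)
    (h : ∀ x ∈ M, (2 : ℤ_[2]) ^ m ∣ p * xe x + q * xf x + r * xh x) :
    ∃ I : LieSubalgebra ℤ_[2] L, I ≠ ⊤ ∧ (∀ x : L, (2 : ℤ_[2]) • x ∈ I → x ∈ I) ∧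
      ∀ x ∈ M, ∃ y ∈ I, ∃ z : L, x = y + (2 : ℤ_[2]) ^ m • z := by
  let I : LieSubalgebra ℤ_[2] L :=
    { carrier := {x | p * xe x + q * xf x + r * xh x = 0}
      add_mem' := by
        intro x y hx hy
        simp only [Set.mem_setOf_eq, xe_add, xf_add, xh_add] at *
        linear_combination hx + hy
      zero_mem' := by
        show p * (0 : ℤ_[2]) + q * 0 + r * 0 = 0
        ring
      smul_mem' := by
        intro c x hx
        simp only [Set.mem_setOf_eq, xe_smul, xf_smul, xh_smul] at *
        linear_combination c * hx
      lie_mem' := by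
        intro x y hx hy
        change p * xe x + q * xf x + r * xh x = 0 at hx
        change p * xe y + q * xf y + r * xh y = 0 at hy
        change p * xe ⁅x, y⁆ + q * xf ⁅x, y⁆ + r * xh ⁅x, y⁆ = 0
        rw [xe_br, xf_br, xh_br]
        rcases hu with hu | hu
        · apply hu.mul_left_cancel
          linear_combination (xf x * xh y - xh x * xf y) * hQ +
            (-2 * p * xh y + r * xf y) * hx + (2 * p * xh x - r * xf x) * hy
        · apply hu.mul_left_cancel
          linear_combination (-xe x * xh y + xh x * xe y) * hQ +
            (2 * q * xh y - r * xe y) * hx + (-2 * q * xh x + r * xe x) * hy }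
  have hI : ∀ x, x ∈ I ↔ p * xe x + q * xf x + r * xh x = 0 := fun x => Iff.rfl
  have hs : ∀ t, ∃ z : L, p * xe z + q * xf z + r * xh z = t := by
    intro t
    rcases hu with hu | hu
    · obtain ⟨u, hu⟩ := hu.exists_right_inv
      exact ⟨mk (u * t) 0 0, by simp; linear_combination t * hu⟩
    · obtain ⟨u, hu⟩ := hu.exists_right_inv
      exact ⟨mk 0 (u * t) 0, by simp; linear_combination t * hu⟩
  refine ⟨I, ?_, ?_, ?_⟩
  · intro htop
    obtain ⟨z, hz⟩ := hs 1
    have : z ∈ I := by rw [htop]; trivial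
    rw [hI, hz] at this
    exact one_ne_zero this
  · intro x hx
    rw [hI] at hx ⊢
    simp only [xe_smul, xf_smul, xh_smul] at hx
    have : (2 : ℤ_[2]) * (p * xe x + q * xf x + r * xh x) = 0 := by linear_combination hx
    simpa using this
  · intro x hx
    obtain ⟨t, ht⟩ := h x hx
    obtain ⟨z, hz⟩ := hs t
    refine ⟨x + (-2 ^ m : ℤ_[2]) • z, ?_, z, by simp⟩
    rw [hI]
    simp only [xe_add, xf_add, xh_add, xe_smul, xf_smul, xh_smul]
    linear_combination ht - 2 ^ m * hz

lemma adjust (p q r : ℤ_[2]) (K : ℕ) (hK : 1 ≤ K) (hQ : (2 : ℤ_[2]) ^ (K + 2) ∣ r ^ 2 + 4 * (p * q))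
    (hprim : ∃ a b c, p * a + q * b + r * c = 1) :
    ∃ p' q', r ^ 2 + 4 * (p' * q') = 0 ∧ (IsUnit p' ∨ IsUnit q') ∧
      (2 : ℤ_[2]) ^ K ∣ p' - p ∧ (2 : ℤ_[2]) ^ K ∣ q' - q := by
  have hr : (2 : ℤ_[2]) ∣ r := by
    apply two_prime.dvd_of_dvd_pow (n := 2)
    have h1 : (2 : ℤ_[2]) ∣ r ^ 2 + 4 * (p * q) := (dvd_pow_self _ (by omega)).trans hQ
    have h2 : (2 : ℤ_[2]) ∣ 4 * (p * q) := ⟨2 * (p * q), by ring⟩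
    exact (dvd_add_left h2).1 h1
  obtain ⟨s, rfl⟩ := hr
  obtain ⟨t, ht⟩ := hQ
  have ht' : s ^ 2 + p * q = 2 ^ K * t := by
    have h4 : (4 : ℤ_[2]) ≠ 0 := by norm_num
    apply mul_left_cancel₀ h4
    rw [pow_add] at ht
    linear_combination ht
  obtain ⟨a, b, c, habc⟩ := hprim
  rcases isUnit_or_dvd p with hp | hp
  · obtain ⟨u, hu⟩ := hp.exists_right_inv
    refine ⟨p, - (u * s ^ 2), ?_, Or.inl hp, by simp, ⟨- u * t, ?_⟩⟩
    · linear_combination -4 * s ^ 2 * hu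
    · linear_combination -u * ht' + q * hu
  rcases isUnit_or_dvd q with hq | hq
  · obtain ⟨u, hu⟩ := hq.exists_right_inv
    refine ⟨- (u * s ^ 2), q, ?_, Or.inr hq, ⟨- u * t, ?_⟩, by simp⟩
    · linear_combination -4 * s ^ 2 * hu
    · linear_combination -u * ht' + p * hu
  exfalso
  apply two_prime.not_unit
  apply isUnit_of_dvd_one
  rw [← habc]
  exact dvd_add (dvd_add (hp.mul_right _) (hq.mul_right _)) ((dvd_mul_right _ _).mul_right _)

/-- the value of the form -/
lemma form (b : Module.Basis (Fin 3) ℤ_[2] L) (p q r d : ℤ_[2])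
    (hφ : ∀ x, b.repr x 0 = p * xe x + q * xf x + r * xh x)
    (hd : d ∣ b.repr ⁅b 1, b 2⁆ 0) : d ∣ r ^ 2 + 4 * (p * q) := by
  have hker : ∀ x y : L, b.repr x 0 = 0 → b.repr y 0 = 0 → d ∣ b.repr ⁅x, y⁆ 0 := by
    intro x y hx hy
    have hx' := b.sum_repr x
    have hy' := b.sum_repr y
    rw [Fin.sum_univ_three, hx, zero_smul, zero_add] at hx'
    rw [Fin.sum_univ_three, hy, zero_smul, zero_add] at hy'
    have : ⁅x, y⁆ = (b.repr x 1 * b.repr y 2 - b.repr x 2 * b.repr y 1) • ⁅b 1, b 2⁆ := by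
      conv_lhs => rw [← hx', ← hy']
      apply ext3 <;> simp <;> ring
    rw [this]
    simpa using hd.mul_left _
  have e1 := hker (mk q (-p) 0) (mk r 0 (-p)) (by rw [hφ]; simp; ring) (by rw [hφ]; simp; ring)
  have e2 := hker (mk q (-p) 0) (mk 0 r (-q)) (by rw [hφ]; simp; ring) (by rw [hφ]; simp; ring)
  have e3 := hker (mk r 0 (-p)) (mk 0 r (-q)) (by rw [hφ]; simp; ring) (by rw [hφ]; simp; ring)
  have hone : p * xe (b 0) + q * xf (b 0) + r * xh (b 0) = 1 := by
    rw [← hφ]; simp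
  rw [hφ] at e1 e2 e3
  simp only [xe_br, xf_br, xh_br, xe_mk, xf_mk, xh_mk] at e1 e2 e3
  have := dvd_add (dvd_add (e1.mul_right (xe (b 0))) (e2.mul_right (xf (b 0))))
    (e3.mul_right (xh (b 0)))
  convert this using 1
  linear_combination -(r ^ 2 + 4 * (p * q)) * hone

end Sl2Aux

open Sl2Aux in
/-- **Lemma (sl₂, p = 2).**
Every open `ℤ_[2]`-Lie subalgebra `M` of `sl₂(ℤ_[2])` of level `2 ^ n` with `n ≥ 3`
is contained in `I + 2 ^ (⌈n/2⌉ - 1) sl₂(ℤ_[2])` for some proper isolated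
`ℤ_[2]`-Lie subalgebra `I` of `sl₂(ℤ_[2])`. -/
theorem stmt_5 (n : ℕ) (hn : 3 ≤ n)
    (M : LieSubalgebra ℤ_[2] ↥(sl (Fin 2) ℤ_[2]))
    (hlevel : IsLeast {k : ℕ | ∀ x : ↥(sl (Fin 2) ℤ_[2]), (2 : ℤ_[2]) ^ k • x ∈ M} n) :
    ∃ I : LieSubalgebra ℤ_[2] ↥(sl (Fin 2) ℤ_[2]),
      I ≠ ⊤ ∧ (∀ x : ↥(sl (Fin 2) ℤ_[2]), (2 : ℤ_[2]) • x ∈ I → x ∈ I) ∧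
      ∀ m ∈ M, ∃ y ∈ I, ∃ z : ↥(sl (Fin 2) ℤ_[2]),
        m = y + (2 : ℤ_[2]) ^ ((n + 1) / 2 - 1) • z := by
  obtain ⟨b, e, he0, hM, hdiv⟩ := smith n hn M.toSubmodule hlevel
  set m := (n + 1) / 2 - 1 with hm
  have hd0 : ∀ x ∈ M.toSubmodule, (2 : ℤ_[2]) ^ m ∣ b.repr x 0 := fun x hx =>
    (pow_dvd_pow _ (by omega)).trans (hdiv x hx 0)
  by_cases h1 : m ≤ e 1
  · exact line b m M.toSubmodule 2 1 (by decide) (by decide) (by decide) (by decide)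
      fun x hx => ⟨hd0 x hx, (pow_dvd_pow _ h1).trans (hdiv x hx 1)⟩
  by_cases h2 : m ≤ e 2
  · exact line b m M.toSubmodule 1 2 (by decide) (by decide) (by decide) (by decide)
      fun x hx => ⟨hd0 x hx, (pow_dvd_pow _ h2).trans (hdiv x hx 2)⟩
  obtain ⟨K, hK⟩ : ∃ K, n = e 1 + e 2 + (K + 2) := ⟨n - e 1 - e 2 - 2, by omega⟩
  obtain ⟨p, q, r, hφ⟩ : ∃ p q r, ∀ x, b.repr x 0 = p * xe x + q * xf x + r * xh x := by
    refine ⟨b.repr (mk 1 0 0) 0, b.repr (mk 0 1 0) 0, b.repr (mk 0 0 1) 0, fun x => ?_⟩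
    have : x = xe x • mk 1 0 0 + xf x • mk 0 1 0 + xh x • mk 0 0 1 := by
      apply ext3 <;> simp
    conv_lhs => rw [this]
    simp [mul_comm]
  have hQ := form b p q r (2 ^ (K + 2)) hφ (by
    have hb : ⁅(2 : ℤ_[2]) ^ e 1 • b 1, (2 : ℤ_[2]) ^ e 2 • b 2⁆ ∈ M := M.lie_mem (hM 1) (hM 2)
    have h3 := hdiv _ hb 0
    have h4 : ⁅(2 : ℤ_[2]) ^ e 1 • b 1, (2 : ℤ_[2]) ^ e 2 • b 2⁆
        = (2 : ℤ_[2]) ^ (e 1 + e 2) • ⁅b 1, b 2⁆ := by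
      apply ext3 <;> simp <;> ring
    rw [h4, he0, hK, pow_add 2 (e 1 + e 2)] at h3
    simp only [map_smul, Finsupp.smul_apply, smul_eq_mul] at h3
    exact (mul_dvd_mul_iff_left (pow_ne_zero _ two_ne_zero)).1 h3)
  obtain ⟨p', q', hQ', hu, hp, hq⟩ := adjust p q r K (by omega) hQ
    ⟨xe (b 0), xf (b 0), xh (b 0), by rw [← hφ]; simp⟩
  refine plane p' q' r hQ' hu m M.toSubmodule fun x hx => ?_
  have hcoord : ∃ w : L, x = (2 : ℤ_[2]) ^ min (e 1) (e 2) • w := by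
    have : ∀ i, (2 : ℤ_[2]) ^ min (e 1) (e 2) ∣ b.repr x i := by
      intro i
      refine (pow_dvd_pow _ ?_).trans (hdiv x hx i)
      fin_cases i <;> simp <;> omega
    choose c hc using this
    refine ⟨∑ i, c i • b i, ?_⟩
    conv_lhs => rw [← b.sum_repr x]
    simp [hc, Finset.smul_sum, mul_smul]
  obtain ⟨w, hw⟩ := hcoord
  have hsmall : ∀ d u : ℤ_[2], 2 ^ K ∣ d → (2 : ℤ_[2]) ^ m ∣ d * (2 ^ min (e 1) (e 2) * u) := by
    intro d u hd
    rw [← mul_assoc]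
    refine Dvd.dvd.mul_right ?_ _
    refine dvd_trans ?_ (mul_dvd_mul_right hd _)
    rw [← pow_add]
    exact pow_dvd_pow _ (by omega)
  have hxe : xe x = 2 ^ min (e 1) (e 2) * xe w := by rw [hw]; simp
  have hxf : xf x = 2 ^ min (e 1) (e 2) * xf w := by rw [hw]; simp
  have := dvd_add (hd0 x hx) (dvd_add (hsmall _ (xe w) hp) (hsmall _ (xf w) hq))
  rw [← hxe, ← hxf, hφ] at this
  convert this using 1
  ring
end

section
/- Let N ≥ 1 be an integer and p a prime with p > 2N. Then: (i) for every residually nilpotent x ∈ gl(N,ℤ_p) the series exp x converges p-adically, its sum has entries in ℤ_p, and exp x is a residually unipotent element of GL(N,ℤ_p); (ii) for every residually unipotent u ∈ GL(N,ℤ_p) the series log u converges p-adically, its sum has entries in ℤ_p, and log u is a residually nilpotent element of gl(N,ℤ_p); (iii) log(exp x) = x for every residually nilpotent x ∈ gl(N,ℤ_p) and exp(log u) = u for every residually unipotent u ∈ GL(N,ℤ_p); in particular exp is a bijection from the set of residually nilpotent elements of gl(N,ℤ_p) onto the set of residually unipotent elements of GL(N,ℤ_p), with inverse log. -/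
/-- The exponential series `∑ zᵏ/k!` of a square matrix over `ℚ_[p]`. -/
noncomputable def matExp {p : ℕ} [Fact p.Prime] {N : ℕ}
    (z : Matrix (Fin N) (Fin N) ℚ_[p]) : Matrix (Fin N) (Fin N) ℚ_[p] :=
  ∑' k : ℕ, ((k.factorial : ℚ_[p]))⁻¹ • z ^ k

/-- The logarithm series `-∑_{k ≥ 1} (1 - z)ᵏ/k` of a square matrix over `ℚ_[p]`
(the `k = 0` term vanishes since `(0 : ℚ_[p])⁻¹ = 0`). -/
noncomputable def matLog {p : ℕ} [Fact p.Prime] {N : ℕ}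
    (z : Matrix (Fin N) (Fin N) ℚ_[p]) : Matrix (Fin N) (Fin N) ℚ_[p] :=
  -∑' k : ℕ, ((k : ℚ_[p]))⁻¹ • (1 - z) ^ k

/-- The coefficient-wise coercion of a matrix over `ℤ_[p]` to a matrix over `ℚ_[p]`. -/
def matQ {p : ℕ} [Fact p.Prime] {N : ℕ}
    (x : Matrix (Fin N) (Fin N) ℤ_[p]) : Matrix (Fin N) (Fin N) ℚ_[p] :=
  x.map (fun a => (a : ℚ_[p]))

/-- `x ∈ gl(N, ℤ_[p])` is residually nilpotent: `x^m ≡ 0 (mod p)` for some `m ≥ 1`. -/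
def ResNilp {p : ℕ} [Fact p.Prime] {N : ℕ} (x : Matrix (Fin N) (Fin N) ℤ_[p]) : Prop :=
  ∃ m : ℕ, 1 ≤ m ∧ ∀ i j, (p : ℤ_[p]) ∣ (x ^ m) i j

/-- `u` is a residually unipotent element of `GL(N, ℤ_[p])`: `u` is invertible over `ℤ_[p]`
and `u^(p^m) ≡ 1 (mod p)` for some `m ≥ 0`. -/
def ResUnip {p : ℕ} [Fact p.Prime] {N : ℕ} (u : Matrix (Fin N) (Fin N) ℤ_[p]) : Prop :=
  IsUnit u ∧ ∃ m : ℕ, ∀ i j, (p : ℤ_[p]) ∣ (u ^ (p ^ m) - 1) i j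

open PowerSeries in
theorem aux_log_exp {K : Type*} [Field K] [Algebra ℚ K] [CharZero K] :
    (PowerSeries.log K).subst (PowerSeries.exp K - 1) = (X : PowerSeries K) := by
  have hs : HasSubst (PowerSeries.exp K - 1) := HasSubst.of_constantCoeff_zero' (by simp)
  apply derivative.ext
  · rw [derivative_subst hs, derivative_X, deriv_log]
    have h1 : (mk fun n ↦ algebraMap ℚ K ((-1 : ℚ) ^ n)) * (1 + X : PowerSeries K) = 1 := by
      ext n
      rw [mul_add, mul_one]
      cases n with
      | zero => simp
      | succ n => simp [coeff_succ_mul_X, pow_succ, coeff_one]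
    have h2 := congrArg (PowerSeries.subst (PowerSeries.exp K - 1)) h1
    rw [subst_mul hs, subst_add hs, subst_X hs] at h2
    have h3 : (1 : PowerSeries K).subst (PowerSeries.exp K - 1) = (1 : PowerSeries K) := by
      rw [← coe_substAlgHom hs, map_one]
    rw [h3] at h2
    simp only [map_sub, derivative_exp, derivative_one]
    simpa using h2
  · have := constantCoeff_subst_eq_zero (a := PowerSeries.exp K - 1)
      (show PowerSeries.constantCoeff (PowerSeries.exp K - 1) = 0 by simp) (PowerSeries.log K) (by simp)
    rw [constantCoeff_X]
    exact this

open PowerSeries in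
theorem aux_exp_log {K : Type*} [Field K] [Algebra ℚ K] [CharZero K] :
    (PowerSeries.exp K - 1).subst (PowerSeries.log K) = (X : PowerSeries K) := by
  set P := PowerSeries.exp K - 1 with hP
  have hP0 : P.constantCoeff = 0 := by simp [hP]
  have hs : HasSubst P := HasSubst.of_constantCoeff_zero' hP0
  have hu : IsUnit (P.coeff 1) := by simp [hP, coeff_exp, coeff_one]
  have h1 := subst_substInvOfIsUnit_right (P := P) hP0 hu
  have hs' : HasSubst (P.substInvOfIsUnit hu) := HasSubst.substInvOfIsUnit ..
  have h2 := subst_comp_subst_apply hs hs' (PowerSeries.log K)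
  rw [aux_log_exp, h1, X_subst, subst_X hs'] at h2
  rw [← h2, h1]

open PowerSeries in
theorem aux_coeff_pow {p : ℕ} [Fact p.Prime] (t : ℝ) (ht : 0 < t) (G : PowerSeries ℚ_[p])
    (hG : ∀ n, ‖coeff n G‖ * t ^ n ≤ t) (k n : ℕ) : ‖coeff n (G ^ k)‖ * t ^ n ≤ t ^ k := by
  induction k generalizing n with
  | zero =>
    rw [pow_zero, coeff_one]
    split_ifs with h
    · simp [h]
    · simp
  | succ k ih =>
    rw [pow_succ, coeff_mul]
    obtain ⟨i, hi, h⟩ := IsUltrametricDist.exists_norm_finsetSum_le_of_nonempty (t := Finset.HasAntidiagonal.antidiagonal n)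
      ⟨(0, n), by simp [Finset.HasAntidiagonal.mem_antidiagonal]⟩ (fun q => coeff q.1 (G ^ k) * coeff q.2 G)
    rw [Finset.HasAntidiagonal.mem_antidiagonal] at hi
    calc _ ≤ ‖coeff i.1 (G ^ k) * coeff i.2 G‖ * t ^ n := by gcongr
      _ = (‖coeff i.1 (G ^ k)‖ * t ^ i.1) * (‖coeff i.2 G‖ * t ^ i.2) := by
        rw [norm_mul, ← hi, pow_add]; ring
      _ ≤ t ^ k * t := by
        gcongr
        · exact ih _
        · exact hG _
      _ = _ := by ring

section comp
open PowerSeries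
variable {p : ℕ} [Fact p.Prime] {A : Type*} [NormedRing A] [NormedAlgebra ℚ_[p] A] [CompleteSpace A]

theorem aux_summ (t C D : ℝ) (ht : 0 < t) (ht1 : t < 1) (x : A) (hx : ∀ n, ‖x ^ n‖ ≤ C * t ^ (2 * n))
    (a : ℕ → ℚ_[p]) (ha : ∀ n, ‖a n‖ * t ^ n ≤ D) : Summable (fun n => ‖a n • x ^ n‖) := by
  refine Summable.of_nonneg_of_le (fun _ => norm_nonneg _) (fun n => ?_)
    ((summable_geometric_of_lt_one ht.le ht1).mul_left (D * C))
  have hC : 0 ≤ C := by have := (norm_nonneg _).trans (hx 0); simpa using this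
  calc _ ≤ ‖a n‖ * ‖x ^ n‖ := norm_smul_le _ _
    _ ≤ ‖a n‖ * (C * t ^ (2 * n)) := by gcongr; exact hx n
    _ = (‖a n‖ * t ^ n) * (C * t ^ n) := by rw [two_mul, pow_add]; ring
    _ ≤ D * (C * t ^ n) := by gcongr; exact ha n
    _ = _ := by ring

theorem aux_ev_pow (t C : ℝ) (ht : 0 < t) (ht1 : t < 1) (x : A) (hx : ∀ n, ‖x ^ n‖ ≤ C * t ^ (2 * n))
    (G : PowerSeries ℚ_[p]) (hG : ∀ n, ‖coeff n G‖ * t ^ n ≤ t) (k : ℕ) :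
    ∑' n, coeff n (G ^ k) • x ^ n = (∑' n, coeff n G • x ^ n) ^ k := by
  induction k with
  | zero =>
    rw [pow_zero, pow_zero, tsum_eq_single 0]
    · simp
    · intro n hn
      simp [coeff_one, hn]
  | succ k ih =>
    rw [pow_succ (∑' n, coeff n G • x ^ n), ← ih,
      tsum_mul_tsum_eq_tsum_sum_antidiagonal_of_summable_norm
        (aux_summ t C _ ht ht1 x hx _ (fun n => aux_coeff_pow t ht G hG k n))
        (aux_summ t C _ ht ht1 x hx _ hG)]
    congr 1; ext n
    rw [pow_succ, coeff_mul, Finset.sum_smul]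
    apply Finset.sum_congr rfl
    intro q hq
    rw [Finset.HasAntidiagonal.mem_antidiagonal] at hq
    rw [smul_mul_smul_comm, ← pow_add, hq]

set_option maxHeartbeats 1000000 in
theorem aux_comp (q C : ℝ) (hq : 0 < q) (hq1 : q < 1) (x : A)
    (hx : ∀ n, ‖x ^ n‖ ≤ C * (q ^ 2) ^ (2 * n))
    (F G : PowerSeries ℚ_[p]) (hG0 : constantCoeff G = 0)
    (hF : ∀ n, ‖coeff n F‖ * (q ^ 2) ^ n ≤ q ^ 2)
    (hG : ∀ n, ‖coeff n G‖ * (q ^ 2) ^ n ≤ q ^ 2) (hFG : F.subst G = X) :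
    ∑' k, coeff k F • (∑' n, coeff n G • x ^ n) ^ k = x := by
  have ht : 0 < q ^ 2 := by positivity
  have ht1 : q ^ 2 < 1 := by nlinarith
  have hC : 0 ≤ C := by have := (norm_nonneg _).trans (hx 0); simpa using this
  have hv : ∀ n k, n < k → coeff n (G ^ k) = 0 := by
    intro n k hnk
    have : (X : PowerSeries ℚ_[p]) ^ k ∣ G ^ k := pow_dvd_pow_of_dvd (X_dvd_iff.2 hG0) k
    exact (X_pow_dvd_iff.1 this) n hnk
  have hsum : Summable (fun z : ℕ × ℕ => (coeff z.1 F * coeff z.2 (G ^ z.1)) • x ^ z.2) := by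
    have hg := summable_geometric_of_lt_one hq.le hq1
    refine Summable.of_norm_bounded
      ((hg.mul_of_nonneg hg (fun _ => by positivity) (fun _ => by positivity)).mul_left C) ?_
    rintro ⟨k, n⟩
    dsimp only
    rcases lt_or_ge n k with h | h
    · rw [hv n k h]; simp; positivity
    · have h1 := aux_coeff_pow _ ht G hG k n
      have h2 := hF k
      calc _ ≤ ‖coeff k F * coeff n (G ^ k)‖ * ‖x ^ n‖ := norm_smul_le _ _
        _ ≤ ‖coeff k F * coeff n (G ^ k)‖ * (C * (q ^ 2) ^ (2 * n)) := by gcongr; exact hx n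
        _ = ‖coeff k F‖ * (‖coeff n (G ^ k)‖ * (q ^ 2) ^ n) * (C * (q ^ 2) ^ n) := by
          rw [norm_mul]; ring
        _ ≤ ‖coeff k F‖ * ((q ^ 2) ^ k) * (C * (q ^ 2) ^ n) := by gcongr
        _ ≤ 1 * (C * (q ^ 2) ^ n) := by gcongr; exact h2.trans ht1.le
        _ = C * (q ^ n * q ^ n) := by ring
        _ ≤ C * (q ^ k * q ^ n) := by
          gcongr C * (?_ * _)
          exact pow_le_pow_of_le_one hq.le hq1.le h
  have e1 : ∀ k, coeff k F • (∑' n, coeff n G • x ^ n) ^ k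
      = ∑' n, (coeff k F * coeff n (G ^ k)) • x ^ n := by
    intro k
    rw [← aux_ev_pow _ C ht ht1 x hx G hG k, ← tsum_const_smul'']
    simp only [mul_smul]
  have e2 : ∀ n, ∑' k, (coeff k F * coeff n (G ^ k)) • x ^ n
      = coeff n (X : PowerSeries ℚ_[p]) • x ^ n := by
    intro n
    have hs : HasSubst G := HasSubst.of_constantCoeff_zero' hG0
    have hz : ∀ k ∉ Finset.range (n + 1), coeff n (G ^ k) = 0 := fun k hk => hv n k (by simpa using hk)
    rw [← hFG, coeff_subst' hs, tsum_eq_sum (s := Finset.range (n + 1)),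
      finsum_eq_sum_of_support_subset (s := Finset.range (n + 1)), Finset.sum_smul]
    · simp only [smul_eq_mul]
    · intro k hk
      by_contra h
      exact hk (by simp only [smul_eq_mul]; rw [hz k (by simpa using h), mul_zero])
    · intro k hk
      rw [hz k hk]; simp
  simp_rw [e1]
  rw [← Summable.tsum_comm (f := fun k n => (coeff k F * coeff n (G ^ k)) • x ^ n) hsum]
  simp_rw [e2]
  rw [tsum_eq_single 1]
  · simp
  · intro n hn
    simp [coeff_X, hn]
end comp
theorem aux_dvd {p : ℕ} [Fact p.Prime] {N : ℕ} (M : Matrix (Fin N) (Fin N) ℤ_[p]) :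
    (∀ i j, (p : ℤ_[p]) ∣ M i j) ↔ (PadicInt.toZMod (p := p)).mapMatrix M = 0 := by
  have h : ∀ a : ℤ_[p], (p : ℤ_[p]) ∣ a ↔ PadicInt.toZMod a = 0 := by
    intro a
    rw [← RingHom.mem_ker, PadicInt.ker_toZMod, PadicInt.maximalIdeal_eq_span_p,
      Ideal.mem_span_singleton]
  constructor
  · intro H
    ext i j
    simpa using (h _).1 (H i j)
  · intro H i j
    rw [h]
    simpa using congrFun (congrFun H i) j

theorem aux_nilp_iff {p : ℕ} [Fact p.Prime] {N : ℕ} (x : Matrix (Fin N) (Fin N) ℤ_[p]) :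
    ResNilp x ↔ IsNilpotent ((PadicInt.toZMod (p := p)).mapMatrix x) := by
  constructor
  · rintro ⟨m, hm, h⟩
    refine ⟨m, ?_⟩
    rw [← map_pow]
    exact (aux_dvd _).1 h
  · rintro ⟨m, h⟩
    refine ⟨m + 1, by omega, (aux_dvd _).2 ?_⟩
    rw [map_pow, pow_succ, h, zero_mul]

theorem aux_pow_N {p : ℕ} [Fact p.Prime] {N : ℕ} (x : Matrix (Fin N) (Fin N) ℤ_[p])
    (hx : ResNilp x) : ∃ w : Matrix (Fin N) (Fin N) ℤ_[p], x ^ N = (p : ℤ_[p]) • w := by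
  have h := (aux_nilp_iff x).1 hx
  have h1 := (Matrix.isNilpotent_charpoly_sub_pow_of_isNilpotent h).eq_zero
  have h2 : ((PadicInt.toZMod (p := p)).mapMatrix x) ^ N = 0 := by
    have h3 := Matrix.aeval_self_charpoly ((PadicInt.toZMod (p := p)).mapMatrix x)
    rw [sub_eq_zero.1 h1] at h3
    simpa using h3
  rw [← map_pow] at h2
  choose w hw using (aux_dvd _).2 h2
  refine ⟨Matrix.of w, ?_⟩
  ext i j
  simp [hw i j]

theorem aux_unip_iff {p : ℕ} [Fact p.Prime] {N : ℕ} (hN : 1 ≤ N) (u : Matrix (Fin N) (Fin N) ℤ_[p]) :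
    ResUnip u ↔ ResNilp (u - 1) := by
  have : Nonempty (Fin N) := ⟨⟨0, hN⟩⟩
  have : CharP (Matrix (Fin N) (Fin N) (ZMod p)) p := inferInstance
  have key : ∀ m : ℕ, ((PadicInt.toZMod (p := p)).mapMatrix (u - 1)) ^ (p ^ m) =
      (PadicInt.toZMod (p := p)).mapMatrix (u ^ (p ^ m) - 1) := by
    intro m
    rw [map_sub, map_one, map_sub, map_pow, map_one,
      sub_pow_char_pow_of_commute (p := p) (h := Commute.one_right _), one_pow]
  rw [aux_nilp_iff]
  constructor
  · rintro ⟨-, m, h⟩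
    exact ⟨p ^ m, by rw [key]; exact (aux_dvd _).1 h⟩
  · intro h
    refine ⟨?_, ?_⟩
    · have h1 := h.isUnit_one_add
      rw [map_sub, map_one, add_sub_cancel, Matrix.isUnit_iff_isUnit_det, ← RingHom.map_det] at h1
      rw [Matrix.isUnit_iff_isUnit_det]
      by_contra h2
      have : PadicInt.toZMod (Matrix.det u) = 0 := by
        rw [← RingHom.mem_ker, PadicInt.ker_toZMod]
        exact h2
      rw [this] at h1
      exact not_isUnit_zero h1
    · obtain ⟨m, hm⟩ := h
      refine ⟨m, (aux_dvd _).2 ?_⟩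
      rw [← key]
      exact pow_eq_zero_of_le (Nat.lt_pow_self (Fact.out : p.Prime).one_lt).le hm

theorem aux_norm_fact {p : ℕ} [Fact p.Prime] {N : ℕ} (hN : 1 ≤ N) (hp : 2 * N < p) (k : ℕ) :
    ‖(((k + 1).factorial : ℕ) : ℚ_[p])⁻¹‖ ≤ (p : ℝ) ^ (k / (2 * N)) := by
  have h1 := sub_one_mul_padicValNat_factorial_lt_of_ne_zero (p := p) (n := k + 1) (by omega)
  have hp1 : (1 : ℝ) ≤ p := by exact_mod_cast (Fact.out : p.Prime).one_le
  rw [norm_inv, Padic.norm_eq_zpow_neg_valuation (by exact_mod_cast Nat.factorial_ne_zero _),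
    Padic.valuation_natCast, zpow_neg, inv_inv, zpow_natCast]
  apply pow_le_pow_right₀ hp1
  rw [Nat.le_div_iff_mul_le (by omega), mul_comm]
  have : 2 * N ≤ p - 1 := by omega
  have := Nat.mul_le_mul_right (padicValNat p (k + 1).factorial) this
  omega

theorem aux_norm_nat {p : ℕ} [Fact p.Prime] {N : ℕ} (hN : 1 ≤ N) (hp : 2 * N < p) (k : ℕ) :
    ‖((k + 1 : ℕ) : ℚ_[p])⁻¹‖ ≤ (p : ℝ) ^ (k / (2 * N)) := by
  refine le_trans ?_ (aux_norm_fact hN hp k)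
  rw [Nat.factorial_succ]
  push_cast
  rw [mul_inv, norm_mul]
  have h : 1 ≤ ‖((k.factorial : ℕ) : ℚ_[p])⁻¹‖ := by
    rw [norm_inv]
    refine (one_le_inv₀ ?_).2 ?_
    · rw [norm_pos_iff]; exact_mod_cast Nat.factorial_ne_zero _
    · have := PadicInt.norm_le_one ((k.factorial : ℕ) : ℤ_[p])
      rwa [PadicInt.norm_def, PadicInt.coe_natCast] at this
  exact le_mul_of_one_le_right (norm_nonneg _) h

theorem aux_pow_k {p : ℕ} [Fact p.Prime] {N : ℕ} (x w : Matrix (Fin N) (Fin N) ℤ_[p])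
    (hw : x ^ N = (p : ℤ_[p]) • w) (k : ℕ) :
    x ^ k = (p : ℤ_[p]) ^ (k / N) • (x ^ (k % N) * w ^ (k / N)) := by
  conv_lhs => rw [← Nat.mod_add_div k N, pow_add, pow_mul, hw, smul_pow, mul_smul_comm]

theorem aux_q {N : ℕ} (hN : 1 ≤ N) {p : ℕ} (hp : 2 * N < p) :
    ∃ q : ℝ, 0 < q ∧ q < 1 ∧ q ^ (4 * N) * p = 1 := by
  have hp0 : (0 : ℝ) < p := by exact_mod_cast (by omega : 0 < p)
  have hp1 : (1 : ℝ) < p := by exact_mod_cast (by omega : 1 < p)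
  refine ⟨((p : ℝ)⁻¹) ^ (((4 * N : ℕ) : ℝ)⁻¹), by positivity, ?_, ?_⟩
  · apply Real.rpow_lt_one (by positivity) (inv_lt_one_of_one_lt₀ hp1)
    have : (0 : ℝ) < ((4 * N : ℕ) : ℝ) := by exact_mod_cast (by omega)
    positivity
  · rw [Real.rpow_inv_natCast_pow (by positivity) (by omega)]
    exact inv_mul_cancel₀ hp0.ne'

theorem aux_coef {N : ℕ} (hN : 1 ≤ N) {p : ℕ} [Fact p.Prime] (q : ℝ) (hq : 0 < q) (hq1 : q < 1)
    (hqp : q ^ (4 * N) * p = 1) (a : ℕ → ℚ_[p]) (ha0 : a 0 = 0)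
    (ha : ∀ k, ‖a (k + 1)‖ ≤ (p : ℝ) ^ (k / (2 * N))) (n : ℕ) :
    ‖a n‖ * (q ^ 2) ^ n ≤ q ^ 2 := by
  cases n with
  | zero => rw [ha0]; simp; positivity
  | succ k =>
    have h1 : (q ^ 2) ^ k ≤ (q ^ (4 * N)) ^ (k / (2 * N)) := by
      rw [← pow_mul, ← pow_mul]
      apply pow_le_pow_of_le_one hq.le hq1.le
      have := Nat.mul_div_le k (2 * N)
      nlinarith
    calc _ = ‖a (k + 1)‖ * (q ^ 2) ^ k * q ^ 2 := by ring
      _ ≤ (p : ℝ) ^ (k / (2 * N)) * (q ^ (4 * N)) ^ (k / (2 * N)) * q ^ 2 := by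
        gcongr
        exact ha k
      _ = (q ^ (4 * N) * p) ^ (k / (2 * N)) * q ^ 2 := by rw [mul_pow]; ring
      _ = q ^ 2 := by rw [hqp]; simp

attribute [local instance] Matrix.linftyOpNormedRing Matrix.linftyOpNormedAlgebra

theorem aux_norm_int {p : ℕ} [Fact p.Prime] {N : ℕ} (x : Matrix (Fin N) (Fin N) ℤ_[p]) :
    ‖matQ x‖ ≤ N := by
  have : ‖matQ x‖₊ ≤ N := by
    rw [Matrix.linfty_opNNNorm_def]
    apply Finset.sup_le
    intro i _
    calc _ ≤ ∑ j : Fin N, (1 : NNReal) := by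
          apply Finset.sum_le_sum
          intro j _
          exact PadicInt.norm_le_one (x i j)
      _ = N := by simp
  exact_mod_cast this

theorem aux_matQ_eq {p : ℕ} [Fact p.Prime] {N : ℕ} (x : Matrix (Fin N) (Fin N) ℤ_[p]) :
    matQ x = (PadicInt.Coe.ringHom (p := p)).mapMatrix x := rfl

theorem aux_norm_pow {p : ℕ} [Fact p.Prime] {N : ℕ} (hN : 1 ≤ N) (q : ℝ) (hq : 0 < q) (hq1 : q < 1)
    (hqp : q ^ (4 * N) * p = 1) (x : Matrix (Fin N) (Fin N) ℤ_[p]) (hx : ResNilp x) (n : ℕ) :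
    ‖matQ x ^ n‖ ≤ (N * p) * (q ^ 2) ^ (2 * n) := by
  obtain ⟨w, hw⟩ := aux_pow_N x hx
  have hp0 : (0 : ℝ) < p := by exact_mod_cast (Fact.out : p.Prime).pos
  have h1 : matQ x ^ n = (p : ℚ_[p]) ^ (n / N) • matQ (x ^ (n % N) * w ^ (n / N)) := by
    rw [aux_matQ_eq, ← map_pow, aux_pow_k x w hw n]
    ext i j
    have e : ∀ y : ℤ_[p], PadicInt.Coe.ringHom y = (y : ℚ_[p]) := fun _ => rfl
    simp [matQ, e]
  rw [h1]
  have h2 : q ^ (4 * N * (n / N)) * q ^ (4 * N) ≤ (q ^ 2) ^ (2 * n) := by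
    rw [← pow_add, ← pow_mul]
    apply pow_le_pow_of_le_one hq.le hq1.le
    have := Nat.lt_mul_div_succ n (show 0 < N by omega)
    nlinarith
  have h3 : (p : ℝ)⁻¹ = q ^ (4 * N) := (eq_inv_of_mul_eq_one_left hqp).symm
  calc _ ≤ ‖(p : ℚ_[p]) ^ (n / N)‖ * ‖matQ (x ^ (n % N) * w ^ (n / N))‖ := norm_smul_le _ _
    _ ≤ ‖(p : ℚ_[p]) ^ (n / N)‖ * N := by gcongr; exact aux_norm_int _
    _ = q ^ (4 * N * (n / N)) * N := by rw [norm_pow, Padic.norm_p, h3, ← pow_mul]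
    _ = N * p * (q ^ (4 * N * (n / N)) * q ^ (4 * N)) := by
      linear_combination (-(N : ℝ) * q ^ (4 * N * (n / N))) * hqp
    _ ≤ _ := by gcongr

theorem aux_int {p : ℕ} [Fact p.Prime] {N : ℕ} (hN : 1 ≤ N) (hp : 2 * N < p)
    (a : ℕ → ℚ_[p]) (ha0 : a 0 = 0) (ha : ∀ k, ‖a (k + 1)‖ ≤ (p : ℝ) ^ (k / (2 * N)))
    (x : Matrix (Fin N) (Fin N) ℤ_[p]) (hx : ResNilp x) :
    ∃ y : Matrix (Fin N) (Fin N) ℤ_[p], ResNilp y ∧ HasSum (fun k => a k • matQ x ^ k) (matQ y) := by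
  obtain ⟨w, hw⟩ := aux_pow_N x hx
  have hp0 : (0 : ℝ) < p := by exact_mod_cast (Fact.out : p.Prime).pos
  have hp1 : (1 : ℝ) < p := by exact_mod_cast (Fact.out : p.Prime).one_lt
  have hb : ∀ k, ‖a (k + 1) * (p : ℚ_[p]) ^ (k / N)‖ ≤ ((p : ℝ)⁻¹) ^ (k / (2 * N)) := by
    intro k
    have h1 : 2 * (k / (2 * N)) ≤ k / N := by
      rw [Nat.le_div_iff_mul_le (by omega)]
      have := Nat.mul_div_le k (2 * N)
      nlinarith
    rw [norm_mul, norm_pow, Padic.norm_p]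
    calc _ ≤ (p : ℝ) ^ (k / (2 * N)) * ((p : ℝ)⁻¹) ^ (2 * (k / (2 * N))) := by
          gcongr ?_ * ?_
          · exact ha k
          · exact pow_le_pow_of_le_one (by positivity) (inv_lt_one_of_one_lt₀ hp1).le h1
      _ = ((p : ℝ) * (p : ℝ)⁻¹) ^ (k / (2 * N)) * ((p : ℝ)⁻¹) ^ (k / (2 * N)) := by
          rw [mul_pow]; ring
      _ = _ := by rw [mul_inv_cancel₀ hp0.ne', one_pow, one_mul]
  have hb1 : ∀ k, ‖a (k + 1) * (p : ℚ_[p]) ^ (k / N)‖ ≤ 1 := fun k =>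
    (hb k).trans (pow_le_one₀ (by positivity) (inv_lt_one_of_one_lt₀ hp1).le)
  let b : ℕ → ℤ_[p] := fun k => ⟨_, hb1 k⟩
  let c : ℕ → Matrix (Fin N) (Fin N) ℤ_[p] := fun k => x ^ (k % N) * w ^ (k / N)
  have hlim : Filter.Tendsto (fun k : ℕ => ((p : ℝ)⁻¹) ^ (k / (2 * N))) Filter.atTop (nhds 0) :=
    (tendsto_pow_atTop_nhds_zero_of_lt_one (by positivity) (inv_lt_one_of_one_lt₀ hp1)).comp
      (Nat.tendsto_div_const_atTop (by omega))
  have hs : Summable (fun k => b k • c k) := by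
    refine Pi.summable.2 (fun i => Pi.summable.2 (fun j => ?_))
    apply NonarchimedeanAddGroup.summable_of_tendsto_cofinite_zero
    rw [Nat.cofinite_eq_atTop]
    refine squeeze_zero_norm (fun k => ?_) hlim
    calc ‖b k * c k i j‖ = ‖b k‖ * ‖c k i j‖ := norm_mul _ _
      _ ≤ ‖b k‖ * 1 := by gcongr; exact PadicInt.norm_le_one _
      _ ≤ _ := by rw [mul_one]; exact hb k
  obtain ⟨z, hz⟩ := hs
  have hpz : (p : ℤ_[p]) ≠ 0 := by exact_mod_cast (Fact.out : p.Prime).ne_zero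
  have hxw : Commute x w := by
    have h1 : (p : ℤ_[p]) • (x * w) = (p : ℤ_[p]) • (w * x) := by
      rw [← mul_smul_comm, ← smul_mul_assoc, ← hw, ← pow_succ, ← pow_succ']
    ext i j
    have h2 := congrFun (congrFun h1 i) j
    exact mul_left_cancel₀ hpz h2
  have hcomm : ∀ k, x * (b k • c k) = (b k • c k) * x := by
    intro k
    have : Commute x (c k) := ((Commute.refl x).pow_right _).mul_right (hxw.pow_right _)
    rw [mul_smul_comm, smul_mul_assoc, this.eq]
  have hz1 := hz.mul_left x
  have hz2 := hz.mul_right x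
  have hxz : Commute x z := by
    simp_rw [← hcomm] at hz2
    exact hz1.unique hz2
  refine ⟨x * z, ?_, ?_⟩
  · rw [aux_nilp_iff] at hx ⊢
    rw [map_mul]
    exact Commute.isNilpotent_mul_right (hxz.map _) hx
  · have hc : Continuous (matQ : Matrix (Fin N) (Fin N) ℤ_[p] → Matrix (Fin N) (Fin N) ℚ_[p]) := by
      have : Continuous (fun a : ℤ_[p] => (a : ℚ_[p])) := continuous_subtype_val
      exact continuous_id.matrix_map this
    have hm := hz1.map (PadicInt.Coe.ringHom (p := p)).mapMatrix hc
    rw [← hasSum_nat_add_iff' 1]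
    have e0 : matQ (x * z) - ∑ i ∈ Finset.range 1, a i • matQ x ^ i = matQ (x * z) := by
      simp [ha0]
    rw [e0]
    refine Eq.mp (congrArg (fun f => HasSum f (matQ (x * z))) ?_) hm
    funext k
    have e1 : (PadicInt.Coe.ringHom (p := p)).mapMatrix (b k • c k)
        = a (k + 1) • matQ (x ^ k) := by
      rw [aux_pow_k x w hw k]
      ext i j
      change ((b k * c k i j : ℤ_[p]) : ℚ_[p]) = a (k + 1) * (((p : ℤ_[p]) ^ (k / N) * c k i j : ℤ_[p]) : ℚ_[p])
      rw [PadicInt.coe_mul, PadicInt.coe_mul, PadicInt.coe_pow, PadicInt.coe_natCast, ← mul_assoc]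
    simp only [Function.comp_apply]
    rw [map_mul, e1, pow_succ' (matQ x), aux_matQ_eq, aux_matQ_eq, map_pow, mul_smul_comm]

/-- **Lemma (exp/log correspondence for residually nilpotent/unipotent matrices).**
Let `N ≥ 1` and `p > 2N`. Then `exp` converges on residually nilpotent elements of
`gl(N, ℤ_[p])` with residually unipotent sums in `GL(N, ℤ_[p])`, `log` converges on
residually unipotent elements of `GL(N, ℤ_[p])` with residually nilpotent sums in
`gl(N, ℤ_[p])`, and `exp` and `log` are mutually inverse bijections between these sets. -/
theorem stmt_8 (N : ℕ) (hN : 1 ≤ N) (p : ℕ) [Fact p.Prime] (hp : 2 * N < p) :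
    (∀ x : Matrix (Fin N) (Fin N) ℤ_[p], ResNilp x →
      Summable (fun k : ℕ => ((k.factorial : ℚ_[p]))⁻¹ • (matQ x) ^ k) ∧
      ∃ u : Matrix (Fin N) (Fin N) ℤ_[p], ResUnip u ∧ matQ u = matExp (matQ x)) ∧
    (∀ u : Matrix (Fin N) (Fin N) ℤ_[p], ResUnip u →
      Summable (fun k : ℕ => ((k : ℚ_[p]))⁻¹ • (1 - matQ u) ^ k) ∧
      ∃ x : Matrix (Fin N) (Fin N) ℤ_[p], ResNilp x ∧ matQ x = matLog (matQ u)) ∧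
    (∀ x : Matrix (Fin N) (Fin N) ℤ_[p], ResNilp x → matLog (matExp (matQ x)) = matQ x) ∧
    (∀ u : Matrix (Fin N) (Fin N) ℤ_[p], ResUnip u → matExp (matLog (matQ u)) = matQ u) := by
  have hAQ : ∀ r : ℚ, algebraMap ℚ ℚ_[p] r = (r : ℚ_[p]) := fun r => by simp
  let E : PowerSeries ℚ_[p] := PowerSeries.exp ℚ_[p] - 1
  let L : PowerSeries ℚ_[p] := PowerSeries.log ℚ_[p]
  have hE0 : PowerSeries.coeff 0 E = 0 := by simp [E]
  have hL0 : PowerSeries.coeff 0 L = 0 := by simp [L]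
  have hEs : ∀ k, PowerSeries.coeff (k + 1) E = (((k + 1).factorial : ℕ) : ℚ_[p])⁻¹ := by
    intro k
    simp [E, PowerSeries.coeff_exp, PowerSeries.coeff_one]
  have hLk : ∀ k, PowerSeries.coeff k L = -((-1) ^ k * (k : ℚ_[p])⁻¹) := by
    intro k
    rcases Nat.eq_zero_or_pos k with rfl | hk
    · simp [L]
    · simp [L, PowerSeries.coeff_log, hk.ne', pow_succ, div_eq_mul_inv]
  have hEn : ∀ k, ‖PowerSeries.coeff (k + 1) E‖ ≤ (p : ℝ) ^ (k / (2 * N)) := by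
    intro k
    rw [hEs]
    exact aux_norm_fact hN hp k
  have hLn : ∀ k, ‖PowerSeries.coeff (k + 1) L‖ ≤ (p : ℝ) ^ (k / (2 * N)) := by
    intro k
    rw [hLk, norm_neg, norm_mul, norm_pow, norm_neg, norm_one, one_pow, one_mul]
    exact aux_norm_nat hN hp k
  have hsub : ∀ u : Matrix (Fin N) (Fin N) ℤ_[p], matQ (u - 1) = matQ u - 1 := by
    intro u
    rw [aux_matQ_eq, aux_matQ_eq, map_sub, map_one]
  -- exp
  have hexp : ∀ x : Matrix (Fin N) (Fin N) ℤ_[p], ResNilp x →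
      ∃ y : Matrix (Fin N) (Fin N) ℤ_[p], ResNilp y ∧
        HasSum (fun k => PowerSeries.coeff k E • matQ x ^ k) (matQ y) ∧
        HasSum (fun k : ℕ => ((k.factorial : ℚ_[p]))⁻¹ • (matQ x) ^ k) (1 + matQ y) := by
    intro x hx
    obtain ⟨y, hy, hs⟩ := aux_int hN hp (fun k => PowerSeries.coeff k E) hE0 hEn x hx
    refine ⟨y, hy, hs, ?_⟩
    have h1 := (hasSum_ite_eq (0 : ℕ) (1 : Matrix (Fin N) (Fin N) ℚ_[p])).add hs
    convert h1 using 1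
    ext1 k
    cases k with
    | zero => simp [hE0]
    | succ k => rw [hEs]; simp
  have hlog : ∀ u : Matrix (Fin N) (Fin N) ℤ_[p], ResUnip u →
      ∃ y : Matrix (Fin N) (Fin N) ℤ_[p], ResNilp y ∧
        HasSum (fun k => PowerSeries.coeff k L • matQ (u - 1) ^ k) (matQ y) ∧
        HasSum (fun k : ℕ => ((k : ℚ_[p]))⁻¹ • (1 - matQ u) ^ k) (-matQ y) := by
    intro u hu
    obtain ⟨y, hy, hs⟩ := aux_int hN hp (fun k => PowerSeries.coeff k L) hL0 hLn (u - 1)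
      ((aux_unip_iff hN u).1 hu)
    refine ⟨y, hy, hs, ?_⟩
    refine Eq.mp (congrArg (fun f => HasSum f (-matQ y)) ?_) hs.neg
    funext k
    rw [hLk, hsub, ← neg_sub (1 : Matrix (Fin N) (Fin N) ℚ_[p]) (matQ u), neg_pow (1 - matQ u), neg_smul, neg_neg]
    have h1 : ((-1 : Matrix (Fin N) (Fin N) ℚ_[p])) ^ k = ((-1 : ℚ_[p]) ^ k) • 1 := by
      rw [← one_pow (M := Matrix (Fin N) (Fin N) ℚ_[p]) k, ← smul_pow, neg_smul, one_smul, one_pow]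
    rw [h1, smul_mul_assoc, one_mul, smul_smul, mul_right_comm, ← mul_pow]
    simp
  have hexp' : ∀ x : Matrix (Fin N) (Fin N) ℤ_[p], ResNilp x →
      ∃ u : Matrix (Fin N) (Fin N) ℤ_[p], ResUnip u ∧ matQ u = matExp (matQ x) ∧
        matQ (u - 1) = ∑' k, PowerSeries.coeff k E • matQ x ^ k := by
    intro x hx
    obtain ⟨y, hy, h1, h2⟩ := hexp x hx
    refine ⟨1 + y, (aux_unip_iff hN _).2 (by simpa using hy), ?_, ?_⟩
    · rw [matExp, h2.tsum_eq, aux_matQ_eq, aux_matQ_eq, map_add, map_one]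
    · rw [h1.tsum_eq, add_sub_cancel_left]
  obtain ⟨q, hq, hq1, hqp⟩ := aux_q hN hp
  have hEq := aux_coef hN q hq hq1 hqp (fun k => PowerSeries.coeff k E) hE0 hEn
  have hLq := aux_coef hN q hq hq1 hqp (fun k => PowerSeries.coeff k L) hL0 hLn
  have hcomplete : @CompleteSpace (Matrix (Fin N) (Fin N) ℚ_[p])
      (Matrix.linftyOpNormedRing.toMetricSpace.toPseudoMetricSpace.toUniformSpace) :=
    FiniteDimensional.complete ℚ_[p] _
  refine ⟨fun x hx => ?_, fun u hu => ?_, fun x hx => ?_, fun u hu => ?_⟩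
  · obtain ⟨y, hy, h1, h2⟩ := hexp x hx
    obtain ⟨u, hu, h3, h4⟩ := hexp' x hx
    exact ⟨h2.summable, u, hu, h3⟩
  · obtain ⟨y, hy, h1, h2⟩ := hlog u hu
    exact ⟨h2.summable, y, hy, by rw [matLog, h2.tsum_eq, neg_neg]⟩
  · obtain ⟨u, hu, h3, h4⟩ := hexp' x hx
    obtain ⟨y, hy, h1, h2⟩ := hlog u hu
    rw [← h3, matLog, h2.tsum_eq, neg_neg, ← h1.tsum_eq, h4]
    exact aux_comp q _ hq hq1 (matQ x) (aux_norm_pow hN q hq hq1 hqp x hx) L E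
      (by simpa using hE0) hLq hEq aux_log_exp
  · obtain ⟨y, hy, h1, h2⟩ := hlog u hu
    obtain ⟨z, hz, h3, h4⟩ := hexp y hy
    have hun := (aux_unip_iff hN u).1 hu
    have h5 : matLog (matQ u) = matQ y := by rw [matLog, h2.tsum_eq, neg_neg]
    rw [h5, matExp, h4.tsum_eq, ← h3.tsum_eq, ← h1.tsum_eq]
    have h6 := aux_comp q _ hq hq1 (matQ (u - 1)) (aux_norm_pow hN q hq hq1 hqp _ hun) E L
      (by simpa using hL0) hEq hLq aux_exp_log
    rw [hsub] at h6 ⊢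
    refine (congrArg (fun m => 1 + m) h6).trans ?_
    simp
end
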